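/- Let p be an odd prime, q = p^f ≥ 5, and let a ∈ 𝔽_q* be such that the subfield of 𝔽_q generated by a is all of 𝔽_q, with a ≠ 2 and a ≠ −2. Let x = x(a) and y be the 8×8 matrices over 𝔽_q with rows x: [0,−1,0,0,0,0,0,0], [−1,0,0,0,0,0,0,0], [1,−1,−1,−a,0,0,0,0], [0,0,0,1,0,0,0,0], [0,0,0,1,0,−1,1,0], [0,0,0,−1,−1,0,−1,0], [0,0,0,−2,0,0,−1,0], [1,−1,−2,−2a,0,0,−a,1]; y: [1,0,0,0,0,0,0,0], [0,0,0,0,0,0,0,1], [0,0,0,0,0,1,0,0], [0,0,1,0,0,0,0,0], [0,0,0,0,1,0,0,0], [0,0,0,1,0,0,0,0], [0,1,0,0,0,0,0,0], [0,0,0,0,0,0,1,0]. Let Q⁺ be the quadratic form on 𝔽_q⁸ given by Q⁺(v) = v₁v₅ + v₂v₆ + v₃v₇ + v₄v₈, and let O(Q⁺) be the subgroup of GL₈(𝔽_q) of elements preserving Q⁺. Then x has order 2, y has order 3, and the subgroup of GL₈(𝔽_q) generated by x and y equals the derived subgroup of O(Q⁺), i.e., equals Ω₈⁺(q). In particular Ω₈⁺(q)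 is (2,3)-generated for all odd q ≥ 5. -/

import Mathlib

open Matrix

/-- A group is `(2,3)`-generated if it is generated by an element of order 2
together with an element of order 3. -/
def IsTwoThreeGenerated (G : Type*) [Group G] : Prop :=
  ∃ x y : G, orderOf x = 2 ∧ orderOf y = 3 ∧ Subgroup.closure {x, y} = ⊤

/-- The plus-type quadratic form `Q⁺(v) = v₁v₅ + v₂v₆ + v₃v₇ + v₄v₈` on `F⁸`. -/
def QPlus (F : Type*) [Field F] (v : Fin 8 → F) : F :=
  v 0 * v 4 + v 1 * v 5 + v 2 * v 6 + v 3 * v 7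

/-- The group of linear automorphisms of `F⁸` preserving the form `Q`,
as a subgroup of `GL₈(F)`. -/
def orthogonalGroupOf (F : Type*) [Field F] (Q : (Fin 8 → F) → F) :
    Subgroup (GL (Fin 8) F) where
  carrier := {g | ∀ v, Q ((g : Matrix (Fin 8) (Fin 8) F).mulVec v) = Q v}
  one_mem' := by
    intro v
    simp
  mul_mem' := by
    intro a b ha hb v
    have h : ((a * b : GL (Fin 8) F) : Matrix (Fin 8) (Fin 8) F).mulVec v
        = (a : Matrix (Fin 8) (Fin 8) F).mulVec
            ((b : Matrix (Fin 8) (Fin 8) F).mulVec v) := by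
      simp [Matrix.mulVec_mulVec]
    rw [h, ha, hb]
  inv_mem' := by
    intro a ha v
    have h1 : (a : Matrix (Fin 8) (Fin 8) F).mulVec
        (((a⁻¹ : GL (Fin 8) F) : Matrix (Fin 8) (Fin 8) F).mulVec v) = v := by
      rw [Matrix.mulVec_mulVec, ← Units.val_mul, mul_inv_cancel]
      simp
    calc Q (((a⁻¹ : GL (Fin 8) F) : Matrix (Fin 8) (Fin 8) F).mulVec v)
        = Q ((a : Matrix (Fin 8) (Fin 8) F).mulVec
            (((a⁻¹ : GL (Fin 8) F) : Matrix (Fin 8) (Fin 8) F).mulVec v)) := (ha _).symm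
      _ = Q v := by rw [h1]


/-- The generator `x = x(a)` of order 2 for `Ω₈⁺(q)` in odd characteristic. -/
def xPlusOdd (K : Type*) [Field K] (a : K) : Matrix (Fin 8) (Fin 8) K :=
  !![0, -1, 0, 0, 0, 0, 0, 0;
     -1, 0, 0, 0, 0, 0, 0, 0;
     1, -1, -1, -a, 0, 0, 0, 0;
     0, 0, 0, 1, 0, 0, 0, 0;
     0, 0, 0, 1, 0, -1, 1, 0;
     0, 0, 0, -1, -1, 0, -1, 0;
     0, 0, 0, -2, 0, 0, -1, 0;
     1, -1, -2, -2*a, 0, 0, -a, 1]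

/-- The generator `y` of order 3 for `Ω₈⁺(q)`. -/
def yPlus (K : Type*) [Field K] : Matrix (Fin 8) (Fin 8) K :=
  !![1, 0, 0, 0, 0, 0, 0, 0;
     0, 0, 0, 0, 0, 0, 0, 1;
     0, 0, 0, 0, 0, 1, 0, 0;
     0, 0, 1, 0, 0, 0, 0, 0;
     0, 0, 0, 0, 1, 0, 0, 0;
     0, 0, 0, 1, 0, 0, 0, 0;
     0, 1, 0, 0, 0, 0, 0, 0;
     0, 0, 0, 0, 0, 0, 1, 0]

set_option linter.unusedSimpArgs false

section Siegel

variable {F : Type*} [Field F]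

/-- The polar form of `QPlus`. -/
def polarForm (u v : Fin 8 → F) : F :=
  u 0 * v 4 + u 4 * v 0 + (u 1 * v 5 + u 5 * v 1) + (u 2 * v 6 + u 6 * v 2)
    + (u 3 * v 7 + u 7 * v 3)

theorem polarForm_comm (u v : Fin 8 → F) : polarForm u v = polarForm v u := by
  simp only [polarForm]; ring

@[simp] theorem polarForm_add_left (u v w : Fin 8 → F) :
    polarForm (u + v) w = polarForm u w + polarForm v w := by
  simp only [polarForm, Pi.add_apply]; ring

@[simp] theorem polarForm_add_right (u v w : Fin 8 → F) :
    polarForm w (u + v) = polarForm w u + polarForm w v := by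
  simp only [polarForm, Pi.add_apply]; ring

@[simp] theorem polarForm_sub_left (u v w : Fin 8 → F) :
    polarForm (u - v) w = polarForm u w - polarForm v w := by
  simp only [polarForm, Pi.sub_apply]; ring

@[simp] theorem polarForm_sub_right (u v w : Fin 8 → F) :
    polarForm w (u - v) = polarForm w u - polarForm w v := by
  simp only [polarForm, Pi.sub_apply]; ring

@[simp] theorem polarForm_smul_left (c : F) (u w : Fin 8 → F) :
    polarForm (c • u) w = c * polarForm u w := by
  simp only [polarForm, Pi.smul_apply, smul_eq_mul]; ring

@[simp] theorem polarForm_smul_right (c : F) (u w : Fin 8 → F) :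
    polarForm w (c • u) = c * polarForm w u := by
  simp only [polarForm, Pi.smul_apply, smul_eq_mul]; ring

@[simp] theorem polarForm_neg_left (u w : Fin 8 → F) :
    polarForm (-u) w = -polarForm u w := by
  simp only [polarForm, Pi.neg_apply]; ring

@[simp] theorem polarForm_neg_right (u w : Fin 8 → F) :
    polarForm w (-u) = -polarForm w u := by
  simp only [polarForm, Pi.neg_apply]; ring

@[simp] theorem polarForm_zero_right (w : Fin 8 → F) : polarForm w 0 = 0 := by
  simp [polarForm]

@[simp] theorem polarForm_zero_left (w : Fin 8 → F) : polarForm 0 w = 0 := by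
  simp [polarForm]

theorem polarForm_self (u : Fin 8 → F) : polarForm u u = 2 * QPlus F u := by
  simp only [polarForm, QPlus]; ring

theorem QPlus_add (u v : Fin 8 → F) :
    QPlus F (u + v) = QPlus F u + QPlus F v + polarForm u v := by
  simp only [polarForm, QPlus, Pi.add_apply]; ring

theorem QPlus_smul (c : F) (u : Fin 8 → F) : QPlus F (c • u) = c ^ 2 * QPlus F u := by
  simp only [QPlus, Pi.smul_apply, smul_eq_mul]; ring

theorem QPlus_neg (u : Fin 8 → F) : QPlus F (-u) = QPlus F u := by
  simp only [QPlus, Pi.neg_apply]; ring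

@[simp] theorem QPlus_zero : QPlus F (0 : Fin 8 → F) = 0 := by
  simp [QPlus]

/-- The Siegel transformation attached to `v` and `n`; it is an isometry when `v` is singular and
orthogonal to `n`. -/
def siegel (v n : Fin 8 → F) : Module.End F (Fin 8 → F) where
  toFun z := z + polarForm z v • n - polarForm z n • v - (QPlus F n * polarForm z v) • v
  map_add' z w := by
    simp only [polarForm_add_left]; module
  map_smul' c z := by
    simp only [polarForm_smul_left, RingHom.id_apply]; module

theorem siegel_apply (v n z : Fin 8 → F) :
    siegel v n z
      = z + polarForm z v • n - polarForm z n • v - (QPlus F n * polarForm z v) • v := rfl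

@[simp] theorem siegel_zero (v : Fin 8 → F) : siegel v 0 = 1 := by
  refine LinearMap.ext fun z => ?_
  simp [siegel_apply]

theorem siegel_mul {v n n' : Fin 8 → F} (hv : QPlus F v = 0) (hn : polarForm n v = 0)
    (hn' : polarForm n' v = 0) : siegel v n * siegel v n' = siegel v (n + n') := by
  have hvv : polarForm v v = 0 := by rw [polarForm_self, hv, mul_zero]
  refine LinearMap.ext fun z => ?_
  simp only [Module.End.mul_apply, siegel_apply, polarForm_add_left, polarForm_sub_left,
    polarForm_smul_left, polarForm_add_right, QPlus_add, hvv, hn, hn',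
    polarForm_comm v n, polarForm_comm n' n]
  module

theorem siegel_mul_neg {v n : Fin 8 → F} (hv : QPlus F v = 0) (hn : polarForm n v = 0) :
    siegel v n * siegel v (-n) = 1 := by
  rw [siegel_mul hv hn (by simp [hn]), add_neg_cancel, siegel_zero]

theorem siegel_pow {v n : Fin 8 → F} (hv : QPlus F v = 0) (hn : polarForm n v = 0) (k : ℕ) :
    siegel v n ^ k = siegel v ((k : F) • n) := by
  induction k with
  | zero => simp
  | succ k ih =>
    rw [pow_succ, ih, siegel_mul hv (by simp [hn]) hn]
    push_cast
    rw [add_smul, one_smul]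

theorem siegel_smul_left (c : F) (v n : Fin 8 → F) : siegel (c • v) n = siegel v (c • n) := by
  refine LinearMap.ext fun z => ?_
  simp only [siegel_apply, polarForm_smul_right, QPlus_smul]
  module

theorem siegel_swap {v n : Fin 8 → F} (hv : QPlus F v = 0) (hn : QPlus F n = 0) :
    siegel v n = siegel n (-v) := by
  refine LinearMap.ext fun z => ?_
  simp only [siegel_apply, polarForm_neg_right, QPlus_neg, hv, hn]
  module

/-- Adding a multiple of `v` to `n` does not change the Siegel transformation. -/
theorem siegel_add_smul_self {v n : Fin 8 → F} (hv : QPlus F v = 0) (hn : polarForm n v = 0)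
    (c : F) : siegel v (n + c • v) = siegel v n := by
  refine LinearMap.ext fun z => ?_
  simp only [siegel_apply, polarForm_add_right, polarForm_smul_right, QPlus_smul, QPlus_add, hv, hn]
  module

/-- Conjugation of Siegel transformations by isometries. -/
theorem siegel_conj {g g' : Module.End F (Fin 8 → F)} (hg : ∀ z, QPlus F (g z) = QPlus F z)
    (hgg : g * g' = 1) (v n : Fin 8 → F) :
    g * siegel v n * g' = siegel (g v) (g n) := by
  have hB : ∀ z w, polarForm (g z) (g w) = polarForm z w := by
    intro z w
    have h1 := QPlus_add (g z) (g w)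
    have h2 := QPlus_add z w
    rw [← map_add, hg, hg, hg, h2] at h1
    exact (add_left_cancel h1).symm
  have hz : ∀ z, g (g' z) = z := fun z => by
    rw [← Module.End.mul_apply, hgg, Module.End.one_apply]
  refine LinearMap.ext fun z => ?_
  have hzB : ∀ w, polarForm z (g w) = polarForm (g' z) w := fun w => by
    conv_lhs => rw [← hz z]
    exact hB _ _
  simp only [Module.End.mul_apply, siegel_apply, map_add, map_sub, map_smul, hz, hg, hzB]

/-- The commutator of two root elements whose planes meet the form in a rank one pairing. -/
theorem siegel_commutator {p q r s : Fin 8 → F} (hp : QPlus F p = 0) (hq : QPlus F q = 0)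
    (hr : QPlus F r = 0) (hs : QPlus F s = 0) (hpq : polarForm p q = 0) (hrs : polarForm r s = 0)
    (hqr : polarForm q r = 0) (hqs : polarForm q s = 0) (hps : polarForm p s = 0) :
    siegel q p * siegel s r * siegel q (-p) * siegel s (-r)
      = siegel q (polarForm p r • s) := by
  have h1 : polarForm p p = 0 := by rw [polarForm_self, hp, mul_zero]
  have h2 : polarForm q q = 0 := by rw [polarForm_self, hq, mul_zero]
  have h3 : polarForm r r = 0 := by rw [polarForm_self, hr, mul_zero]
  have h4 : polarForm s s = 0 := by rw [polarForm_self, hs, mul_zero]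
  refine LinearMap.ext fun z => ?_
  simp only [Module.End.mul_apply, siegel_apply, polarForm_add_left, polarForm_sub_left,
    polarForm_smul_left, polarForm_neg_left, polarForm_neg_right, polarForm_smul_right, QPlus_neg,
    QPlus_smul, hp, hr, hs, h1, h2, h3, h4, hpq, hrs, hqr, hqs, hps, polarForm_comm q p,
    polarForm_comm r q, polarForm_comm s q, polarForm_comm s p, polarForm_comm s r,
    polarForm_comm r p]
  module

end Siegel

section Wedge

variable {F : Type*} [Field F]

/-- The infinitesimal rotation `z ↦ B(z, v) w - B(z, w) v`. -/
def wedge (v w : Fin 8 → F) : Module.End F (Fin 8 → F) where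
  toFun z := polarForm z v • w - polarForm z w • v
  map_add' z z' := by
    simp only [polarForm_add_left]; module
  map_smul' c z := by
    simp only [polarForm_smul_left, RingHom.id_apply]; module

theorem wedge_apply (v w z : Fin 8 → F) :
    wedge v w z = polarForm z v • w - polarForm z w • v := rfl

theorem wedge_add_left (u v w : Fin 8 → F) : wedge (u + v) w = wedge u w + wedge v w := by
  refine LinearMap.ext fun z => ?_
  simp only [wedge_apply, LinearMap.add_apply, polarForm_add_right]; module

theorem wedge_add_right (u v w : Fin 8 → F) : wedge w (u + v) = wedge w u + wedge w v := by
  refine LinearMap.ext fun z => ?_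
  simp only [wedge_apply, LinearMap.add_apply, polarForm_add_right]; module

theorem wedge_smul_left (c : F) (v w : Fin 8 → F) : wedge (c • v) w = c • wedge v w := by
  refine LinearMap.ext fun z => ?_
  simp only [wedge_apply, LinearMap.smul_apply, polarForm_smul_right]; module

theorem wedge_smul_right (c : F) (v w : Fin 8 → F) : wedge v (c • w) = c • wedge v w := by
  refine LinearMap.ext fun z => ?_
  simp only [wedge_apply, LinearMap.smul_apply, polarForm_smul_right]; module

theorem wedge_neg_left (v w : Fin 8 → F) : wedge (-v) w = -wedge v w := by
  refine LinearMap.ext fun z => ?_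
  simp only [wedge_apply, LinearMap.neg_apply, polarForm_neg_right]; module

theorem wedge_neg_right (v w : Fin 8 → F) : wedge v (-w) = -wedge v w := by
  refine LinearMap.ext fun z => ?_
  simp only [wedge_apply, LinearMap.neg_apply, polarForm_neg_right]; module

theorem wedge_sub_left (u v w : Fin 8 → F) : wedge (u - v) w = wedge u w - wedge v w := by
  rw [sub_eq_add_neg, wedge_add_left, wedge_neg_left, sub_eq_add_neg]

theorem wedge_sub_right (u v w : Fin 8 → F) : wedge w (u - v) = wedge w u - wedge w v := by
  rw [sub_eq_add_neg, wedge_add_right, wedge_neg_right, sub_eq_add_neg]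

@[simp] theorem wedge_self (v : Fin 8 → F) : wedge v v = 0 := by
  refine LinearMap.ext fun z => ?_
  simp [wedge_apply]

theorem wedge_comm (v w : Fin 8 → F) : wedge w v = -wedge v w := by
  refine LinearMap.ext fun z => ?_
  simp [wedge_apply]

theorem siegel_eq_one_add_wedge {n : Fin 8 → F} (v : Fin 8 → F) (hn : QPlus F n = 0) :
    siegel v n = 1 + wedge v n := by
  refine LinearMap.ext fun z => ?_
  simp [siegel_apply, wedge_apply, hn]
  module

theorem wedge_mul_wedge {v w v' w' : Fin 8 → F} (h1 : polarForm v v' = 0)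
    (h2 : polarForm v w' = 0) (h3 : polarForm w v' = 0) (h4 : polarForm w w' = 0) :
    wedge v w * wedge v' w' = 0 := by
  refine LinearMap.ext fun z => ?_
  simp [wedge_apply, polarForm_comm v' v, polarForm_comm w' v, polarForm_comm v' w,
    polarForm_comm w' w, h1, h2, h3, h4]

/-- An endomorphism preserving the quadratic form. -/
def Preserves (g : Module.End F (Fin 8 → F)) : Prop := ∀ z, QPlus F (g z) = QPlus F z

theorem Preserves.polarForm {g : Module.End F (Fin 8 → F)} (hg : Preserves g)
    (z w : Fin 8 → F) : polarForm (g z) (g w) = polarForm z w := by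
  have h1 := QPlus_add (g z) (g w)
  have h2 := QPlus_add z w
  rw [← map_add, hg, hg, hg, h2] at h1
  exact (add_left_cancel h1).symm

theorem Preserves.mul {g h : Module.End F (Fin 8 → F)} (hg : Preserves g) (hh : Preserves h) :
    Preserves (g * h) := fun z => by
  rw [Module.End.mul_apply, hg, hh]

theorem siegel_preserves {v n : Fin 8 → F} (hv : QPlus F v = 0) (hn : polarForm n v = 0) :
    Preserves (siegel v n) := fun z => by
  have h2 : polarForm v v = 0 := by rw [polarForm_self, hv, mul_zero]
  rw [siegel_apply, sub_sub, sub_eq_add_neg, ← add_smul, ← neg_smul, QPlus_add, QPlus_add,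
    QPlus_smul, QPlus_smul, hv]
  simp only [polarForm_add_left, polarForm_smul_left, polarForm_smul_right, hn]
  ring

variable [Finite F] {H : Submonoid (Module.End F (Fin 8 → F))}

/-- In the finite endomorphism monoid, submonoids contain the inverses of their elements. -/
theorem inverse_mem {g g' : Module.End F (Fin 8 → F)} (hg : g ∈ H) (h : g * g' = 1) : g' ∈ H := by
  have : Finite (Module.End F (Fin 8 → F)) :=
    Finite.of_injective (fun g => (g : (Fin 8 → F) → (Fin 8 → F))) DFunLike.coe_injective
  have h' : g' * g = 1 := mul_eq_one_comm.mp h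
  let u : (Module.End F (Fin 8 → F))ˣ := ⟨g, g', h, h'⟩
  have hu : u ^ (orderOf u - 1) = u⁻¹ := by
    rw [eq_inv_iff_mul_eq_one, ← pow_succ, Nat.sub_add_cancel (orderOf_pos u), pow_orderOf_eq_one]
  have : g' = g ^ (orderOf u - 1) := by
    have := congrArg Units.val hu
    simpa [u] using this.symm
  rw [this]
  exact pow_mem hg _

theorem mem_of_mul_mem_left {g h : Module.End F (Fin 8 → F)} (hg : g ∈ H) (hu : IsUnit g)
    (h' : g * h ∈ H) : h ∈ H := by
  obtain ⟨u, rfl⟩ := hu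
  have := H.mul_mem (inverse_mem hg (u.mul_inv)) h'
  rwa [Units.inv_mul_cancel_left] at this

theorem isUnit_siegel {v n : Fin 8 → F} (hv : QPlus F v = 0) (hn : polarForm n v = 0) :
    IsUnit (siegel v n) :=
  IsUnit.of_mul_eq_one _ (siegel_mul_neg hv hn)

theorem siegel_neg_mem {v n : Fin 8 → F} (hv : QPlus F v = 0) (hn : polarForm n v = 0)
    (h : siegel v n ∈ H) : siegel v (-n) ∈ H :=
  inverse_mem h (siegel_mul_neg hv hn)

/-- Conjugation inside `H`. -/
theorem siegel_map_mem {g : Module.End F (Fin 8 → F)} (hg : g ∈ H) (hu : IsUnit g)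
    (hp : Preserves g) {v n : Fin 8 → F} (h : siegel v n ∈ H) : siegel (g v) (g n) ∈ H := by
  obtain ⟨u, rfl⟩ := hu
  rw [← siegel_conj hp u.mul_inv v n]
  exact H.mul_mem (H.mul_mem hg h) (inverse_mem hg u.mul_inv)

theorem siegel_commutator_mem {p q r s : Fin 8 → F} (hp : QPlus F p = 0) (hq : QPlus F q = 0)
    (hr : QPlus F r = 0) (hs : QPlus F s = 0) (hpq : polarForm p q = 0) (hrs : polarForm r s = 0)
    (hqr : polarForm q r = 0) (hqs : polarForm q s = 0) (hps : polarForm p s = 0)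
    (h1 : siegel q p ∈ H) (h2 : siegel s r ∈ H) : siegel q (polarForm p r • s) ∈ H := by
  rw [← siegel_commutator hp hq hr hs hpq hrs hqr hqs hps]
  exact H.mul_mem (H.mul_mem (H.mul_mem h1 h2) (siegel_neg_mem hq hpq h1))
    (siegel_neg_mem hs hrs h2)

end Wedge

section Extraction

open Polynomial

variable {F : Type*} [Field F] [Finite F]

/-- A separable polynomial over a finite field divides some `X ^ p ^ m - X`. -/
theorem exists_dvd_X_pow_sub_X (p : ℕ) [hp : Fact p.Prime] [CharP F p] {r : F[X]}
    (hr : r.Separable) : ∃ m : ℕ, 0 < m ∧ r ∣ X ^ p ^ m - X := by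
  classical
  let L := r.SplittingField
  have : Finite L := Module.finite_of_finite F
  have := Fintype.ofFinite L
  have : CharP L p := charP_of_injective_algebraMap (algebraMap F L).injective p
  obtain ⟨m, -, hm⟩ := FiniteField.card L p
  refine ⟨m, m.pos, ?_⟩
  rw [← map_dvd_map' (algebraMap F L)]
  have hsp : (r.map (algebraMap F L)).Splits := SplittingField.splits r
  rw [hsp.eq_prod_roots]
  have h0 : (r.map (algebraMap F L)).leadingCoeff ≠ 0 := by
    rw [Ne, leadingCoeff_eq_zero, Polynomial.map_eq_zero]
    exact hr.ne_zero
  rw [IsUnit.mul_left_dvd (isUnit_C.mpr h0.isUnit)]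
  have hne : (X ^ p ^ (m : ℕ) - X : L[X]) ≠ 0 := by
    rw [← hm]; exact FiniteField.X_pow_card_sub_X_ne_zero L Fintype.one_lt_card
  simp only [Polynomial.map_sub, Polynomial.map_pow, map_X]
  rw [Multiset.prod_X_sub_C_dvd_iff_le_roots hne, ← hm, FiniteField.roots_X_pow_card_sub_X,
    Multiset.le_iff_subset (nodup_roots (hr.map))]
  intro z _
  exact Finset.mem_univ z

/-- If a member of `H` is a commuting product of a semisimple and a `p`-unipotent element then both
factors are in `H`. -/
theorem unipotent_part_mem (p : ℕ) [hp : Fact p.Prime] [CharP F p]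
    {H : Submonoid (Module.End F (Fin 8 → F))} {w Z U : Module.End F (Fin 8 → F)} (hw : w ∈ H)
    (hu : IsUnit w) (hZU : w = Z * U) (hc : Commute Z U) (hU : U ^ p = 1) {r : F[X]}
    (hr : r.Separable) (hrZ : aeval Z r = 0) : U ∈ H := by
  obtain ⟨m, hm, k, hk⟩ := exists_dvd_X_pow_sub_X p hr
  have hZ : Z ^ p ^ m = Z := by
    have h := congrArg (aeval Z) hk
    rw [map_mul, hrZ, zero_mul] at h
    simpa [sub_eq_zero] using h
  have hU' : U ^ p ^ m = 1 := by
    rw [← Nat.sub_add_cancel hm, pow_succ', pow_mul, hU, one_pow]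
  have hZH : Z ∈ H := by
    have h := pow_mem hw (p ^ m)
    rwa [hZU, hc.mul_pow, hZ, hU', mul_one] at h
  refine mem_of_mul_mem_left hZH ?_ (hZU ▸ hw)
  obtain ⟨u, rfl⟩ := hu
  refine IsUnit.of_mul_eq_one (U * (u⁻¹ : (Module.End F (Fin 8 → F))ˣ)) ?_
  rw [← mul_assoc, ← hZU, Units.mul_inv]

end Extraction

theorem eta_fin_eight {α : Type*} (z : Fin 8 → α) :
    z = ![z 0, z 1, z 2, z 3, z 4, z 5, z 6, z 7] := by
  funext i
  fin_cases i <;> rfl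

section Generators

variable {F : Type*} [Field F]

/-- The endomorphism given by `xPlusOdd`. -/
def xEnd (a : F) : Module.End F (Fin 8 → F) := Matrix.toLin' (xPlusOdd F a)

/-- The endomorphism given by `yPlus`. -/
def yEnd : Module.End F (Fin 8 → F) := Matrix.toLin' (yPlus F)

theorem xEnd_apply (a : F) (z : Fin 8 → F) :
    xEnd a z = ![-z 1, -z 0, z 0 - z 1 - z 2 - a * z 3, z 3, z 3 - z 5 + z 6, -z 3 - z 4 - z 6,
      -2 * z 3 - z 6, z 0 - z 1 - 2 * z 2 - 2 * a * z 3 - a * z 6 + z 7] := by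
  funext i
  fin_cases i <;>
    simp [xEnd, xPlusOdd, Matrix.toLin'_apply, Matrix.mulVec, dotProduct, Fin.sum_univ_eight] <;>
    ring

theorem yEnd_apply (z : Fin 8 → F) :
    yEnd z = ![z 0, z 7, z 5, z 2, z 4, z 3, z 1, z 6] := by
  funext i
  fin_cases i <;>
    simp [yEnd, yPlus, Matrix.toLin'_apply, Matrix.mulVec, dotProduct, Fin.sum_univ_eight]

theorem xEnd_mul_xEnd (a : F) : xEnd a * xEnd a = 1 := by
  refine LinearMap.ext fun z => ?_
  rw [Module.End.mul_apply, Module.End.one_apply]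
  conv_rhs => rw [eta_fin_eight z]
  simp only [xEnd_apply]
  funext i
  fin_cases i <;> simp <;> ring

theorem yEnd_mul_yEnd_mul_yEnd : (yEnd : Module.End F (Fin 8 → F)) * (yEnd * yEnd) = 1 := by
  refine LinearMap.ext fun z => ?_
  rw [Module.End.mul_apply, Module.End.mul_apply, Module.End.one_apply]
  conv_rhs => rw [eta_fin_eight z]
  simp [yEnd_apply]

theorem xEnd_preserves (a : F) : Preserves (xEnd a) := fun z => by
  simp [QPlus, xEnd_apply]; ring

theorem yEnd_preserves : Preserves (yEnd : Module.End F (Fin 8 → F)) := fun z => by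
  simp [QPlus, yEnd_apply]; ring

theorem isUnit_xEnd (a : F) : IsUnit (xEnd a) := IsUnit.of_mul_eq_one _ (xEnd_mul_xEnd a)

theorem isUnit_yEnd : IsUnit (yEnd : Module.End F (Fin 8 → F)) :=
  IsUnit.of_mul_eq_one _ yEnd_mul_yEnd_mul_yEnd

variable [Finite F] {H : Submonoid (Module.End F (Fin 8 → F))}

theorem siegel_xEnd_mem {a : F} (hX : xEnd a ∈ H) {v n : Fin 8 → F} (h : siegel v n ∈ H) :
    siegel (xEnd a v) (xEnd a n) ∈ H :=
  siegel_map_mem hX (isUnit_xEnd a) (xEnd_preserves a) h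

theorem siegel_yEnd_mem (hY : yEnd ∈ H) {v n : Fin 8 → F} (h : siegel v n ∈ H) :
    siegel (yEnd v) (yEnd n) ∈ H :=
  siegel_map_mem hY isUnit_yEnd yEnd_preserves h

end Generators

section Basis

variable {F : Type*} [Field F]

/-- The first basis vector. -/
def e1 : Fin 8 → F := ![1, 0, 0, 0, 0, 0, 0, 0]

/-- The images of `x e1` under the powers of `y`. -/
def mv : Fin 3 → Fin 8 → F :=
  ![![0, -1, 1, 0, 0, 0, 0, 1], ![0, 1, 0, 1, 0, 0, -1, 0], ![0, 0, 0, 0, 0, 1, 1, -1]]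

/-- Multiples of the vectors dual to the `mv i`. -/
def dv (a : F) : Fin 3 → Fin 8 → F :=
  ![![0, 1, 0, 1, 0, -1, a, 1], ![0, 1, -1, 0, 0, 1, 1, a], ![0, a, 1, -1, 0, 0, 1, 1]]

@[simp] theorem QPlus_e1 : QPlus F e1 = 0 := by simp [QPlus, e1]
@[simp] theorem QPlus_mv (i : Fin 3) : QPlus F (mv i) = 0 := by
  fin_cases i <;> simp [QPlus, mv]
@[simp] theorem QPlus_dv (a : F) (i : Fin 3) : QPlus F (dv a i) = 0 := by
  fin_cases i <;> simp [QPlus, dv]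
@[simp] theorem polarForm_e1_e1 : polarForm (e1 : Fin 8 → F) e1 = 0 := by simp [polarForm, e1]
@[simp] theorem polarForm_e1_mv (i : Fin 3) : polarForm (e1 : Fin 8 → F) (mv i) = 0 := by
  fin_cases i <;> simp [polarForm, e1, mv]
@[simp] theorem polarForm_mv_e1 (i : Fin 3) : polarForm (mv i : Fin 8 → F) e1 = 0 := by
  rw [polarForm_comm, polarForm_e1_mv]
@[simp] theorem polarForm_e1_dv (a : F) (i : Fin 3) : polarForm e1 (dv a i) = 0 := by
  fin_cases i <;> simp [polarForm, e1, dv]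
@[simp] theorem polarForm_dv_e1 (a : F) (i : Fin 3) : polarForm (dv a i) e1 = 0 := by
  rw [polarForm_comm, polarForm_e1_dv]
@[simp] theorem polarForm_mv_mv (i j : Fin 3) : polarForm (mv i : Fin 8 → F) (mv j) = 0 := by
  fin_cases i <;> fin_cases j <;> simp [polarForm, mv]
@[simp] theorem polarForm_dv_dv (a : F) (i j : Fin 3) : polarForm (dv a i) (dv a j) = 0 := by
  fin_cases i <;> fin_cases j <;> simp [polarForm, dv]
@[simp] theorem polarForm_mv_dv (a : F) (i j : Fin 3) :
    polarForm (mv i) (dv a j) = if i = j then a + 2 else 0 := by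
  fin_cases i <;> fin_cases j <;> simp [polarForm, mv, dv] <;> ring
@[simp] theorem polarForm_dv_mv (a : F) (i j : Fin 3) :
    polarForm (dv a i) (mv j) = if j = i then a + 2 else 0 := by
  rw [polarForm_comm, polarForm_mv_dv]

@[simp] theorem xEnd_e1 (a : F) : xEnd a e1 = mv 0 := by simp [xEnd_apply, e1, mv]
@[simp] theorem xEnd_mv_zero (a : F) : xEnd a (mv 0) = e1 := by
  simp [xEnd_apply, e1, mv]; norm_num
@[simp] theorem xEnd_mv_one (a : F) : xEnd a (mv 1) = -e1 - a • mv 0 - dv a 2 := by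
  funext i; fin_cases i <;> simp [xEnd_apply, e1, mv, dv] <;> ring
@[simp] theorem xEnd_mv_two (a : F) : xEnd a (mv 2) = -mv 0 - dv a 1 := by
  funext i; fin_cases i <;> simp [xEnd_apply, mv, dv] <;> ring
@[simp] theorem xEnd_dv_one (a : F) : xEnd a (dv a 1) = -(mv 2 + e1) := by
  funext i; fin_cases i <;> simp [xEnd_apply, e1, mv, dv] <;> ring
@[simp] theorem xEnd_dv_two (a : F) : xEnd a (dv a 2) = -(mv 1 + mv 0 + a • e1) := by
  funext i; fin_cases i <;> simp [xEnd_apply, e1, mv, dv] <;> ring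
@[simp] theorem yEnd_e1 : yEnd (e1 : Fin 8 → F) = e1 := by simp [yEnd_apply, e1]
@[simp] theorem yEnd_mv (i : Fin 3) : yEnd (mv i : Fin 8 → F) = mv (i + 1) := by
  fin_cases i <;> simp [yEnd_apply, mv]
@[simp] theorem yEnd_dv (a : F) (i : Fin 3) : yEnd (dv a i) = dv a (i + 1) := by
  fin_cases i <;> simp [yEnd_apply, dv]

end Basis

section Fill

variable {F : Type*} [Field F]

theorem one_add_mul_one_add {A B : Module.End F (Fin 8 → F)} (h : A * B = 0) :
    (1 + A) * (1 + B) = 1 + (A + B) := by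
  rw [mul_add, add_mul, add_mul, h]; simp [add_assoc]

theorem one_add_commutator {A B : Module.End F (Fin 8 → F)} (hA : A * A = 0) (hB : B * B = 0)
    (hAB : A * B * A = 0) (hBA : B * A * B = 0) :
    (1 + A) * (1 + B) * (1 - A) * (1 - B) = 1 + (A * B - B * A) := by
  rw [mul_assoc] at hAB hBA
  simp only [add_mul, mul_add, mul_sub, sub_mul, one_mul, mul_one, mul_assoc, hA, hB, hAB, hBA,
      mul_zero, zero_mul]
  abel

variable {H : Submonoid (Module.End F (Fin 8 → F))}

theorem siegel_add_mem {v n n' : Fin 8 → F} (hv : QPlus F v = 0) (hn : polarForm n v = 0)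
    (hn' : polarForm n' v = 0) (h : siegel v n ∈ H) (h' : siegel v n' ∈ H) :
    siegel v (n + n') ∈ H := by
  rw [← siegel_mul hv hn hn']
  exact H.mul_mem h h'

variable [Finite F]

theorem commutator_mem {A B : Module.End F (Fin 8 → F)} (hA : A * A = 0) (hB : B * B = 0)
    (hAB : A * B * A = 0) (hBA : B * A * B = 0) (h1 : 1 + A ∈ H) (h2 : 1 + B ∈ H) :
    1 + (A * B - B * A) ∈ H := by
  rw [← one_add_commutator hA hB hAB hBA]
  have e1 : (1 + A) * (1 - A) = 1 := by simp [mul_sub, add_mul, hA]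
  have e2 : (1 + B) * (1 - B) = 1 := by simp [mul_sub, add_mul, hB]
  exact H.mul_mem (H.mul_mem (H.mul_mem h1 h2) (inverse_mem h1 e1)) (inverse_mem h2 e2)

theorem siegel_e1_mv_mem (hY : yEnd ∈ H) {t : F} (h : siegel e1 (t • mv 0) ∈ H) (i : Fin 3) :
    siegel e1 (t • mv i) ∈ H := by
  have h1 := siegel_yEnd_mem hY h
  have h2 := siegel_yEnd_mem hY h1
  simp only [map_smul, yEnd_e1, yEnd_mv] at h1 h2
  fin_cases i
  exacts [h, h1, h2]

theorem siegel_mv_dv_mem {a : F} (hX : xEnd a ∈ H) (hY : yEnd ∈ H) {t : F}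
    (h : siegel e1 (t • mv 0) ∈ H) {i j : Fin 3} (hij : i ≠ j) :
    siegel (mv i) (t • dv a j) ∈ H := by
  have k0 := siegel_xEnd_mem hX h
  have k1 := siegel_xEnd_mem hX (siegel_e1_mv_mem hY h 1)
  have k2 := siegel_xEnd_mem hX (siegel_e1_mv_mem hY h 2)
  simp only [map_smul, xEnd_e1, xEnd_mv_zero, xEnd_mv_one, xEnd_mv_two] at k0 k1 k2
  have r1 : siegel (mv 0) (t • dv a 2) ∈ H := by
    have h1 := siegel_neg_mem (by simp) (by simp)
      (siegel_add_mem (by simp) (by simp) (by simp) k1 k0)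
    rw [← siegel_add_smul_self (by simp) (by simp) (t * a)]
    convert h1 using 2
    module
  have r2 : siegel (mv 0) (t • dv a 1) ∈ H := by
    have h1 := siegel_neg_mem (by simp) (by simp) k2
    rw [← siegel_add_smul_self (by simp) (by simp) t]
    convert h1 using 2
    module
  have r3 := siegel_yEnd_mem hY r1
  have r4 := siegel_yEnd_mem hY r2
  have r5 := siegel_yEnd_mem hY r3
  have r6 := siegel_yEnd_mem hY r4
  simp only [map_smul, yEnd_dv, yEnd_mv] at r3 r4 r5 r6
  fin_cases i <;> fin_cases j <;> first | exact absurd rfl hij | assumption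

/-- Scales of the root group of `e1` and `m0` are multiplied by means of a commutator. -/
theorem siegel_e1_mv_mul_mem {a : F} (hX : xEnd a ∈ H) (hY : yEnd ∈ H) {t t' : F}
    (h : siegel e1 (t • mv 0) ∈ H) (h' : siegel e1 (t' • mv 0) ∈ H) :
    siegel e1 (((a + 2) * t * t') • mv 0) ∈ H := by
  have k1 := siegel_e1_mv_mem hY h 1
  have k2 := siegel_mv_dv_mem hX hY h' (i := 0) (j := 1) (by decide)
  have := siegel_commutator_mem (by simp [QPlus_smul]) (by simp) (by simp [QPlus_smul]) (by simp)
    (by simp) (by simp) (by simp) (by simp) (by simp) k1 k2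
  convert this using 2
  simp
  ring_nf

/-- The endomorphism `m1 ∧ m0 + d2 ∧ e1`. -/
def pairSum (a : F) : Module.End F (Fin 8 → F) := wedge (mv 1) (mv 0) + wedge (dv a 2) e1

/-- The endomorphism `a (m0 ∧ m1 + d2 ∧ e1) - a² e1 ∧ m0`. -/
def pairDiff (a : F) : Module.End F (Fin 8 → F) :=
  a • (wedge (mv 0) (mv 1) + wedge (dv a 2) e1) - a ^ 2 • wedge e1 (mv 0)

theorem one_add_pairSum_mem {a : F} (hX : xEnd a ∈ H) (hY : yEnd ∈ H) {t : F}
    (h : siegel e1 (t • mv 0) ∈ H) :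
    siegel (mv 1 + dv a 2) (t • (mv 0 + e1)) ∈ H ∧ 1 + t • pairSum a ∈ H := by
  have k1 := siegel_yEnd_mem hY (siegel_xEnd_mem hX
    (siegel_mv_dv_mem hX hY h (i := 2) (j := 1) (by decide)))
  have k2 : siegel (mv 1 + dv a 2) (t • (mv 0 + e1)) ∈ H := by
    have e : (mv 1 + dv a 2 : Fin 8 → F) = (-1 : F) • (-mv 1 - dv a 2) := by module
    rw [e, siegel_smul_left]
    convert k1 using 2
    · simp
    · simp [add_comm]
  refine ⟨k2, ?_⟩
  have k3 := siegel_e1_mv_mem hY h 1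
  have k4 := siegel_mv_dv_mem hX hY h (i := 0) (j := 2) (by decide)
  have := H.mul_mem (H.mul_mem k2 k3) k4
  rw [siegel_eq_one_add_wedge, siegel_eq_one_add_wedge, siegel_eq_one_add_wedge,
    one_add_mul_one_add, one_add_mul_one_add] at this
  · convert this using 2
    simp only [pairSum, wedge_smul_right, wedge_add_left, wedge_add_right, wedge_comm e1,
      wedge_comm (mv 0)]
    module
  · rw [add_mul, wedge_mul_wedge, wedge_mul_wedge, add_zero] <;> simp
  · rw [wedge_mul_wedge] <;> simp
  · simp [QPlus_smul]
  · simp [QPlus_smul]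
  · simp [QPlus_smul, QPlus_add]

theorem one_add_pairDiff_mem {a : F} (hX : xEnd a ∈ H) (hY : yEnd ∈ H) {t : F}
    (h : siegel e1 (t • mv 0) ∈ H) : 1 + t • pairDiff a ∈ H := by
  have k1 := siegel_xEnd_mem hX (siegel_mv_dv_mem hX hY h (i := 1) (j := 2) (by decide))
  simp only [map_smul, xEnd_mv_one, xEnd_dv_two] at k1
  have k2 := siegel_neg_mem (by simp) (by simp) (siegel_e1_mv_mem hY h 1)
  have k3 := siegel_neg_mem (by simp) (by simp) h
  have k4 := siegel_mv_dv_mem hX hY h (i := 1) (j := 2) (by decide)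
  have k5 := siegel_mv_dv_mem hX hY h (i := 0) (j := 2) (by decide)
  have := H.mul_mem (H.mul_mem (H.mul_mem (H.mul_mem k1 k2) k3) k4) k5
  rw [siegel_eq_one_add_wedge, siegel_eq_one_add_wedge, siegel_eq_one_add_wedge,
    siegel_eq_one_add_wedge, siegel_eq_one_add_wedge,
    one_add_mul_one_add, one_add_mul_one_add, one_add_mul_one_add, one_add_mul_one_add] at this
  · convert this using 2
    simp only [pairDiff, wedge_smul_right, wedge_smul_left, wedge_add_left, wedge_add_right,
      wedge_sub_left, wedge_neg_left, wedge_neg_right, wedge_comm e1 (mv 0),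
      wedge_comm e1 (mv 1), wedge_comm (mv 0) (mv 1), wedge_comm (mv 0) (dv a 2),
      wedge_comm (mv 1) (dv a 2), wedge_comm e1 (dv a 2), wedge_self]
    module
  · simp only [add_mul]
    rw [wedge_mul_wedge, wedge_mul_wedge, wedge_mul_wedge, wedge_mul_wedge] <;> simp
  · simp only [add_mul]
    rw [wedge_mul_wedge, wedge_mul_wedge, wedge_mul_wedge] <;> simp
  · rw [add_mul, wedge_mul_wedge, wedge_mul_wedge, add_zero] <;> simp
  · rw [wedge_mul_wedge] <;> simp
  · simp [QPlus_smul]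
  · simp [QPlus_smul]
  · simp [QPlus_smul, QPlus_neg]
  · simp [QPlus_smul, QPlus_neg]
  · simp [QPlus_smul, QPlus_add, QPlus_neg]

end Fill

section Fill

variable {F : Type*} [Field F]

theorem wedge_conj {g g' : Module.End F (Fin 8 → F)} (hg : Preserves g) (hgg : g * g' = 1)
    (v w : Fin 8 → F) : g * wedge v w * g' = wedge (g v) (g w) := by
  have hz : ∀ z, g (g' z) = z := fun z => by
    rw [← Module.End.mul_apply, hgg, Module.End.one_apply]
  refine LinearMap.ext fun z => ?_
  have hzB : ∀ w, polarForm z (g w) = polarForm (g' z) w := fun w => by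
    conv_lhs => rw [← hz z]
    exact hg.polarForm _ _
  simp only [Module.End.mul_apply, wedge_apply, map_sub, map_smul, hzB]

theorem yEnd_conj_pairDiff (a : F) : yEnd * pairDiff a * (yEnd * yEnd)
    = a • (wedge (mv 1) (mv 2) + wedge (dv a 0) e1) - a ^ 2 • wedge e1 (mv 1) := by
  simp only [pairDiff, mul_sub, sub_mul, mul_add, add_mul, smul_mul_assoc, mul_smul_comm,
    wedge_conj yEnd_preserves yEnd_mul_yEnd_mul_yEnd, yEnd_mv, yEnd_e1, yEnd_dv]
  rfl

variable {H : Submonoid (Module.End F (Fin 8 → F))} [Finite F]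

theorem siegel_e1_mv_mul_sq_mem {a : F} (hX : xEnd a ∈ H) (hY : yEnd ∈ H) {t t' : F}
    (h : siegel e1 (t • mv 0) ∈ H) (h' : siegel e1 (t' • mv 0) ∈ H) :
    siegel e1 ((-2 * a ^ 2 * ((a + 2) * t * t')) • mv 0) ∈ H := by
  have k1 := one_add_pairDiff_mem hX hY h
  have k2 := H.mul_mem (H.mul_mem hY (one_add_pairDiff_mem hX hY h')) (H.mul_mem hY hY)
  rw [mul_add, add_mul, mul_one, yEnd_mul_yEnd_mul_yEnd, mul_smul_comm, smul_mul_assoc,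
    yEnd_conj_pairDiff] at k2
  have k3 := commutator_mem ?_ ?_ ?_ ?_ k1 k2
  · have k4 : siegel e1 ((-2 * a ^ 2 * ((a + 2) * t * t')) • mv 1) ∈ H := by
      rw [siegel_eq_one_add_wedge _ (by simp [QPlus_smul, QPlus_neg])]
      convert k3 using 2
      refine LinearMap.ext fun z => ?_
      simp [pairDiff, wedge_apply]
      module
    have k5 := siegel_yEnd_mem hY (siegel_yEnd_mem hY k4)
    simpa using k5
  all_goals
    refine LinearMap.ext fun z => ?_
    simp [pairDiff, wedge_apply]

/-- The vector `y x d0`. -/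
def loopVec (a : F) : Fin 8 → F :=
  ![-1, -2 * a - a ^ 2, -1 - a, -1 - a, 2 + a, 1, 0, -2 - a]

theorem siegel_e1_mv_mul_cubic_mem {a : F} (hX : xEnd a ∈ H) (hY : yEnd ∈ H) {t t' : F}
    (h : siegel e1 (t • mv 0) ∈ H) (h' : siegel e1 (t' • mv 0) ∈ H) :
    siegel (mv 1 + dv a 2) ((2 * (1 - a ^ 2) * (1 + a) * ((a + 2) * t * t')) • (mv 0 + e1))
      ∈ H := by
  have key : ∀ t : F, siegel e1 (t • mv 0) ∈ H → siegel (mv 1 + dv a 2) (t • loopVec a) ∈ H := by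
    intro t h
    have k := siegel_yEnd_mem hY (siegel_xEnd_mem hX (siegel_yEnd_mem hY (siegel_yEnd_mem hY
      (siegel_xEnd_mem hX (siegel_yEnd_mem hY (siegel_yEnd_mem hY h))))))
    simp only [map_smul] at k
    have e2 : yEnd (xEnd a (yEnd (yEnd (xEnd a (yEnd (yEnd e1))))))
        = (-1 : F) • (mv 1 + dv a 2) := by
      simp [xEnd_apply, yEnd_apply, e1, mv, dv]
    have e3 : yEnd (xEnd a (yEnd (yEnd (xEnd a (yEnd (yEnd (mv 0)))))))
        = mv 1 + dv a 2 - loopVec a := by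
      simp [xEnd_apply, yEnd_apply, e1, mv, dv, loopVec]; ring_nf; simp
    rw [e2, siegel_smul_left, e3] at k
    have : siegel (mv 1 + dv a 2) (t • loopVec a)
      = siegel (mv 1 + dv a 2) (t • loopVec a + (-t) • (mv 1 + dv a 2)) := by
      rw [siegel_add_smul_self]
      · simp [QPlus_add]
      · simp [polarForm, loopVec, mv, dv]; ring_nf
    rw [this]
    convert k using 2
    module
  have k1 := key t h
  have k2 := siegel_xEnd_mem hX (key t' h')
  have e1 : xEnd a (mv 1 + dv a 2) = - (1 + a) • (mv 0 + e1) - (mv 1 + dv a 2) := by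
    simp; module
  have e2 : polarForm (t • loopVec a) (xEnd a (t' • loopVec a))
    = 2 * (1 - a ^ 2) * ((a + 2) * t * t') := by
    simp [xEnd_apply, loopVec, polarForm]; ring
  have k3 := siegel_commutator_mem ?_ ?_ ?_ ?_ ?_ ?_ ?_ ?_ ?_ k1 k2
  · rw [e1, e2] at k3
    have k4 := siegel_neg_mem ?_ ?_ k3
    · rw [← siegel_add_smul_self (c := 2 * (1 - a ^ 2) * ((a + 2) * t * t'))]
      convert k4 using 2
      module
      all_goals simp [QPlus_add]
    all_goals simp [QPlus_add]
  all_goals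
    simp only [xEnd_apply, loopVec, polarForm, QPlus, mv, dv]
    simp
    try ring

end Fill

section Fill

variable {F : Type*} [Field F] [Finite F] {H : Submonoid (Module.End F (Fin 8 → F))}

/-- The scalars `t` for which the root element of `e1` and `m0` of scale `t` is in `H`. -/
def scaleGroup (H : Submonoid (Module.End F (Fin 8 → F))) : AddSubgroup F where
  carrier := {t | siegel e1 (t • mv 0) ∈ H}
  zero_mem' := by simp [H.one_mem]
  add_mem' := fun {s t} hs ht => by
    have := siegel_add_mem (by simp) (by simp) (by simp) hs ht
    rwa [← add_smul] at this
  neg_mem' := fun {s} hs => by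
    have := siegel_neg_mem (by simp) (by simp) hs
    rwa [← neg_smul] at this

/-- The multipliers of the scale group form a subfield. -/
def multiplierField (T : AddSubgroup F) : Subfield F where
  carrier := {k | ∀ t ∈ T, k * t ∈ T}
  mul_mem' := fun {k l} hk hl t ht => by rw [mul_assoc]; exact hk _ (hl _ ht)
  one_mem' := fun t ht => by rwa [one_mul]
  add_mem' := fun {k l} hk hl t ht => by rw [add_mul]; exact T.add_mem (hk _ ht) (hl _ ht)
  zero_mem' := fun t ht => by rw [zero_mul]; exact T.zero_mem
  neg_mem' := fun {k} hk t ht => by rw [neg_mul]; exact T.neg_mem (hk _ ht)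
  inv_mem' := fun k hk => by
    have hpow : ∀ n : ℕ, ∀ t ∈ T, k ^ n * t ∈ T := by
      intro n
      induction n with
      | zero => intro t ht; simpa using ht
      | succ n ih => intro t ht; rw [pow_succ, mul_assoc]; exact ih _ (hk _ ht)
    rcases eq_or_ne k 0 with rfl | h0
    · simpa using hk
    · have := Fintype.ofFinite F
      have h1 := FiniteField.pow_card_sub_one_eq_one k h0
      have h2 : k⁻¹ = k ^ (Fintype.card F - 2) := by
        have : 1 < Fintype.card F := Fintype.one_lt_card
        refine inv_eq_of_mul_eq_one_right ?_
        rw [← pow_succ', ← h1]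
        congr 1
        omega
      intro t ht
      rw [h2]
      exact hpow _ t ht

theorem two_mul_mem_scaleGroup {a : F} (hX : xEnd a ∈ H) (hY : yEnd ∈ H) {s : F}
    (h : siegel (mv 1 + dv a 2) (s • (mv 0 + e1)) ∈ H) : 2 * s ∈ scaleGroup H := by
  have k1 := siegel_xEnd_mem hX (siegel_yEnd_mem hY (siegel_xEnd_mem hX
    (siegel_yEnd_mem hY (siegel_yEnd_mem hY h))))
  have e2 : xEnd a (yEnd (xEnd a (yEnd (yEnd (mv 1 + dv a 2))))) = (-1 : F) • (e1 : Fin 8 → F) := by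
    simp
  have e3 : xEnd a (yEnd (xEnd a (yEnd (yEnd (s • (mv 0 + e1))))))
      = s • (mv 1 + mv 0 + a • e1) := by
    simp
    module
  rw [e2, e3, siegel_smul_left] at k1
  have k2 : siegel e1 (s • (mv 0 + mv 1)) ∈ H := by
    have := siegel_neg_mem (by simp) (by simp) k1
    rw [← siegel_add_smul_self (by simp) (by simp) (s * a)]
    convert this using 2
    module
  have k3 := siegel_yEnd_mem hY k2
  have k4 := siegel_yEnd_mem hY k3
  simp only [map_smul, map_add, yEnd_e1, yEnd_mv] at k3 k4
  have k5 := siegel_add_mem (by simp) (by simp) (by simp) k2 (siegel_add_mem (by simp) (by simp)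
    (by simp) k4 (siegel_neg_mem (by simp) (by simp) k3))
  change siegel e1 ((2 * s) • mv 0) ∈ H
  convert k5 using 2
  simp only [Fin.isValue, Fin.reduceAdd]
  module

theorem scaleGroup_eq_top {a : F} (h2 : (2 : F) ≠ 0) (ha2 : a + 2 ≠ 0)
    (ha : Subfield.closure {a} = ⊤) (hX : xEnd a ∈ H) (hY : yEnd ∈ H) {t : F} (ht : t ≠ 0)
    (h : siegel e1 (t • mv 0) ∈ H) (s : F) : siegel e1 (s • mv 0) ∈ H := by
  set K := multiplierField (scaleGroup H) with hK
  have k1 : (a + 2) * t ∈ K := fun s hs => siegel_e1_mv_mul_mem hX hY h hs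
  have k2 : -2 * a ^ 2 * ((a + 2) * t) ∈ K := fun s hs => by
    have := siegel_e1_mv_mul_sq_mem hX hY h hs
    rwa [mul_assoc]
  have k3 : 2 * (2 * (1 - a ^ 2) * (1 + a) * ((a + 2) * t)) ∈ K := fun s hs => by
    have := two_mul_mem_scaleGroup hX hY (siegel_e1_mv_mul_cubic_mem hX hY h hs)
    rwa [mul_assoc, mul_assoc (2 * (1 - a ^ 2) * (1 + a))]
  have hft : (a + 2) * t ≠ 0 := mul_ne_zero ha2 ht
  have q2 : (2 : F) ∈ K := ofNat_mem K 2
  have q3 : a ^ 2 ∈ K := by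
    have := K.div_mem (K.div_mem k2 k1) (K.neg_mem q2)
    rwa [mul_div_cancel_right₀ _ hft, mul_div_cancel_left₀ _ (neg_ne_zero.mpr h2)] at this
  have q4 : (1 - a ^ 2) * (1 + a) ∈ K := by
    have := K.div_mem (K.div_mem (K.div_mem k3 q2) k1) q2
    rwa [mul_div_cancel_left₀ _ h2, mul_div_cancel_right₀ _ hft, mul_assoc,
      mul_div_cancel_left₀ _ h2] at this
  have q5 : a ∈ K := by
    by_cases h1 : 1 - a ^ 2 = 0
    · have : (a - 1) * (a + 1) = 0 := by linear_combination -h1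
      rcases mul_eq_zero.mp this with h | h
      · rw [sub_eq_zero.mp h]; exact K.one_mem
      · rw [eq_neg_of_add_eq_zero_left h]; exact K.neg_mem K.one_mem
    · have := K.sub_mem (K.div_mem q4 (K.sub_mem K.one_mem q3)) K.one_mem
      rwa [mul_div_cancel_left₀ _ h1, add_sub_cancel_left] at this
  have hKtop : K = ⊤ := by
    rw [eq_top_iff, ← ha, Subfield.closure_le, Set.singleton_subset_iff]
    exact q5
  have : s / t ∈ K := hKtop ▸ Subfield.mem_top _
  have := this t h
  rwa [div_mul_cancel₀ _ ht] at this

theorem siegel_e1_mem {a : F} (h2 : (2 : F) ≠ 0) (ha0 : a ≠ 0) (ha2 : a + 2 ≠ 0)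
    (ha : Subfield.closure {a} = ⊤) (hX : xEnd a ∈ H) (hY : yEnd ∈ H) {t : F} (ht : t ≠ 0)
    (h : siegel e1 (t • mv 0) ∈ H) {n : Fin 8 → F} (hn : polarForm n e1 = 0) :
    siegel e1 n ∈ H := by
  have hT := scaleGroup_eq_top h2 ha2 ha hX hY ht h
  have hm : ∀ (s : F) (i : Fin 3), siegel e1 (s • mv i) ∈ H :=
    fun s i => siegel_e1_mv_mem hY (hT s) i
  have hd2 : ∀ s : F, siegel e1 (s • dv a 2) ∈ H := by
    intro s
    have k := H.mul_mem (H.mul_mem (one_add_pairDiff_mem hX hY (hT (-(s / (2 * a)))))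
      (one_add_pairSum_mem hX hY (hT (-(s / 2)))).2) (hT (-(s * a / 2)))
    rw [siegel_eq_one_add_wedge _ (by simp [QPlus_smul, QPlus_neg]),
      one_add_mul_one_add, one_add_mul_one_add] at k
    · rw [siegel_eq_one_add_wedge _ (by simp [QPlus_smul])]
      convert k using 2
      refine LinearMap.ext fun z => ?_
      simp [pairDiff, pairSum, wedge_apply]
      match_scalars <;> field_simp <;> ring
    · refine LinearMap.ext fun z => ?_
      simp [pairDiff, pairSum, wedge_apply]
    · refine LinearMap.ext fun z => ?_
      simp [pairDiff, pairSum, wedge_apply]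
  have hd : ∀ (s : F) (i : Fin 3), siegel e1 (s • dv a i) ∈ H := by
    intro s i
    have r1 := siegel_yEnd_mem hY (hd2 s)
    have r2 := siegel_yEnd_mem hY r1
    simp only [map_smul, yEnd_e1, yEnd_dv] at r1 r2
    fin_cases i
    exacts [r1, r2, hd2 s]
  have hn4 : n 4 = 0 := by simpa [polarForm, e1] using hn
  have key : n = (a + 2)⁻¹ • (polarForm n (dv a 0) • mv 0 + polarForm n (dv a 1) • mv 1
      + polarForm n (dv a 2) • mv 2 + polarForm n (mv 0) • dv a 0 + polarForm n (mv 1) • dv a 1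
      + polarForm n (mv 2) • dv a 2) + n 0 • e1 := by
    funext i
    fin_cases i <;> simp [polarForm, mv, dv, e1, hn4] <;> field_simp <;> ring
  rw [key, siegel_add_smul_self (by simp) (by simp)]
  simp only [smul_add, smul_smul]
  refine siegel_add_mem (by simp) (by simp) (by simp) (siegel_add_mem (by simp) (by simp) (by simp)
    (siegel_add_mem (by simp) (by simp) (by simp) (siegel_add_mem (by simp) (by simp) (by simp)
    (siegel_add_mem (by simp) (by simp) (by simp) ?_ ?_) ?_) ?_) ?_) ?_
  exacts [hm _ _, hm _ _, hm _ _, hd _ _, hd _ _, hd _ _]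

end Fill

section Transport

variable {F : Type*} [Field F]

/-- Siegel transformations move a singular vector to any other one with the same product with the
centre. -/
theorem siegel_sub_apply {w u v : Fin 8 → F} {b : F} (hb : b ≠ 0) (hu : QPlus F u = 0)
    (hv : QPlus F v = 0) (huw : polarForm u w = b) :
    siegel w (b⁻¹ • (v - u)) u = v := by
  have h1 : QPlus F (v - u) = -polarForm u v := by
    rw [sub_eq_add_neg, QPlus_add, QPlus_neg, hu, hv, polarForm_neg_right, polarForm_comm]; ring
  rw [siegel_apply, huw, QPlus_smul, h1]
  simp only [polarForm_smul_right, polarForm_sub_right, polarForm_self u, hu]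
  match_scalars <;> field_simp <;> ring

theorem polarForm_single (z : Fin 8 → F) (i : Fin 8) : polarForm z (Pi.single i 1) = z (i + 4) := by
  fin_cases i <;> simp [polarForm, Pi.single_apply]

theorem QPlus_single (i : Fin 8) (c : F) : QPlus F (Pi.single i c) = 0 := by
  fin_cases i <;> simp [QPlus, Pi.single_apply]

theorem e1_eq_single : (e1 : Fin 8 → F) = Pi.single 0 1 := by
  funext i
  fin_cases i <;> simp [e1, Pi.single_apply]

/-- `H` contains all Siegel transformations with centre `z`. -/
def HasSiegel (H : Submonoid (Module.End F (Fin 8 → F))) (z : Fin 8 → F) : Prop :=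
  ∀ n, polarForm n z = 0 → siegel z n ∈ H

variable {H : Submonoid (Module.End F (Fin 8 → F))}

theorem HasSiegel.of_smul {c : F} (hc : c ≠ 0) {z : Fin 8 → F} (h : HasSiegel H (c • z)) :
    HasSiegel H z := fun n hn => by
  have := h (c⁻¹ • n) (by simp [hn])
  rwa [siegel_smul_left, smul_smul, mul_inv_cancel₀ hc, one_smul] at this

variable [Finite F]

theorem HasSiegel.map {g : Module.End F (Fin 8 → F)} (hg : g ∈ H) (hu : IsUnit g)
    (hp : Preserves g) {z : Fin 8 → F} (h : HasSiegel H z) : HasSiegel H (g z) := fun n hn => by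
  obtain ⟨u, rfl⟩ := hu
  have e : (u : Module.End F (Fin 8 → F)) ((u⁻¹ : (Module.End F (Fin 8 → F))ˣ).val n) = n := by
    rw [← Module.End.mul_apply, Units.mul_inv, Module.End.one_apply]
  rw [← e] at hn ⊢
  rw [hp.polarForm] at hn
  exact siegel_map_mem hg u.isUnit hp (h _ hn)

theorem HasSiegel.transport {w w' z : Fin 8 → F} (hw : QPlus F w = 0) (hw' : QPlus F w' = 0)
    (hz : QPlus F z = 0) (h : HasSiegel H w) (h' : HasSiegel H w') (hww : polarForm w' w ≠ 0)
    (hzw : polarForm z w ≠ 0) : HasSiegel H z := by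
  set c := polarForm w' w / polarForm z w with hc
  have hc0 : c ≠ 0 := div_ne_zero hww hzw
  have hn : polarForm ((polarForm w' w)⁻¹ • (c • z - w')) w = 0 := by
    simp [hc, div_mul_cancel₀ _ hzw]
  refine HasSiegel.of_smul hc0 ?_
  rw [← siegel_sub_apply hww hw' (v := c • z) (by simp [QPlus_smul, hz]) rfl]
  exact h'.map (h _ hn) (isUnit_siegel hw hn) (siegel_preserves hw hn)

/-- If `H` contains the Siegel transformations with centre `e1`, then it contains all of them. -/
theorem HasSiegel.of_e1 {a : F} (ha2 : a + 2 ≠ 0) (hX : xEnd a ∈ H) (hY : yEnd ∈ H)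
    (h : HasSiegel H e1) {z : Fin 8 → F} (hz : QPlus F z = 0) : HasSiegel H z := by
  have hxm : ∀ z, HasSiegel H z → HasSiegel H (xEnd a z) := fun z hz =>
    hz.map hX (isUnit_xEnd a) (xEnd_preserves a)
  have hym : ∀ z, HasSiegel H z → HasSiegel H (yEnd z) := fun z hz =>
    hz.map hY isUnit_yEnd yEnd_preserves
  have h1 := hxm _ (hym _ (hxm _ (hym _ (hxm _ h))))
  have hq : QPlus F (xEnd a (yEnd (xEnd a (yEnd (xEnd a e1))))) = 0 := by
    rw [xEnd_preserves, yEnd_preserves, xEnd_preserves, yEnd_preserves, xEnd_preserves, QPlus_e1]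
  have hB : polarForm (xEnd a (yEnd (xEnd a (yEnd (xEnd a e1))))) e1 ≠ 0 := by
    have : polarForm (xEnd a (yEnd (xEnd a (yEnd (xEnd a e1))))) e1 = -(a + 2) := by
      simp [xEnd_apply, yEnd_apply, e1, polarForm, mv, dv]; ring
    rw [this]
    exact neg_ne_zero.mpr ha2
  have key : ∀ z, QPlus F z = 0 → polarForm z e1 ≠ 0 → HasSiegel H z := fun z hz hz1 =>
    HasSiegel.transport QPlus_e1 hq hz h h1 hB hz1
  have h5 : HasSiegel H (Pi.single 4 1 : Fin 8 → F) :=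
    key _ (QPlus_single _ _) (by simp [e1_eq_single, polarForm_single])
  have h1' : HasSiegel H (Pi.single 0 1 : Fin 8 → F) := e1_eq_single (F := F) ▸ h
  have key5 : ∀ z, QPlus F z = 0 → polarForm z (Pi.single 4 1) ≠ 0 → HasSiegel H z :=
    fun z hz hz1 => HasSiegel.transport (QPlus_single _ _) (QPlus_single _ _) hz h5 h1'
      (by simp [polarForm_single]) hz1
  have hall : ∀ k : Fin 8, HasSiegel H (Pi.single k 1 : Fin 8 → F) := by
    intro k
    by_cases hk0 : k = 0
    · exact hk0 ▸ h1'
    by_cases hk4 : k = 4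
    · exact hk4 ▸ h5
    have hw : QPlus F (Pi.single 0 1 + Pi.single (k + 4) 1 : Fin 8 → F) = 0 := by
      rw [QPlus_add, QPlus_single, QPlus_single, polarForm_single]
      fin_cases k <;> simp_all
    refine HasSiegel.transport (w := Pi.single 0 1 + Pi.single (k + 4) 1) (w' := Pi.single 4 1)
      hw (QPlus_single _ _) (QPlus_single _ _) ?_ h5 ?_ ?_
    · refine key5 _ hw ?_
      rw [polarForm_single]
      fin_cases k <;> simp_all
    · rw [polarForm_add_right, polarForm_single, polarForm_single]
      fin_cases k <;> simp_all
    · rw [polarForm_add_right, polarForm_single, polarForm_single]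
      fin_cases k <;> simp_all
  by_cases hz0 : z = 0
  · intro n _
    have : siegel z n = 1 := by
      refine LinearMap.ext fun v => ?_
      simp [siegel_apply, hz0]
    rw [this]
    exact H.one_mem
  obtain ⟨k, hk⟩ := Function.ne_iff.mp hz0
  refine HasSiegel.transport (w := Pi.single (k + 4) 1) (w' := Pi.single k 1) (QPlus_single _ _)
    (QPlus_single _ _) hz (hall _) (hall _) ?_ ?_
  · rw [polarForm_single]
    fin_cases k <;> simp
  · rw [polarForm_single]
    fin_cases k <;> simpa using hk

end Transport

section Elimination

variable {F : Type*} [Field F] {H : Submonoid (Module.End F (Fin 8 → F))}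

theorem add_four_add_four (i : Fin 8) : i + 4 + 4 = i := by
  revert i; decide

theorem siegel_apply_of_orthogonal {v n z : Fin 8 → F} (h1 : polarForm z v = 0)
    (h2 : polarForm z n = 0) : siegel v n z = z := by
  simp [siegel_apply, h1, h2]

/-- The subset of `H` of isometries that fix the basis vectors with index in `D`. -/
structure FixMem (H : Submonoid (Module.End F (Fin 8 → F))) (D : Finset (Fin 8))
    (g : Module.End F (Fin 8 → F)) : Prop where
  mem : g ∈ H
  preserves : Preserves g
  fix : ∀ i ∈ D, g (Pi.single i 1) = Pi.single i 1

theorem FixMem.mul {D : Finset (Fin 8)} {g h : Module.End F (Fin 8 → F)} (hg : FixMem H D g)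
    (hh : FixMem H D h) : FixMem H D (g * h) :=
  ⟨H.mul_mem hg.mem hh.mem, hg.preserves.mul hh.preserves, fun i hi => by
    rw [Module.End.mul_apply, hh.fix i hi, hg.fix i hi]⟩

theorem fixMem_siegel (hS : ∀ z, QPlus F z = 0 → HasSiegel H z) {D : Finset (Fin 8)}
    {v n : Fin 8 → F} (hv : QPlus F v = 0) (hvn : polarForm n v = 0)
    (hvD : ∀ i ∈ D, v (i + 4) = 0) (hnD : ∀ i ∈ D, n (i + 4) = 0) : FixMem H D (siegel v n) :=
  ⟨hS v hv n hvn, siegel_preserves hv hvn, fun i hi => siegel_apply_of_orthogonal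
    (by rw [polarForm_comm, polarForm_single, hvD i hi])
    (by rw [polarForm_comm, polarForm_single, hnD i hi])⟩

/-- Nonzero singular vectors orthogonal to the fixed basis vectors are moved to a basis vector. -/
theorem exists_fixMem_apply_eq_single (hS : ∀ z, QPlus F z = 0 → HasSiegel H z)
    {D : Finset (Fin 8)} (hD : ∀ i ∈ D, i + 4 ∈ D) {j k : Fin 8} (hk : k ∉ D) (hj : j ∉ D)
    (hjk : j ≠ k) (hjk' : j ≠ k + 4) {z : Fin 8 → F} (hz : QPlus F z = 0) (hz0 : z ≠ 0)
    (hzD : ∀ i ∈ D, z i = 0) :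
    ∃ h, FixMem H D h ∧ h z = Pi.single k 1 := by
  have hD' : ∀ i ∉ D, i + 4 ∉ D := fun i hi h => hi (add_four_add_four i ▸ hD _ h)
  have hsD : ∀ l ∉ D, ∀ c : F, ∀ i ∈ D, (Pi.single l c : Fin 8 → F) (i + 4) = 0 :=
    fun l hl c i hi => by
      rw [Pi.single_apply, if_neg]
      rintro rfl
      exact hl (hD i hi)
  have exists_of_apply_eq_one : ∀ z : Fin 8 → F, QPlus F z = 0 → (∀ i ∈ D, z i = 0) → z k = 1 →
      ∃ h, FixMem H D h ∧ h z = Pi.single k 1 := by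
    intro z hz hzD hzk
    have hb : polarForm z (Pi.single (k + 4) 1) = 1 := by
      rw [polarForm_single, add_four_add_four, hzk]
    refine ⟨_, fixMem_siegel hS (v := Pi.single (k + 4) 1)
        (QPlus_single _ _) ?_ (hsD _ (hD' k hk) 1)
      ?_, siegel_sub_apply one_ne_zero hz (QPlus_single k 1) hb⟩
    · rw [polarForm_smul_left, polarForm_sub_left, hb, polarForm_single, add_four_add_four,
        Pi.single_eq_same, sub_self, mul_zero]
    · intro i hi
      simp [hsD k hk 1 i hi, hzD _ (hD i hi)]
  have exists_of_apply_ne_zero : ∀ z : Fin 8 → F, QPlus F z = 0 → (∀ i ∈ D, z i = 0) → ∀ i ∉ D,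
      i ≠ k → i ≠ k + 4 → z i ≠ 0 → ∃ h, FixMem H D h ∧ h z = Pi.single k 1 := by
    intro z hz hzD i hi hik hik' hzi
    have hne : k + 4 ≠ i + 4 := fun h => hik (add_right_cancel h).symm
    set c := (z k - 1) / z i with hc
    have hf : FixMem H D (siegel (Pi.single k 1) (c • Pi.single (i + 4) 1)) := by
      refine fixMem_siegel hS (QPlus_single _ _) ?_ (hsD k hk 1) ?_
      · simp [polarForm_single, Pi.single_apply, hne]
      · intro l hl
        rw [Pi.smul_apply, hsD _ (hD' i hi) 1 l hl, smul_zero]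
    have hA : ∀ l ∈ D, siegel (Pi.single k 1) (c • Pi.single (i + 4) 1) z l = 0 := by
      intro l hl
      have h1 := hf.preserves.polarForm z (Pi.single (l + 4) 1)
      rwa [hf.fix _ (hD l hl), polarForm_single, polarForm_single, add_four_add_four,
        hzD l hl] at h1
    have hB : siegel (Pi.single k 1) (c • Pi.single (i + 4) 1) z k = 1 := by
      have hk4 : k ≠ i + 4 := fun h => hik' (by rw [h, add_four_add_four])
      simp [siegel_apply, polarForm_single, add_four_add_four, Pi.single_apply, QPlus_smul,
        QPlus_single, hk4]
      rw [hc, div_mul_cancel₀ _ hzi]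
      ring
    obtain ⟨h, hh, hhz⟩ := exists_of_apply_eq_one
      (siegel (Pi.single k 1) (c • Pi.single (i + 4) 1) z)
      (by rw [hf.preserves, hz]) hA hB
    exact ⟨_, hh.mul hf, hhz⟩
  by_cases hex : ∃ i ∉ D, i ≠ k ∧ i ≠ k + 4 ∧ z i ≠ 0
  · obtain ⟨i, hi, hik, hik', hzi⟩ := hex
    exact exists_of_apply_ne_zero z hz hzD i hi hik hik' hzi
  have hjz : z j = 0 := by
    by_contra h
    exact hex ⟨j, hj, hjk, hjk', h⟩
  have hj4 : z (j + 4) = 0 := by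
    by_contra h
    refine hex ⟨j + 4, hD' j hj, fun h => hjk' ?_, fun h => hjk (add_right_cancel h), h⟩
    rw [← h, add_four_add_four]
  obtain ⟨l, hl, hlz⟩ : ∃ l, (l = k ∨ l = k + 4) ∧ z l ≠ 0 := by
    obtain ⟨l, hl⟩ := Function.ne_iff.mp hz0
    refine ⟨l, ?_, hl⟩
    by_contra hcon
    rw [not_or] at hcon
    by_cases hlD : l ∈ D
    · exact hl (hzD l hlD)
    · exact hex ⟨l, hlD, hcon.1, hcon.2, hl⟩
  have hlD : l + 4 ∉ D := by
    rcases hl with rfl | rfl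
    · exact hD' _ hk
    · rwa [add_four_add_four]
  have hjl : j ≠ l ∧ j ≠ l + 4 := by
    rcases hl with rfl | rfl
    · exact ⟨hjk, hjk'⟩
    · rw [add_four_add_four]; exact ⟨hjk', hjk⟩
  have hf : FixMem H D (siegel (Pi.single (l + 4) 1) (Pi.single j 1)) :=
    fixMem_siegel hS (QPlus_single _ _) (by
      rw [polarForm_single, add_four_add_four, Pi.single_apply, if_neg hjl.1.symm]) (hsD _ hlD 1)
      (hsD _ hj 1)
  have hA : ∀ i ∈ D, siegel (Pi.single (l + 4) 1) (Pi.single j 1) z i = 0 := by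
    intro i hi
    have h1 := hf.preserves.polarForm z (Pi.single (i + 4) 1)
    rwa [hf.fix _ (hD i hi), polarForm_single, polarForm_single, add_four_add_four,
      hzD i hi] at h1
  have hB : siegel (Pi.single (l + 4) 1) (Pi.single j 1) z j ≠ 0 := by
    simp [siegel_apply, polarForm_single, add_four_add_four, Pi.single_apply,
      QPlus_single, hjz, hj4, hlz, hjl]
  obtain ⟨h, hh, hhz⟩ := exists_of_apply_ne_zero (siegel (Pi.single (l + 4) 1) (Pi.single j 1) z)
    (by rw [hf.preserves, hz]) hA j hj hjk hjk' hB
  exact ⟨_, hh.mul hf, hhz⟩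

/-- One step of the reduction of an isometry to one fixing many basis vectors. -/
theorem exists_fixMem_mul (hS : ∀ z, QPlus F z = 0 → HasSiegel H z)
    {D : Finset (Fin 8)} (hD : ∀ i ∈ D, i + 4 ∈ D) {j k : Fin 8} (hk : k ∉ D) (hj : j ∉ D)
    (hjk : j ≠ k) (hjk' : j ≠ k + 4) {g : Module.End F (Fin 8 → F)} (hg : Preserves g)
    (hgD : ∀ i ∈ D, g (Pi.single i 1) = Pi.single i 1) :
    ∃ h ∈ H, Preserves (h * g) ∧
      ∀ i ∈ insert k (insert (k + 4) D), (h * g) (Pi.single i 1) = Pi.single i 1 := by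
  have hort : ∀ f : Module.End F (Fin 8 → F), Preserves f →
      (∀ i ∈ D, f (Pi.single i 1) = Pi.single i 1) → ∀ l ∉ D, ∀ i ∈ D,
      f (Pi.single l 1) i = 0 := by
    intro f hf hfD l hl i hi
    have h1 := hf.polarForm (Pi.single l 1) (Pi.single (i + 4) 1)
    rw [hfD _ (hD i hi), polarForm_single, polarForm_single, add_four_add_four] at h1
    rw [h1, Pi.single_apply, if_neg]
    rintro rfl
    exact hl hi
  have hD' : ∀ i ∉ D, i + 4 ∉ D := fun i hi h => hi (add_four_add_four i ▸ hD _ h)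
  have hB : ∀ f : Module.End F (Fin 8 → F), Preserves f →
      polarForm (f (Pi.single (k + 4) 1)) (f (Pi.single k 1)) = 1 := by
    intro f hf
    rw [hf.polarForm, polarForm_single, Pi.single_eq_same]
  obtain ⟨h, hh, hhz⟩ := exists_fixMem_apply_eq_single hS hD hk hj hjk hjk'
    (z := g (Pi.single k 1)) (by rw [hg, QPlus_single]) (by
      intro h0
      have := hB g hg
      rw [h0] at this
      simp at this) (hort g hg hgD k hk)
  have hp := hh.preserves.mul hg
  have hfix : ∀ i ∈ D, (h * g) (Pi.single i 1) = Pi.single i 1 := fun i hi => by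
    rw [Module.End.mul_apply, hgD i hi, hh.fix i hi]
  have hb : polarForm ((h * g) (Pi.single (k + 4) 1)) (Pi.single k 1) = 1 := by
    have := hB _ hp
    rwa [Module.End.mul_apply h g (Pi.single k 1), hhz] at this
  set u := (h * g) (Pi.single (k + 4) 1) with hu
  have hn : polarForm ((1 : F)⁻¹ • (Pi.single (k + 4) 1 - u)) (Pi.single k 1) = 0 := by
    rw [polarForm_smul_left, polarForm_sub_left, hb, polarForm_single, Pi.single_eq_same, sub_self,
      mul_zero]
  have hf : FixMem H D (siegel (Pi.single k 1) ((1 : F)⁻¹ • (Pi.single (k + 4) 1 - u))) := by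
    refine fixMem_siegel hS (QPlus_single _ _) hn ?_ ?_
    · intro i hi
      rw [Pi.single_apply, if_neg]
      rintro rfl
      exact hk (hD i hi)
    · intro i hi
      have : i + 4 ≠ k + 4 := fun h => hk (add_right_cancel h ▸ hi)
      simp [hort _ hp hfix _ (hD' k hk) _ (hD i hi), hu, Pi.single_apply, this]
      exact hort _ hp hfix _ (hD' k hk) _ (hD i hi)
  refine ⟨_, H.mul_mem hf.mem hh.mem, ?_, ?_⟩
  · rw [mul_assoc]
    exact hf.preserves.mul hp
  · intro i hi
    rw [mul_assoc, Module.End.mul_apply]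
    rw [Finset.mem_insert, Finset.mem_insert] at hi
    rcases hi with rfl | rfl | hi
    · rw [Module.End.mul_apply h g, hhz]
      refine siegel_apply_of_orthogonal ?_ ?_
      · rw [polarForm_self, QPlus_single, mul_zero]
      · rw [polarForm_comm, hn]
    · rw [← hu]
      exact siegel_sub_apply one_ne_zero (by rw [hu, hp, QPlus_single]) (QPlus_single _ _) hb
    · rw [hfix i hi, hf.fix i hi]

end Elimination

section Torus

variable {F : Type*} [Field F]

/-- The diagonal isometry scaling the hyperbolic pair `(e₃, e₇)`. -/
def pairScale (s : F) : Module.End F (Fin 8 → F) :=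
  Matrix.toLin' (Matrix.diagonal ![1, 1, 1, s, 1, 1, 1, s⁻¹])

theorem pairScale_apply (s : F) (z : Fin 8 → F) :
    pairScale s z = ![z 0, z 1, z 2, s * z 3, z 4, z 5, z 6, s⁻¹ * z 7] := by
  funext i
  fin_cases i <;> simp [pairScale, Matrix.toLin'_apply, Matrix.mulVec_diagonal]

/-- The isometry swapping the two lines of the hyperbolic pair `(e₃, e₇)`. -/
def pairSwap (s : F) : Module.End F (Fin 8 → F) :=
  pairScale s * Matrix.toLin' ((Equiv.swap (3 : Fin 8) 7).toPEquiv.toMatrix)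

theorem pairSwap_apply (s : F) (z : Fin 8 → F) :
    pairSwap s z = ![z 0, z 1, z 2, s * z 7, z 4, z 5, z 6, s⁻¹ * z 3] := by
  have h : Matrix.toLin' ((Equiv.swap (3 : Fin 8) 7).toPEquiv.toMatrix : Matrix _ _ F) z =
      ![z 0, z 1, z 2, z 7, z 4, z 5, z 6, z 3] := by
    rw [Matrix.toLin'_apply, PEquiv.toMatrix_toPEquiv_mulVec]
    funext i
    fin_cases i <;> rfl
  rw [pairSwap, Module.End.mul_apply, h, pairScale_apply]
  rfl

theorem pairScale_single {s : F} {i : Fin 8} (h3 : i ≠ 3) (h7 : i ≠ 7) :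
    pairScale s (Pi.single i 1) = Pi.single i 1 := by
  rw [pairScale_apply]
  funext j
  fin_cases i <;> first | contradiction | (fin_cases j <;> simp)

theorem pairSwap_single {s : F} {i : Fin 8} (h3 : i ≠ 3) (h7 : i ≠ 7) :
    pairSwap s (Pi.single i 1) = Pi.single i 1 := by
  rw [pairSwap_apply]
  funext j
  fin_cases i <;> first | contradiction | (fin_cases j <;> simp)

theorem single_cases (i : Fin 8) : i = 3 ∨ i = 7 ∨ (i ≠ 3 ∧ i ≠ 7) := by
  tauto

theorem siegel_torus_apply {s : F} (hs : s ≠ 0) (z : Fin 8 → F) :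
    ((siegel (Pi.single 6 1) (((1 - s) / s) • Pi.single 7 1) *
      siegel (Pi.single 2 1) ((-1 : F) • Pi.single 3 1) *
      siegel (Pi.single 6 1) ((s - 1) • Pi.single 7 1) *
      siegel (Pi.single 2 1) ((1 / s) • Pi.single 3 1) : Module.End F (Fin 8 → F))) z =
    ![z 0, z 1, s * z 2, s * z 3, z 4, z 5, s⁻¹ * z 6, s⁻¹ * z 7] := by
  simp only [Module.End.mul_apply, siegel_apply, polarForm, QPlus]
  funext i
  fin_cases i <;> simp [Pi.single_apply] <;> field_simp <;> ring

theorem siegel_torus_apply' {s : F} (hs : s ≠ 0) (z : Fin 8 → F) :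
    ((siegel (Pi.single 6 1) (((1 - s) / s) • Pi.single 3 1) *
      siegel (Pi.single 2 1) ((-1 : F) • Pi.single 7 1) *
      siegel (Pi.single 6 1) ((s - 1) • Pi.single 3 1) *
      siegel (Pi.single 2 1) ((1 / s) • Pi.single 7 1) : Module.End F (Fin 8 → F))) z =
    ![z 0, z 1, s * z 2, s⁻¹ * z 3, z 4, z 5, s⁻¹ * z 6, s * z 7] := by
  simp only [Module.End.mul_apply, siegel_apply, polarForm, QPlus]
  funext i
  fin_cases i <;> simp [Pi.single_apply] <;> field_simp <;> ring

theorem pairScale_sq_mem {H : Submonoid (Module.End F (Fin 8 → F))}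
    (hS : ∀ z, QPlus F z = 0 → HasSiegel H z) {s : F} (hs : s ≠ 0) :
    pairScale (s ^ 2) ∈ H := by
  have key : ∀ (i j : Fin 8) (c : F), j + 4 ≠ i →
      siegel (Pi.single i 1) (c • Pi.single j 1) ∈ H := fun i j c hij =>
    hS _ (QPlus_single _ _) _ (by
      rw [polarForm_smul_left, polarForm_single, Pi.single_apply, if_neg, mul_zero]
      rintro rfl
      exact hij (add_four_add_four i))
  have e : pairScale (s ^ 2) =
      (siegel (Pi.single 6 1) (((1 - s) / s) • Pi.single 7 1) *
      siegel (Pi.single 2 1) ((-1 : F) • Pi.single 3 1) *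
      siegel (Pi.single 6 1) ((s - 1) • Pi.single 7 1) *
      siegel (Pi.single 2 1) ((1 / s) • Pi.single 3 1)) *
      (siegel (Pi.single 6 1) (((1 - s⁻¹) / s⁻¹) • Pi.single 3 1) *
      siegel (Pi.single 2 1) ((-1 : F) • Pi.single 7 1) *
      siegel (Pi.single 6 1) ((s⁻¹ - 1) • Pi.single 3 1) *
      siegel (Pi.single 2 1) ((1 / s⁻¹) • Pi.single 7 1)) := by
    refine LinearMap.ext fun z => ?_
    rw [Module.End.mul_apply, siegel_torus_apply' (inv_ne_zero hs), siegel_torus_apply hs,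
      pairScale_apply]
    funext i
    fin_cases i <;> simp <;> field_simp
  rw [e]
  refine H.mul_mem (H.mul_mem (H.mul_mem (H.mul_mem ?_ ?_) ?_) ?_)
    (H.mul_mem (H.mul_mem (H.mul_mem ?_ ?_) ?_) ?_) <;> exact key _ _ _ (by decide)

/-- An endomorphism is determined by the images of the standard basis. -/
theorem end_ext_single {f g : Module.End F (Fin 8 → F)}
    (h : ∀ i, f (Pi.single i 1) = g (Pi.single i 1)) : f = g := by
  refine (Pi.basisFun F (Fin 8)).ext fun i => ?_
  simpa using h i

/-- The isometries fixing three of the hyperbolic pairs. -/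
theorem apply_single_of_fix {r : Module.End F (Fin 8 → F)} (hr : Preserves r)
    (hfix : ∀ i : Fin 8, i ≠ 3 → i ≠ 7 → r (Pi.single i 1) = Pi.single i 1) :
    (∃ s : F, s ≠ 0 ∧ r = pairScale s) ∨
    (∃ s : F, s ≠ 0 ∧ r = pairSwap s) := by
  have h4 : ∀ i : Fin 8, i ≠ 3 → i ≠ 7 → i + 4 ≠ 3 ∧ i + 4 ≠ 7 := by decide
  have hz : ∀ j : Fin 8, (j = 3 ∨ j = 7) → ∀ i : Fin 8, i ≠ 3 → i ≠ 7 →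
      r (Pi.single j 1) i = 0 := by
    intro j hj i hi3 hi7
    have h1 := hr.polarForm (Pi.single j 1) (Pi.single (i + 4) 1)
    rw [hfix _ (h4 i hi3 hi7).1 (h4 i hi3 hi7).2, polarForm_single, polarForm_single,
      add_four_add_four] at h1
    rw [h1, Pi.single_apply, if_neg]
    rintro rfl
    tauto
  have e : ∀ j : Fin 8, (j = 3 ∨ j = 7) → r (Pi.single j 1) =
      ![0, 0, 0, r (Pi.single j 1) 3, 0, 0, 0, r (Pi.single j 1) 7] := by
    intro j hj
    funext i
    by_cases hi3 : i = 3
    · subst hi3; rfl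
    by_cases hi7 : i = 7
    · subst hi7; rfl
    rw [hz j hj i hi3 hi7]
    fin_cases i <;> simp_all
  have e3 := e 3 (Or.inl rfl)
  have e7 := e 7 (Or.inr rfl)
  set α := r (Pi.single 3 1) 3 with hα
  set β := r (Pi.single 3 1) 7 with hβ
  set γ := r (Pi.single 7 1) 3 with hγ
  set δ := r (Pi.single 7 1) 7 with hδ
  have q3 : α * β = 0 := by
    have := hr (Pi.single 3 1)
    rw [e3, QPlus_single] at this
    simpa [QPlus] using this
  have q7 : γ * δ = 0 := by
    have := hr (Pi.single 7 1)
    rw [e7, QPlus_single] at this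
    simpa [QPlus] using this
  have q37 : α * δ + β * γ = 1 := by
    have := hr.polarForm (Pi.single 3 1) (Pi.single 7 1)
    rw [e3, e7, polarForm_single] at this
    simpa [polarForm] using this
  by_cases hα0 : α = 0
  · have hβγ : β * γ = 1 := by simpa [hα0] using q37
    have hγ0 : γ ≠ 0 := right_ne_zero_of_mul_eq_one hβγ
    have hδ0 : δ = 0 := (mul_eq_zero.mp q7).resolve_left hγ0
    have hβ' : β = γ⁻¹ := eq_inv_of_mul_eq_one_left hβγ
    refine Or.inr ⟨γ, hγ0, end_ext_single fun i => ?_⟩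
    rcases single_cases i with rfl | rfl | ⟨hi3, hi7⟩
    · rw [e3, pairSwap_apply]; funext j; fin_cases j <;> simp [hα0, hβ']
    · rw [e7, pairSwap_apply]; funext j; fin_cases j <;> simp [hδ0]
    · rw [hfix i hi3 hi7, pairSwap_single hi3 hi7]
  · have hβ0 : β = 0 := (mul_eq_zero.mp q3).resolve_left hα0
    have hαδ : α * δ = 1 := by simpa [hβ0] using q37
    have hδ0 : δ ≠ 0 := right_ne_zero_of_mul_eq_one hαδ
    have hγ0 : γ = 0 := (mul_eq_zero.mp q7).resolve_right hδ0
    have hδ' : δ = α⁻¹ := eq_inv_of_mul_eq_one_right hαδ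
    refine Or.inl ⟨α, hα0, end_ext_single fun i => ?_⟩
    rcases single_cases i with rfl | rfl | ⟨hi3, hi7⟩
    · rw [e3, pairScale_apply]; funext j; fin_cases j <;> simp [hβ0]
    · rw [e7, pairScale_apply]; funext j; fin_cases j <;> simp [hγ0, hδ']
    · rw [hfix i hi3 hi7, pairScale_single hi3 hi7]

theorem exists_mul_eq_pairScale_mul {r r' : Module.End F (Fin 8 → F)} (hr : Preserves r)
    (hr' : Preserves r') (hfix : ∀ i : Fin 8, i ≠ 3 → i ≠ 7 → r (Pi.single i 1) = Pi.single i 1)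
    (hfix' : ∀ i : Fin 8, i ≠ 3 → i ≠ 7 → r' (Pi.single i 1) = Pi.single i 1) :
    ∃ s : F, s ≠ 0 ∧ r * r' = pairScale (s ^ 2) * (r' * r) := by
  rcases apply_single_of_fix hr hfix with ⟨s, hs, h⟩ | ⟨s, hs, h⟩ <;>
  rcases apply_single_of_fix hr' hfix' with ⟨t, ht, h'⟩ | ⟨t, ht, h'⟩
  · refine ⟨1, one_ne_zero, LinearMap.ext fun z => ?_⟩
    simp only [h, h', Module.End.mul_apply, pairScale_apply, pairSwap_apply]
    funext i; fin_cases i <;> simp <;> ring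
  · refine ⟨s, hs, LinearMap.ext fun z => ?_⟩
    simp only [h, h', Module.End.mul_apply, pairScale_apply, pairSwap_apply]
    funext i; fin_cases i <;> simp <;> field_simp
  · refine ⟨t⁻¹, inv_ne_zero ht, LinearMap.ext fun z => ?_⟩
    simp only [h, h', Module.End.mul_apply, pairScale_apply, pairSwap_apply]
    funext i; fin_cases i <;> simp <;> field_simp
  · refine ⟨s * t⁻¹, mul_ne_zero hs (inv_ne_zero ht), LinearMap.ext fun z => ?_⟩
    simp only [h, h', Module.End.mul_apply, pairScale_apply, pairSwap_apply]
    funext i; fin_cases i <;> simp <;> field_simp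

end Torus

open scoped commutatorElement

section Derived

variable {F : Type*} [Field F]

/-- The submonoid generated by all Siegel transformations. -/
def siegelMonoid (F : Type*) [Field F] : Submonoid (Module.End F (Fin 8 → F)) :=
  Submonoid.closure {g | ∃ v n : Fin 8 → F, QPlus F v = 0 ∧ polarForm n v = 0 ∧ g = siegel v n}

theorem hasSiegel_siegelMonoid (v : Fin 8 → F) (hv : QPlus F v = 0) :
    HasSiegel (siegelMonoid F) v := fun n hn =>
  Submonoid.subset_closure ⟨v, n, hv, hn, rfl⟩

theorem siegelMonoid_le {H : Submonoid (Module.End F (Fin 8 → F))}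
    (hS : ∀ z, QPlus F z = 0 → HasSiegel H z) : siegelMonoid F ≤ H := by
  refine (Submonoid.closure_le).mpr ?_
  rintro _ ⟨v, n, hv, hn, rfl⟩
  exact hS v hv n hn

theorem siegelMonoid_conj {g g' e : Module.End F (Fin 8 → F)} (hg : Preserves g)
    (h : g * g' = 1) (h' : g' * g = 1) (he : e ∈ siegelMonoid F) :
    g * e * g' ∈ siegelMonoid F := by
  induction he using Submonoid.closure_induction with
  | mem e he =>
    obtain ⟨v, n, hv, hn, rfl⟩ := he
    have : g * siegel v n * g' = siegel (g v) (g n) := siegel_conj hg h v n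
    rw [this]
    exact hasSiegel_siegelMonoid _ (by rw [hg, hv]) _ (by rw [hg.polarForm, hn])
  | one => rw [mul_one, h]; exact Submonoid.one_mem _
  | mul e f _ _ ihe ihf =>
    have : g * (e * f) * g' = (g * e * g') * (g * f * g') := by
      calc g * (e * f) * g' = g * e * 1 * f * g' := by simp [mul_assoc]
        _ = _ := by rw [← h']; simp [mul_assoc]
    rw [this]
    exact Submonoid.mul_mem _ ihe ihf

theorem isUnit_of_mem_siegelMonoid [Finite F] {e : Module.End F (Fin 8 → F)} (he : e ∈ siegelMonoid F) :
    IsUnit e := by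
  have : siegelMonoid F ≤ IsUnit.submonoid _ := (Submonoid.closure_le).mpr (by
    rintro _ ⟨v, n, hv, hn, rfl⟩
    exact isUnit_siegel hv hn)
  exact this he

theorem preserves_of_mem_siegelMonoid {e : Module.End F (Fin 8 → F)} (he : e ∈ siegelMonoid F) :
    Preserves e := by
  induction he using Submonoid.closure_induction with
  | mem e he =>
    obtain ⟨v, n, hv, hn, rfl⟩ := he
    exact siegel_preserves hv hn
  | one => exact fun _ => rfl
  | mul e f _ _ ihe ihf => exact ihe.mul ihf

theorem exists_siegelMonoid_mul_fix {g : Module.End F (Fin 8 → F)} (hg : Preserves g) :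
    ∃ h ∈ siegelMonoid F, Preserves (h * g) ∧
      ∀ i : Fin 8, i ≠ 3 → i ≠ 7 → (h * g) (Pi.single i 1) = Pi.single i 1 := by
  obtain ⟨h₀, hh₀, hp₀, hf₀⟩ := exists_fixMem_mul hasSiegel_siegelMonoid (D := ∅) (j := 3) (k := 0)
    (by decide) (by decide) (by decide) (by decide) (by decide) hg (by simp)
  obtain ⟨h₁, hh₁, hp₁, hf₁⟩ := exists_fixMem_mul hasSiegel_siegelMonoid (j := 3) (k := 1)
    (by decide) (by decide) (by decide) (by decide) (by decide) hp₀ hf₀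
  obtain ⟨h₂, hh₂, hp₂, hf₂⟩ := exists_fixMem_mul hasSiegel_siegelMonoid (j := 3) (k := 2)
    (by decide) (by decide) (by decide) (by decide) (by decide) hp₁ hf₁
  refine ⟨h₂ * h₁ * h₀, Submonoid.mul_mem _ (Submonoid.mul_mem _ hh₂ hh₁) hh₀, ?_, ?_⟩
  · simpa [mul_assoc] using hp₂
  · intro i h3 h7
    have hi : i ∈ insert (2 : Fin 8) (insert (2 + 4) (insert 1 (insert (1 + 4)
        (insert 0 (insert (0 + 4) (∅ : Finset (Fin 8))))))) := by
      revert i; decide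
    simpa [mul_assoc] using hf₂ i hi

/-- The action of `GL₈` on column vectors. -/
def glEnd (F : Type*) [Field F] : GL (Fin 8) F →* Module.End F (Fin 8 → F) :=
  (Matrix.toLinAlgEquiv' : Matrix (Fin 8) (Fin 8) F ≃ₐ[F] _).toMulEquiv.toMonoidHom.comp
    (Units.coeHom _)

theorem glEnd_apply (g : GL (Fin 8) F) : glEnd F g = Matrix.toLin' (g : Matrix (Fin 8) (Fin 8) F) :=
  rfl

theorem glEnd_injective : Function.Injective (glEnd F) := fun g h hgh => by
  rw [glEnd_apply, glEnd_apply] at hgh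
  exact Units.ext (Matrix.toLin'.injective hgh)

theorem mem_orthogonalGroupOf_iff {g : GL (Fin 8) F} :
    g ∈ orthogonalGroupOf F (QPlus F) ↔ Preserves (glEnd F g) := Iff.rfl

theorem exists_glEnd_eq {e : Module.End F (Fin 8 → F)} (he : IsUnit e) :
    ∃ g : GL (Fin 8) F, glEnd F g = e := by
  obtain ⟨u, rfl⟩ := he
  refine ⟨Units.map (Matrix.toLinAlgEquiv' : Matrix (Fin 8) (Fin 8) F ≃ₐ[F] _).symm.toMulEquiv.toMonoidHom u, ?_⟩
  exact (Matrix.toLinAlgEquiv' : Matrix (Fin 8) (Fin 8) F ≃ₐ[F] _).apply_symm_apply u.1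

variable [Finite F]

/-- The isometries that are products of Siegel transformations. -/
def siegelSubgroup (F : Type*) [Field F] [Finite F] :
    Subgroup (orthogonalGroupOf F (QPlus F)) where
  carrier := {g | glEnd F g ∈ siegelMonoid F}
  one_mem' := by
    change glEnd F 1 ∈ siegelMonoid F
    rw [map_one]; exact Submonoid.one_mem _
  mul_mem' := fun {g h} hg hh => by
    change glEnd F (g * h) ∈ siegelMonoid F
    rw [map_mul]
    exact Submonoid.mul_mem _ hg hh
  inv_mem' := fun {g} hg => by
    change glEnd F (g : GL (Fin 8) F)⁻¹ ∈ siegelMonoid F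
    refine inverse_mem (g := glEnd F g) hg ?_
    rw [← map_mul, mul_inv_cancel, map_one]

theorem mem_siegelSubgroup {g : orthogonalGroupOf F (QPlus F)} :
    g ∈ siegelSubgroup F ↔ glEnd F g ∈ siegelMonoid F := Iff.rfl

instance siegelSubgroup_normal : (siegelSubgroup F).Normal where
  conj_mem := fun n hn g => by
    rw [mem_siegelSubgroup] at hn ⊢
    change glEnd F ((g : GL (Fin 8) F) * n * (g : GL (Fin 8) F)⁻¹) ∈ siegelMonoid F
    rw [map_mul, map_mul]
    refine siegelMonoid_conj g.2 ?_ ?_ hn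
    · rw [← map_mul, mul_inv_cancel, map_one]
    · rw [← map_mul, inv_mul_cancel, map_one]

theorem exists_siegelSubgroup_mul_fix (g : orthogonalGroupOf F (QPlus F)) :
    ∃ h ∈ siegelSubgroup F, ∀ i : Fin 8, i ≠ 3 → i ≠ 7 →
      glEnd F (h * g : orthogonalGroupOf F (QPlus F)) (Pi.single i 1) = Pi.single i 1 := by
  obtain ⟨e, he, -, hfix⟩ := exists_siegelMonoid_mul_fix (g := glEnd F g) g.2
  obtain ⟨u, rfl⟩ := exists_glEnd_eq (isUnit_of_mem_siegelMonoid he)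
  refine ⟨⟨u, preserves_of_mem_siegelMonoid he⟩, he, fun i h3 h7 => ?_⟩
  have := hfix i h3 h7
  rwa [← map_mul] at this

theorem commutator_le_siegelSubgroup :
    commutator (orthogonalGroupOf F (QPlus F)) ≤ siegelSubgroup F := by
  rw [commutator_def, Subgroup.commutator_le]
  intro g _ g' _
  obtain ⟨h, hh, hfix⟩ := exists_siegelSubgroup_mul_fix g
  obtain ⟨h', hh', hfix'⟩ := exists_siegelSubgroup_mul_fix g'
  obtain ⟨s, hs, hcomm⟩ := exists_mul_eq_pairScale_mul
    (mem_orthogonalGroupOf_iff.mp (h * g).2) (mem_orthogonalGroupOf_iff.mp (h' * g').2) hfix hfix'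
  have hc : ⁅h * g, h' * g'⁆ ∈ siegelSubgroup F := by
    rw [mem_siegelSubgroup]
    have : glEnd F (⁅h * g, h' * g'⁆ : orthogonalGroupOf F (QPlus F)) = pairScale (s ^ 2) := by
      have e1 : (⁅h * g, h' * g'⁆ : orthogonalGroupOf F (QPlus F)) =
          ((h * g) * (h' * g')) * ((h' * g') * (h * g))⁻¹ := by
        rw [commutatorElement_def]; group
      rw [e1]
      change glEnd F ((((h * g : orthogonalGroupOf F (QPlus F)) : GL (Fin 8) F) *
        (h' * g' : orthogonalGroupOf F (QPlus F))) * (((h' * g' : orthogonalGroupOf F (QPlus F)) :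
          GL (Fin 8) F) * (h * g : orthogonalGroupOf F (QPlus F)))⁻¹) = _
      rw [map_mul, map_mul, hcomm, ← map_mul, mul_assoc, ← map_mul, mul_inv_cancel, map_one,
        mul_one]
    rw [this]
    exact pairScale_sq_mem hasSiegel_siegelMonoid hs
  rw [← QuotientGroup.eq_one_iff] at hh hh' hc ⊢
  have k1 : ((h * g : orthogonalGroupOf F (QPlus F)) : _ ⧸ siegelSubgroup F) = g := by
    rw [QuotientGroup.mk_mul, hh, one_mul]
  have k2 : ((h' * g' : orthogonalGroupOf F (QPlus F)) : _ ⧸ siegelSubgroup F) = g' := by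
    rw [QuotientGroup.mk_mul, hh', one_mul]
  have := map_commutatorElement (QuotientGroup.mk' (siegelSubgroup F)) (h * g) (h' * g')
  have h2 := map_commutatorElement (QuotientGroup.mk' (siegelSubgroup F)) g g'
  simp only [QuotientGroup.mk'_apply] at this h2
  rw [h2, ← k1, ← k2, ← this, hc]

end Derived

section GeneratorsDerived

variable {F : Type*} [Field F]

/-- The endomorphisms coming from the derived subgroup of the orthogonal group. -/
def derivedMonoid (F : Type*) [Field F] : Submonoid (Module.End F (Fin 8 → F)) :=
  ((commutator (orthogonalGroupOf F (QPlus F))).map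
    (orthogonalGroupOf F (QPlus F)).subtype).toSubmonoid.map (glEnd F)

theorem commutator_mem_derivedMonoid {g g' h h' : Module.End F (Fin 8 → F)} (hg : Preserves g)
    (hh : Preserves h) (e1 : g * g' = 1) (e2 : g' * g = 1) (e3 : h * h' = 1) (e4 : h' * h = 1) :
    g * h * g' * h' ∈ derivedMonoid F := by
  obtain ⟨u, rfl⟩ := exists_glEnd_eq (IsUnit.of_mul_eq_one _ e1)
  obtain ⟨w, rfl⟩ := exists_glEnd_eq (IsUnit.of_mul_eq_one _ e3)
  have k1 : g' = glEnd F u⁻¹ := left_inv_eq_right_inv e2 (by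
    rw [← map_mul, mul_inv_cancel, map_one])
  have k2 : h' = glEnd F w⁻¹ := left_inv_eq_right_inv e4 (by
    rw [← map_mul, mul_inv_cancel, map_one])
  subst k1 k2
  refine ⟨⁅u, w⁆, ⟨⁅(⟨u, hg⟩ : orthogonalGroupOf F (QPlus F)), ⟨w, hh⟩⁆, ?_, rfl⟩, ?_⟩
  · exact Subgroup.commutator_mem_commutator (Subgroup.mem_top _) (Subgroup.mem_top _)
  · rw [commutatorElement_def, map_mul, map_mul, map_mul]

/-- Siegel transformations centred at a basis vector are commutators with the isometry negating
all hyperbolic pairs but the one of `eᵢ`. -/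
theorem siegel_single_mem_derivedMonoid (h2 : (2 : F) ≠ 0) {i : Fin 8} {n : Fin 8 → F}
    (hi : n i = 0) (hi4 : n (i + 4) = 0) :
    siegel (Pi.single i 1) n ∈ derivedMonoid F := by
  set t : Module.End F (Fin 8 → F) :=
    Matrix.toLin' (Matrix.diagonal fun j => if j = i ∨ j = i + 4 then (1 : F) else -1) with ht
  have hta : ∀ z j, t z j = (if j = i ∨ j = i + 4 then (1 : F) else -1) * z j := fun z j => by
    rw [ht, Matrix.toLin'_apply, Matrix.mulVec_diagonal]
  have htt : t * t = 1 := by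
    refine LinearMap.ext fun z => funext fun j => ?_
    rw [Module.End.mul_apply, hta, hta, Module.End.one_apply]
    split_ifs <;> ring
  have hp : Preserves t := fun z => by
    simp only [QPlus, hta]
    clear_value t
    fin_cases i <;> simp
  have htv : t (Pi.single i 1) = Pi.single i 1 := by
    funext j
    rw [hta, Pi.single_apply]
    by_cases hj : j = i <;> simp [hj]
  have htn : t ((-(2 : F)⁻¹) • n) = -((-(2 : F)⁻¹) • n) := by
    funext j
    rw [hta]
    split_ifs with hj
    · rcases hj with rfl | rfl
      · simp [hi]
      · simp [hi4]
    · simp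
  have hv : QPlus F (Pi.single i 1 : Fin 8 → F) = 0 := QPlus_single _ _
  have hn : polarForm ((-(2 : F)⁻¹) • n) (Pi.single i 1) = 0 := by
    rw [polarForm_smul_left, polarForm_single, hi4, mul_zero]
  have hn' : polarForm (-((-(2 : F)⁻¹) • n)) (Pi.single i 1) = 0 := by
    rw [polarForm_neg_left, hn, neg_zero]
  have key := commutator_mem_derivedMonoid hp (siegel_preserves hv hn) htt htt
    (siegel_mul_neg hv hn) (by simpa using siegel_mul_neg hv hn')
  rw [siegel_conj hp htt, htv, htn, siegel_mul hv hn' hn'] at key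
  convert key using 2
  match_scalars
  field_simp
  norm_num

theorem yEnd_mem_derivedMonoid : (yEnd : Module.End F (Fin 8 → F)) ∈ derivedMonoid F := by
  set t : Module.End F (Fin 8 → F) := Matrix.toLin'
    ((Equiv.swap (1 : Fin 8) 6 * Equiv.swap (2 : Fin 8) 5).toPEquiv.toMatrix) with ht
  have hta : ∀ z, t z = ![z 0, z 6, z 5, z 3, z 4, z 2, z 1, z 7] := fun z => by
    rw [ht, Matrix.toLin'_apply, PEquiv.toMatrix_toPEquiv_mulVec]
    funext i
    fin_cases i <;> rfl
  have htt : t * t = 1 := by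
    refine LinearMap.ext fun z => ?_
    rw [Module.End.mul_apply, hta, hta, Module.End.one_apply]
    funext i
    fin_cases i <;> rfl
  have hp : Preserves t := fun z => by
    simp [QPlus, hta]
    ring
  have key := commutator_mem_derivedMonoid hp yEnd_preserves htt htt yEnd_mul_yEnd_mul_yEnd
    (by rw [mul_assoc]; exact yEnd_mul_yEnd_mul_yEnd)
  have e : t * yEnd * t * (yEnd * yEnd) = yEnd := by
    refine LinearMap.ext fun z => ?_
    simp only [Module.End.mul_apply, hta, yEnd_apply]
    funext i
    fin_cases i <;> rfl
  rwa [e] at key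

/-- The isometry negating two of the hyperbolic pairs. -/
def negPairs (F : Type*) [Field F] : Module.End F (Fin 8 → F) :=
  Matrix.toLin' (Matrix.diagonal ![1, -1, -1, 1, 1, -1, -1, 1])

theorem negPairs_apply (z : Fin 8 → F) :
    negPairs F z = ![z 0, -z 1, -z 2, z 3, z 4, -z 5, -z 6, z 7] := by
  funext i
  fin_cases i <;> simp [negPairs, Matrix.toLin'_apply, Matrix.mulVec_diagonal]

theorem negPairs_mem_derivedMonoid : negPairs F ∈ derivedMonoid F := by
  set t : Module.End F (Fin 8 → F) := Matrix.toLin'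
    ((Equiv.swap (1 : Fin 8) 2 * Equiv.swap (5 : Fin 8) 6).toPEquiv.toMatrix) with ht
  have hta : ∀ z, t z = ![z 0, z 2, z 1, z 3, z 4, z 6, z 5, z 7] := fun z => by
    rw [ht, Matrix.toLin'_apply, PEquiv.toMatrix_toPEquiv_mulVec]
    funext i
    fin_cases i <;> rfl
  set d : Module.End F (Fin 8 → F) :=
    Matrix.toLin' (Matrix.diagonal ![1, -1, 1, 1, 1, -1, 1, 1]) with hd
  have hda : ∀ z, d z = ![z 0, -z 1, z 2, z 3, z 4, -z 5, z 6, z 7] := fun z => by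
    funext i
    fin_cases i <;> simp [hd, Matrix.toLin'_apply, Matrix.mulVec_diagonal]
  have htt : t * t = 1 := by
    refine LinearMap.ext fun z => ?_
    rw [Module.End.mul_apply, hta, hta, Module.End.one_apply]
    funext i
    fin_cases i <;> rfl
  have hdd : d * d = 1 := by
    refine LinearMap.ext fun z => ?_
    rw [Module.End.mul_apply, hda, hda, Module.End.one_apply]
    funext i
    fin_cases i <;> simp
  have hpt : Preserves t := fun z => by
    simp [QPlus, hta]
    ring
  have hpd : Preserves d := fun z => by
    simp [QPlus, hda]
  have key := commutator_mem_derivedMonoid hpt hpd htt htt hdd hdd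
  have e : t * d * t * d = negPairs F := by
    refine LinearMap.ext fun z => ?_
    simp only [Module.End.mul_apply, hta, hda, negPairs_apply]
    funext i
    fin_cases i <;> rfl
  rwa [e] at key

theorem xEnd_mem_derivedMonoid (h2 : (2 : F) ≠ 0) (a : F) : xEnd a ∈ derivedMonoid F := by
  have e0 : ∀ z : Fin 8 → F, siegel (Pi.single 0 1) (-Pi.single 5 1) z =
      ![z 0 + z 1, z 1, z 2, z 3, z 4, z 5 - z 4, z 6, z 7] := fun z => by
    funext i
    fin_cases i <;> simp [siegel_apply, polarForm, QPlus] <;> ring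
  have e4 : ∀ z : Fin 8 → F, siegel (Pi.single 4 1) (mv 0) z =
      ![z 0, z 1 - z 0, z 2 + z 0, z 3, z 4 + z 5 - z 6 - z 3, z 5, z 6, z 7 + z 0] := fun z => by
    funext i
    simp only [siegel_apply, Pi.add_apply, Pi.sub_apply, Pi.smul_apply]
    fin_cases i <;> simp [polarForm, QPlus, mv] <;> ring
  have e7 : ∀ z : Fin 8 → F,
      siegel (Pi.single 7 1) (-a • Pi.single 2 1 - (2 : F) • Pi.single 6 1) z =
      ![z 0, z 1, z 2 - a * z 3, z 3, z 4, z 5, z 6 - 2 * z 3,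
        z 7 + a * z 6 + 2 * z 2 - 2 * a * z 3] := fun z => by
    funext i
    fin_cases i <;> simp [siegel_apply, polarForm, QPlus] <;> ring
  have e : xEnd a = siegel (Pi.single 0 1) (-Pi.single 5 1) * siegel (Pi.single 4 1) (mv 0) *
      siegel (Pi.single 0 1) (-Pi.single 5 1) *
      siegel (Pi.single 7 1) (-a • Pi.single 2 1 - (2 : F) • Pi.single 6 1) * negPairs F := by
    refine LinearMap.ext fun z => ?_
    simp only [Module.End.mul_apply, negPairs_apply, xEnd_apply, e0, e4, e7]
    funext i
    fin_cases i <;> simp <;> ring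
  rw [e]
  refine Submonoid.mul_mem _ (Submonoid.mul_mem _ (Submonoid.mul_mem _ (Submonoid.mul_mem _
    ?_ ?_) ?_) ?_) negPairs_mem_derivedMonoid <;>
    apply siegel_single_mem_derivedMonoid h2 <;> simp [mv]

end GeneratorsDerived

section Assembly

variable {F : Type*} [Field F] [Finite F]

theorem orderOf_xPlusOdd (h2 : (2 : F) ≠ 0) {a : F} {xu : GL (Fin 8) F}
    (hx : glEnd F xu = xEnd a) : orderOf xu = 2 := by
  refine orderOf_eq_prime ?_ ?_
  · refine glEnd_injective ?_
    rw [pow_two, map_mul, hx, xEnd_mul_xEnd, map_one]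
  · rintro rfl
    rw [map_one] at hx
    have := congrFun (LinearMap.congr_fun hx (Pi.single 2 1)) 2
    rw [xEnd_apply] at this
    simp at this
    exact h2 (by linear_combination this)

theorem orderOf_yPlus {yu : GL (Fin 8) F} (hy : glEnd F yu = yEnd) : orderOf yu = 3 := by
  have : Fact (Nat.Prime 3) := ⟨Nat.prime_three⟩
  refine orderOf_eq_prime ?_ ?_
  · refine glEnd_injective ?_
    rw [pow_succ', pow_two, map_mul, map_mul, hy, yEnd_mul_yEnd_mul_yEnd, map_one]
  · rintro rfl
    rw [map_one] at hy
    have := congrFun (LinearMap.congr_fun hy (Pi.single 1 1)) 1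
    rw [yEnd_apply] at this
    simp at this

/-- If every monoid containing the generators contains all Siegel transformations, then the
generators generate the derived subgroup. -/
theorem closure_eq_map_commutator (h2 : (2 : F) ≠ 0) {a : F} {xu yu : GL (Fin 8) F}
    (hx : glEnd F xu = xEnd a) (hy : glEnd F yu = yEnd)
    (hS : ∀ H : Submonoid (Module.End F (Fin 8 → F)), xEnd a ∈ H → yEnd ∈ H →
      ∀ z, QPlus F z = 0 → HasSiegel H z) :
    Subgroup.closure {xu, yu} = Subgroup.map (orthogonalGroupOf F (QPlus F)).subtype
      (commutator ↥(orthogonalGroupOf F (QPlus F))) := by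
  refine le_antisymm ?_ ?_
  · rw [Subgroup.closure_le]
    have key : ∀ u : GL (Fin 8) F, glEnd F u ∈ derivedMonoid F →
        u ∈ Subgroup.map (orthogonalGroupOf F (QPlus F)).subtype
          (commutator ↥(orthogonalGroupOf F (QPlus F))) := by
      rintro u ⟨w, hw, hwu⟩
      rwa [← glEnd_injective hwu]
    rintro u (rfl | rfl)
    · exact key _ (hx ▸ xEnd_mem_derivedMonoid h2 a)
    · exact key _ (hy ▸ yEnd_mem_derivedMonoid)
  · rintro _ ⟨g, hg, rfl⟩
    have h1 := commutator_le_siegelSubgroup hg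
    rw [mem_siegelSubgroup] at h1
    have h3 := siegelMonoid_le (hS ((Subgroup.closure {xu, yu}).toSubmonoid.map (glEnd F))
      ⟨xu, Subgroup.subset_closure (by simp), hx⟩ ⟨yu, Subgroup.subset_closure (by simp), hy⟩) h1
    obtain ⟨w, hw, hwg⟩ := h3
    have : w = g := glEnd_injective hwg
    rw [Subgroup.subtype_apply, ← this]
    exact hw

end Assembly

section Palindromic

open Polynomial

variable {F : Type*} [Field F]

/-- Palindromic quartics are separable when three simple quantities do not vanish. -/
theorem separable_palindromic {b d : F} (h1 : 2 + 2 * b + d ≠ 0) (h2 : 2 - 2 * b + d ≠ 0)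
    (h3 : b ^ 2 - 4 * (d - 2) ≠ 0) :
    (X ^ 4 + C b * X ^ 3 + C d * X ^ 2 + C b * X + 1 : F[X]).Separable := by
  set r : F[X] := X ^ 4 + C b * X ^ 3 + C d * X ^ 2 + C b * X + 1 with hr
  set t : F[X] := 2 * X ^ 2 + C b * X + 2 with ht
  have hX : IsCoprime r X := ⟨1, -(X ^ 3 + C b * X ^ 2 + C d * X + C b), by rw [hr]; ring⟩
  have hC : ∀ c : F, c ≠ 0 → C c⁻¹ * C c = (1 : F[X]) := fun c hc => by
    rw [← C_mul, inv_mul_cancel₀ hc, C_1]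
  have hX1 : IsCoprime r (X - 1) := by
    refine ⟨C (2 + 2 * b + d)⁻¹, -C (2 + 2 * b + d)⁻¹ *
      (X ^ 3 + (1 + C b) * X ^ 2 + (1 + C b + C d) * X + (1 + 2 * C b + C d)), ?_⟩
    have := hC _ h1
    rw [hr]
    simp only [C_add, C_mul, C_ofNat] at this ⊢
    linear_combination this
  have hX2 : IsCoprime r (X + 1) := by
    refine ⟨C (2 - 2 * b + d)⁻¹, -C (2 - 2 * b + d)⁻¹ *
      (X ^ 3 + (C b - 1) * X ^ 2 + (1 - C b + C d) * X + (-1 + 2 * C b - C d)), ?_⟩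
    have := hC _ h2
    rw [hr]
    simp only [C_add, C_sub, C_mul, C_ofNat] at this ⊢
    linear_combination this
  have hu : IsUnit (C (b ^ 2 - 4 * (d - 2)) : F[X]) := isUnit_C.mpr (isUnit_iff_ne_zero.mpr h3)
  have ht' : IsCoprime r t := by
    have k1 : IsCoprime r (C (b ^ 2 - 4 * (d - 2)) * X ^ 2) :=
      (isCoprime_mul_unit_left_right hu _ _).mpr hX.pow_right
    have k2 : (C (b ^ 2 - 4 * (d - 2)) * X ^ 2 : F[X]) = t ^ 2 + r * (-4) := by
      simp only [C_sub, C_mul, C_pow, C_ofNat]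
      rw [ht, hr]; ring
    rw [k2] at k1
    exact (IsCoprime.pow_right_iff two_pos).mp k1.of_add_mul_left_right
  have hprod : IsCoprime r ((X - 1) * (X + 1) * t) := (hX1.mul_right hX2).mul_right ht'
  have hder : derivative r = 4 * X ^ 3 + 3 * C b * X ^ 2 + 2 * C d * X + C b := by
    rw [hr]
    simp only [derivative_add, derivative_mul, derivative_X_pow, derivative_C, derivative_X,
      derivative_one]
    push_cast
    simp only [C_ofNat]
    ring
  have k3 : (X - 1) * (X + 1) * t = X * derivative r + r * (-2) := by
    rw [hder, ht, hr]; ring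
  rw [k3] at hprod
  exact hprod.of_add_mul_left_right.of_mul_right_right

theorem aeval_palindromic {A : Type*} [Ring A] [Algebra F A] (b d : F) (Z : A) :
    aeval Z (X ^ 4 + C b * X ^ 3 + C d * X ^ 2 + C b * X + 1 : F[X]) =
      Z ^ 4 + b • Z ^ 3 + d • Z ^ 2 + b • Z + 1 := by
  simp [Algebra.smul_def]

end Palindromic

/-- Passing from a commutative algebra to commuting elements: the semisimple part `c * (1 - N)`
is a root of a palindromic quartic. -/
theorem palindromic_of_comm {F A : Type*} [Field F] [CommRing A] [Algebra F A] {a : F} {c c' N : A}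
    (hc : c * c' = 1) (hN : N * N = 0)
    (h : (c + c') * (c + c') - a • (c + c') + (a ^ 2 - 4) • 1 =
      ((2 : F) • (c + c') - a • (1 : A)) * (c - c') * N) :
    (c * (1 - N)) ^ 4 + (-a) • (c * (1 - N)) ^ 3 + (a ^ 2 - 2) • (c * (1 - N)) ^ 2 +
      (-a) • (c * (1 - N)) + 1 = 0 := by
  simp only [Algebra.smul_def, map_sub, map_pow, map_neg, map_ofNat] at h ⊢
  set α := algebraMap F A a
  set Z := c * (1 - N) with hZ
  set Z' := c' * (1 + N) with hZ'
  have h1 : Z * Z' = 1 := by rw [hZ, hZ']; linear_combination (1 - N * N) * hc - hN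
  have h2 : (Z + Z') ^ 2 - α * (Z + Z') + α ^ 2 - 4 = 0 := by
    rw [hZ, hZ']
    linear_combination h + (c - c') ^ 2 * hN
  linear_combination Z ^ 2 * h2 - (2 * Z ^ 2 + Z * Z' + 1 - α * Z) * h1

theorem palindromic_of_commute {F A : Type*} [Field F] [Ring A] [Algebra F A] {a : F} {c c' N : A}
    (hc : c * c' = 1) (hc' : c' * c = 1) (hN : N * N = 0) (hcN : c * N = N * c)
    (h : (c + c') * (c + c') - a • (c + c') + (a ^ 2 - 4) • 1 =
      ((2 : F) • (c + c') - a • (1 : A)) * (c - c') * N) :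
    (c * (1 - N)) ^ 4 + (-a) • (c * (1 - N)) ^ 3 + (a ^ 2 - 2) • (c * (1 - N)) ^ 2 +
      (-a) • (c * (1 - N)) + 1 = 0 := by
  have hcN' : c' * N = N * c' := by
    calc c' * N = c' * N * (c * c') := by rw [hc, mul_one]
      _ = c' * (N * c) * c' := by simp only [mul_assoc]
      _ = (c' * c) * N * c' := by rw [← hcN]; simp only [mul_assoc]
      _ = N * c' := by rw [hc', one_mul]
  have hcomm : ∀ x ∈ ({c, c', N} : Set A), ∀ y ∈ ({c, c', N} : Set A), x * y = y * x := by
    rintro x (rfl | rfl | rfl) y (rfl | rfl | rfl) <;> simp [hc, hc', hcN, hcN']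
  letI := Algebra.adjoinCommRingOfComm F hcomm
  have := palindromic_of_comm (F := F) (a := a)
    (c := (⟨c, Algebra.subset_adjoin (by simp)⟩ : Algebra.adjoin F {c, c', N}))
    (c' := ⟨c', Algebra.subset_adjoin (by simp)⟩) (N := ⟨N, Algebra.subset_adjoin (by simp)⟩)
    (Subtype.ext hc) (Subtype.ext hN) (Subtype.ext h)
  exact congrArg Subtype.val this

section Word

variable {F : Type*} [Field F]

/-- The word `x y x y⁻¹`. -/
def cEnd (a : F) : Module.End F (Fin 8 → F) := xEnd a * yEnd * xEnd a * (yEnd * yEnd)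

/-- The word `y x y⁻¹ x`. -/
def cInv (a : F) : Module.End F (Fin 8 → F) := yEnd * xEnd a * (yEnd * yEnd) * xEnd a

theorem cEnd_apply (a : F) (z : Fin 8 → F) :
    cEnd a z = ![-z 0 - z 1 + 2 * z 3 + 2 * a * z 5 + z 6 + a * z 7,
      z 6,
      -(1 + a) * z 0 - z 1 + (2 + a) * z 3 + z 4 + (1 + 2 * a + a ^ 2) * z 5 + a * z 6 + (1 +
        a) * z 7,
      z 0 - z 3 - a * z 5 - z 6,
      -z 3 - (1 + a) * z 5 - z 6,
      z 2 + z 3 - (1 - a) * z 5 + z 6 - z 7,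
      -z 0 + 2 * z 3 + 2 * a * z 5 + 2 * z 6,
      -(1 + a) * z 0 - z 1 + (2 + 2 * a) * z 3 + 2 * z 4 + (2 * a + 2 * a ^ 2) * z 5 +
        2 * a * z 6 + (1 + a) * z 7] := by
  simp only [cEnd, Module.End.mul_apply, xEnd_apply, yEnd_apply]
  funext i
  fin_cases i <;> simp <;> ring

theorem cInv_apply (a : F) (z : Fin 8 → F) :
    cInv a z = ![2 * z 3 + z 6,
      -(1 + a) * z 0 - (1 - a) * z 1 + 2 * a * z 2 + (2 * a + 2 * a ^ 2) * z 3 + 2 * a * z 4 +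
        (1 + 2 * a + a ^ 2) * z 6 - a * z 7,
      -z 0 + z 1 + 2 * z 2 + 2 * a * z 3 + z 4 + z 5 + a * z 6 - z 7,
      -z 1 + (1 + a) * z 3 + a * z 4 + (1 + a) * z 6,
      -z 2 - (1 + a) * z 3 - z 4 - (1 + a) * z 6 + z 7,
      -z 3 - z 4 - z 6,
      z 1,
      -z 0 + z 1 + 2 * z 2 + (2 + 2 * a) * z 3 + 2 * z 4 + (2 + a) * z 6 - z 7] := by
  simp only [cInv, Module.End.mul_apply, xEnd_apply, yEnd_apply]
  funext i
  fin_cases i <;> simp <;> ring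

theorem cEnd_mul_cInv (a : F) : cEnd a * cInv a = 1 := by
  refine LinearMap.ext fun z => ?_
  rw [Module.End.mul_apply, Module.End.one_apply]
  conv_rhs => rw [eta_fin_eight z]
  simp only [cEnd_apply, cInv_apply]
  funext i
  fin_cases i <;> simp <;> ring

theorem cInv_mul_cEnd (a : F) : cInv a * cEnd a = 1 := by
  refine LinearMap.ext fun z => ?_
  rw [Module.End.mul_apply, Module.End.one_apply]
  conv_rhs => rw [eta_fin_eight z]
  simp only [cEnd_apply, cInv_apply]
  funext i
  fin_cases i <;> simp <;> ring

/-- The second basis vector. -/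
def e2 : Fin 8 → F := ![0, 1, 0, 0, 0, 0, 0, 0]

/-- A square-zero element commuting with `cEnd a`; it is, up to a scalar, the nilpotent part of
the Jordan decomposition of `cEnd a`. -/
def omegaEnd (a : F) : Module.End F (Fin 8 → F) :=
  (-(2 * a ^ 3 + 4 * a ^ 2 - 3 * a - 4)) • wedge e1 e2 - (2 * a ^ 2 + 3 * a - 4) • wedge e1 (mv 0) +
    (a * (a + 2)) • wedge e1 (mv 1) + ((a + 2) * (a ^ 2 + a - 4)) • wedge e2 (mv 0) +
    (3 * a ^ 2 + 5 * a - 4) • wedge e2 (mv 1) + (2 * a ^ 2 + 3 * a - 4) • wedge (mv 0) (mv 1)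

theorem omegaEnd_apply (a : F) (z : Fin 8 → F) :
    omegaEnd a z = ![
      (2 * a + a ^ 2) * z 2 - (4 - 3 * a - 2 * a ^ 2) * z 3 - (8 * a - a ^ 2 - 2 * a ^ 3) * z 5 -
        (4 - 3 * a - 2 * a ^ 2) * z 6 - (2 * a + a ^ 2) * z 7,
      (2 * a + a ^ 2) * z 2 + (4 + 5 * a - a ^ 2 - a ^ 3) * z 3 + (8 * a - a ^ 2 -
        2 * a ^ 3) * z 4 + (4 + 5 * a - a ^ 2 - a ^ 3) * z 6 - (2 * a + a ^ 2) * z 7,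
      -(4 - 3 * a - 2 * a ^ 2) * z 2 + (4 - 3 * a - 2 * a ^ 2) * z 4 - (4 + 5 * a - a ^ 2 -
        a ^ 3) * z 5 + (4 - 3 * a - 2 * a ^ 2) * z 7,
      -(4 - 3 * a - 2 * a ^ 2) * z 3 + (2 * a + a ^ 2) * z 4 + (2 * a + a ^ 2) * z 5 - (4 -
        3 * a - 2 * a ^ 2) * z 6,
      0,
      0,
      (4 - 3 * a - 2 * a ^ 2) * z 3 - (2 * a + a ^ 2) * z 4 - (2 * a + a ^ 2) * z 5 + (4 -
        3 * a - 2 * a ^ 2) * z 6,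
      -(4 - 3 * a - 2 * a ^ 2) * z 2 + (4 - 3 * a - 2 * a ^ 2) * z 4 - (4 + 5 * a - a ^ 2 -
        a ^ 3) * z 5 + (4 - 3 * a - 2 * a ^ 2) * z 7] := by
  simp only [omegaEnd, LinearMap.add_apply, LinearMap.sub_apply, LinearMap.smul_apply, wedge_apply]
  funext i
  fin_cases i <;> simp [e1, e2, mv, polarForm] <;> ring

theorem cEnd_mul_omegaEnd (a : F) : cEnd a * omegaEnd a = omegaEnd a * cEnd a := by
  refine LinearMap.ext fun z => ?_
  simp only [Module.End.mul_apply, cEnd_apply, omegaEnd_apply]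
  funext i
  fin_cases i <;> simp <;> ring

theorem omegaEnd_mul_omegaEnd (a : F) : omegaEnd a * omegaEnd a = 0 := by
  refine LinearMap.ext fun z => ?_
  simp only [Module.End.mul_apply, omegaEnd_apply]
  funext i
  fin_cases i <;> simp <;> ring

theorem cEnd_add_cInv_apply (a : F) (z : Fin 8 → F) :
    (cEnd a + cInv a) z = ![-z 0 - z 1 + 4 * z 3 + 2 * a * z 5 + 2 * z 6 + a * z 7,
      -(1 + a) * z 0 - (1 - a) * z 1 + 2 * a * z 2 + (2 * a + 2 * a ^ 2) * z 3 + 2 * a * z 4 +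
        (2 + 2 * a + a ^ 2) * z 6 - a * z 7,
      -(2 + a) * z 0 + 2 * z 2 + (2 + 3 * a) * z 3 + 2 * z 4 + (2 + 2 * a + a ^ 2) * z 5 +
        2 * a * z 6 + a * z 7,
      z 0 - z 1 + a * z 3 + a * z 4 - a * z 5 + a * z 6,
      -z 2 - (2 + a) * z 3 - z 4 - (1 + a) * z 5 - (2 + a) * z 6 + z 7,
      z 2 - z 4 - (1 - a) * z 5 - z 7,
      -z 0 + z 1 + 2 * z 3 + 2 * a * z 5 + 2 * z 6,
      -(2 + a) * z 0 + 2 * z 2 + (4 + 4 * a) * z 3 + 4 * z 4 + (2 * a + 2 * a ^ 2) * z 5 + (2 +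
        3 * a) * z 6 + a * z 7] := by
  simp only [LinearMap.add_apply, cEnd_apply, cInv_apply]
  funext i
  fin_cases i <;> simp <;> ring

theorem cEnd_sub_cInv_mul_omegaEnd_apply (a : F) (z : Fin 8 → F) :
    ((cEnd a - cInv a) * omegaEnd a) z = ![-(8 * a - a ^ 2 - 2 * a ^ 3) * z 2 -
        (8 * a + a ^ 2 - a ^ 3) * z 3 - (4 * a +
        2 * a ^ 2) * z 4 + (4 * a - 6 * a ^ 2 - a ^ 3 + a ^ 4) * z 5 - (8 * a + a ^ 2 -
        a ^ 3) * z 6 + (8 * a - a ^ 2 - 2 * a ^ 3) * z 7,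
      (8 * a - a ^ 2 - 2 * a ^ 3) * z 2 + (3 * a ^ 2 - a ^ 3 - a ^ 4) * z 3 + (4 * a -
        6 * a ^ 2 - a ^ 3 + a ^ 4) * z 4 - (4 * a + 2 * a ^ 2) * z 5 + (3 * a ^ 2 - a ^ 3 -
        a ^ 4) * z 6 - (8 * a - a ^ 2 - 2 * a ^ 3) * z 7,
      -(8 * a + a ^ 2 - a ^ 3) * z 2 - (16 - 4 * a + 2 * a ^ 3) * z 3 - (8 * a + a ^ 2 -
        a ^ 3) * z 4 + (3 * a ^ 2 - a ^ 3 - a ^ 4) * z 5 - (16 - 4 * a + 2 * a ^ 3) * z 6 +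
        (8 * a + a ^ 2 - a ^ 3) * z 7,
      (4 * a + 2 * a ^ 2) * z 2 + (8 * a + a ^ 2 - a ^ 3) * z 3 + (8 * a - a ^ 2 -
        2 * a ^ 3) * z 4 - (8 * a - a ^ 2 - 2 * a ^ 3) * z 5 + (8 * a + a ^ 2 - a ^ 3) * z 6 -
        (4 * a + 2 * a ^ 2) * z 7,
      0,
      0,
      -(4 * a + 2 * a ^ 2) * z 2 - (8 * a + a ^ 2 - a ^ 3) * z 3 - (8 * a - a ^ 2 -
        2 * a ^ 3) * z 4 + (8 * a - a ^ 2 - 2 * a ^ 3) * z 5 - (8 * a + a ^ 2 - a ^ 3) * z 6 +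
        (4 * a + 2 * a ^ 2) * z 7,
      -(8 * a + a ^ 2 - a ^ 3) * z 2 - (16 - 4 * a + 2 * a ^ 3) * z 3 - (8 * a + a ^ 2 -
        a ^ 3) * z 4 + (3 * a ^ 2 - a ^ 3 - a ^ 4) * z 5 - (16 - 4 * a + 2 * a ^ 3) * z 6 +
        (8 * a + a ^ 2 - a ^ 3) * z 7] := by
  simp only [Module.End.mul_apply, LinearMap.sub_apply]
  rw [omegaEnd_apply]
  simp only [cEnd_apply, cInv_apply]
  funext i
  fin_cases i <;> simp <;> ring

set_option maxHeartbeats 1000000 in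
theorem cEnd_quadratic (a : F) :
    (16 - 3 * a ^ 2) • ((cEnd a + cInv a) * (cEnd a + cInv a) - a • (cEnd a + cInv a) +
      (a ^ 2 - 4) • (1 : Module.End F (Fin 8 → F))) =
    (2 : F) • (((2 : F) • (cEnd a + cInv a) - a • (1 : Module.End F (Fin 8 → F))) *
      ((cEnd a - cInv a) * omegaEnd a)) := by
  refine LinearMap.ext fun z => ?_
  have h1 := cEnd_add_cInv_apply a z
  have h2 := cEnd_sub_cInv_mul_omegaEnd_apply a z
  have h3 := cEnd_add_cInv_apply a
  generalize (cEnd a - cInv a) * omegaEnd a = M at *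
  generalize cEnd a + cInv a = S at *
  rw [LinearMap.smul_apply, LinearMap.smul_apply, Module.End.mul_apply]
  rw [h2]
  simp only [Module.End.mul_apply, LinearMap.add_apply, LinearMap.sub_apply, LinearMap.smul_apply,
    Module.End.one_apply]
  rw [h1]
  rw [h3, h3]
  funext i
  simp only [Pi.smul_apply, Pi.add_apply, Pi.sub_apply]
  fin_cases i <;> simp [-mul_eq_zero, -zero_eq_mul] <;> ring

end Word

section Unipotent

variable {F : Type*} [Field F]

theorem one_add_pow_char {A : Type*} [Ring A] [Algebra F A] (p : ℕ) [CharP F p] {N : A}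
    (hN : N * N = 0) : (1 + N) ^ p = 1 := by
  have h : ∀ k : ℕ, (1 + N) ^ k = 1 + (k : F) • N := fun k => by
    induction k with
    | zero => simp
    | succ k ih =>
      rw [pow_succ, ih, mul_add, add_mul, add_mul, smul_mul_assoc _ N N, hN]
      simp only [one_mul, mul_one, smul_zero, Nat.cast_add, Nat.cast_one]
      module
  rw [h, CharP.cast_eq_zero, zero_smul, add_zero]

variable [Finite F] {H : Submonoid (Module.End F (Fin 8 → F))}

/-- The unipotent part of `cEnd a`. -/
theorem one_add_omegaEnd_mem (p : ℕ) [Fact p.Prime] [CharP F p] {a : F} (ha0 : a ≠ 0)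
    (ha2 : a + 2 ≠ 0) (ha2' : a - 2 ≠ 0) (hδ : 16 - 3 * a ^ 2 ≠ 0) (hX : xEnd a ∈ H)
    (hY : yEnd ∈ H) : 1 + (2 / (16 - 3 * a ^ 2)) • omegaEnd a ∈ H := by
  set N := (2 / (16 - 3 * a ^ 2)) • omegaEnd a with hNdef
  have hN : N * N = 0 := by
    rw [hNdef, smul_mul_smul_comm, omegaEnd_mul_omegaEnd, smul_zero]
  have hcN : cEnd a * N = N * cEnd a := by
    rw [hNdef, mul_smul_comm, smul_mul_assoc, cEnd_mul_omegaEnd]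
  have hquad : (cEnd a + cInv a) * (cEnd a + cInv a) - a • (cEnd a + cInv a) +
      (a ^ 2 - 4) • (1 : Module.End F (Fin 8 → F)) =
      ((2 : F) • (cEnd a + cInv a) - a • (1 : Module.End F (Fin 8 → F))) *
        (cEnd a - cInv a) * N := by
    have h := congrArg (fun M => (16 - 3 * a ^ 2)⁻¹ • M) (cEnd_quadratic a)
    simp only [inv_smul_smul₀ hδ] at h
    rw [h, hNdef, mul_smul_comm, smul_smul, mul_assoc, inv_mul_eq_div]
  have hpal := palindromic_of_commute (cEnd_mul_cInv a) (cInv_mul_cEnd a) hN hcN hquad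
  have hcomm : Commute (cEnd a * (1 - N)) (1 + N) := by
    show _ * _ = _ * _
    simp only [mul_add, mul_sub, add_mul, sub_mul, mul_one, one_mul, ← mul_assoc, ← hcN]
    simp only [mul_assoc, hN, mul_zero]
    abel
  refine unipotent_part_mem (w := cEnd a) (Z := cEnd a * (1 - N)) p ?_ ?_ ?_ hcomm
    (one_add_pow_char (F := F) p hN)
    (separable_palindromic (b := -a) (d := a ^ 2 - 2) ?_ ?_ ?_) ?_
  · exact mul_mem (mul_mem (mul_mem hX hY) hX) (mul_mem hY hY)
  · exact IsUnit.of_mul_eq_one _ (cEnd_mul_cInv a)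
  · simp only [mul_add, mul_sub, add_mul, sub_mul, mul_one, one_mul, mul_assoc, hN, mul_zero]
    abel
  · convert mul_ne_zero ha0 ha2' using 1; ring
  · convert mul_ne_zero ha0 ha2 using 1; ring
  · have h : (-a) ^ 2 - 4 * (a ^ 2 - 2 - 2) = 16 - 3 * a ^ 2 := by ring
    rwa [h]
  · rw [aeval_palindromic]; convert hpal using 2

end Unipotent

section OppositePlanes

open Polynomial

variable {F : Type*} [Field F]

theorem separable_cubic {τ : F} (h1 : τ - 2 ≠ 0) (h2 : τ + 2 ≠ 0) :
    ((X - 1) * (X ^ 2 - C τ * X + 1) : F[X]).Separable := by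
  have hC : ∀ c : F, c ≠ 0 → C c⁻¹ * C c = (1 : F[X]) := fun c hc => by
    rw [← C_mul, inv_mul_cancel₀ hc, C_1]
  have k1 := hC _ h1
  have k2 := hC _ h2
  simp only [C_add, C_sub, C_ofNat] at k1 k2
  refine Separable.mul (by simpa using separable_X_sub_C (x := (1 : F))) ?_ ?_
  · refine ⟨-4 * C (τ - 2)⁻¹ * C (τ + 2)⁻¹, C (τ - 2)⁻¹ * C (τ + 2)⁻¹ * (2 * X - C τ), ?_⟩
    simp only [derivative_add, derivative_sub, derivative_mul, derivative_X_pow, derivative_C,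
      derivative_X, derivative_one]
    push_cast
    simp only [C_ofNat]
    linear_combination (C (τ + 2)⁻¹ * (C τ + 2)) * k1 + k2
  · refine ⟨C (τ - 2)⁻¹ * (X + 1 - C τ), -C (τ - 2)⁻¹, ?_⟩
    linear_combination k1

theorem aeval_cubic {A : Type*} [Ring A] [Algebra F A] (τ : F) (Z : A) :
    aeval Z ((X - 1) * (X ^ 2 - C τ * X + 1) : F[X]) = (Z - 1) * (Z ^ 2 - τ • Z + 1) := by
  simp [Algebra.smul_def]

theorem opposite_cubic {A : Type*} [Ring A] [Algebra F A] {s s' : A} {Δ : F} (hs : s * s = 0)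
    (hs' : s' * s' = 0) (h : s * s' * s = Δ • s) (h' : s' * s * s' = Δ • s') :
    ((1 + s) * (1 + s') - 1) *
      (((1 + s) * (1 + s')) ^ 2 - (2 + Δ) • ((1 + s) * (1 + s')) + 1) = 0 := by
  have k : (1 + s) * (1 + s') - 1 = s + s' + s * s' := by noncomm_ring
  have i1 : (1 - s') * (1 - s) * ((1 + s) * (1 + s')) = 1 := by
    have e1 : (1 - s) * (1 + s) = 1 := by simp [sub_mul, mul_add, hs]
    have e2 : (1 - s') * (1 + s') = 1 := by simp [sub_mul, mul_add, hs']
    calc _ = (1 - s') * ((1 - s) * (1 + s)) * (1 + s') := by simp only [mul_assoc]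
      _ = 1 := by rw [e1, mul_one, e2]
  have i2 : (1 + s) * (1 + s') + (1 - s') * (1 - s) - (2 + Δ) • (1 : A) =
      s * s' + s' * s - Δ • (1 : A) := by
    rw [add_smul, two_smul]; noncomm_ring
  have i3 : ((1 + s) * (1 + s')) ^ 2 - (2 + Δ) • ((1 + s) * (1 + s')) + 1 =
      (s * s' + s' * s - Δ • (1 : A)) * ((1 + s) * (1 + s')) := by
    rw [← i2]
    generalize (1 + s) * (1 + s') = Z at i1
    rw [sub_mul, add_mul, i1, smul_mul_assoc, one_mul, sq]
    abel
  have i4 : (s + s' + s * s') * (s * s' + s' * s - Δ • (1 : A)) = 0 := by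
    have z1 : s * (s * s') = 0 := by rw [← mul_assoc, hs, zero_mul]
    have z2 : s' * (s' * s) = 0 := by rw [← mul_assoc, hs', zero_mul]
    have z3 : s * (s' * s) = Δ • s := by rw [← mul_assoc, h]
    have z4 : s' * (s * s') = Δ • s' := by rw [← mul_assoc, h']
    simp only [add_mul, mul_add, mul_sub, mul_smul_comm, mul_one, mul_assoc, z1, z2, z3, z4,
      mul_zero]
    module
  rw [k, i3, ← mul_assoc, i4, zero_mul]

variable [Finite F] {H : Submonoid (Module.End F (Fin 8 → F))}

/-- The central parts of two members of `H` whose other parts are opposite multiply to a member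
of `H`. -/
theorem opposite_mem (p : ℕ) [Fact p.Prime] [CharP F p] {s s' b : Module.End F (Fin 8 → F)}
    {Δ t t' : F} (hs : s * s = 0) (hs' : s' * s' = 0) (h : s * s' * s = Δ • s)
    (h' : s' * s * s' = Δ • s') (hb : b * b = 0) (hsb : s * b = 0) (hbs : b * s = 0)
    (hsb' : s' * b = 0) (hbs' : b * s' = 0) (hΔ : Δ ≠ 0) (hΔ4 : Δ + 4 ≠ 0)
    (hu : 1 + (s + t • b) ∈ H) (hu' : 1 + (s' + t' • b) ∈ H) : 1 + (t + t') • b ∈ H := by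
  have hcb : Commute ((1 + s) * (1 + s')) (1 + (t + t') • b) := by
    have e1 : Commute (1 + s) (1 + (t + t') • b) := by
      show _ * _ = _ * _
      simp only [add_mul, mul_add, one_mul, mul_one, mul_smul_comm, smul_mul_assoc, hsb, hbs,
        smul_zero]
      module
    have e2 : Commute (1 + s') (1 + (t + t') • b) := by
      show _ * _ = _ * _
      simp only [add_mul, mul_add, one_mul, mul_one, mul_smul_comm, smul_mul_assoc, hsb', hbs',
        smul_zero]
      module
    exact e1.mul_left e2
  have hsq : ((t + t') • b) * ((t + t') • b) = 0 := by
    rw [smul_mul_smul_comm, hb, smul_zero]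
  have hw : (1 + (s + t • b)) * (1 + (s' + t' • b)) = (1 + s) * (1 + s') * (1 + (t + t') • b) := by
    simp only [add_mul, mul_add, one_mul, mul_one, mul_smul_comm, smul_mul_assoc, hsb, hbs, hsb',
      hbs', hb, smul_zero, mul_assoc, mul_zero]
    module
  have hun : IsUnit ((1 + (s + t • b)) * (1 + (s' + t' • b))) := by
    have e1 : (1 + (s + t • b)) * (1 - (s + t • b)) = 1 := by
      simp only [add_mul, mul_add, mul_sub, one_mul, mul_one, mul_smul_comm, smul_mul_assoc, hsb,
        hbs, hb, hs, smul_zero]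
      module
    have e2 : (1 + (s' + t' • b)) * (1 - (s' + t' • b)) = 1 := by
      simp only [add_mul, mul_add, mul_sub, one_mul, mul_one, mul_smul_comm, smul_mul_assoc, hsb',
        hbs', hb, hs', smul_zero]
      module
    exact (IsUnit.of_mul_eq_one _ e1).mul (IsUnit.of_mul_eq_one _ e2)
  refine unipotent_part_mem p (mul_mem hu hu') hun hw hcb (one_add_pow_char (F := F) p hsq)
    (separable_cubic (τ := 2 + Δ) (by simpa using hΔ) ?_) ?_
  · convert hΔ4 using 1; ring
  · rw [aeval_cubic]
    exact opposite_cubic hs hs' h h'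

/-- If moreover the characteristic is at least five, some nontrivial central element is in `H`. -/
theorem exists_opposite_mem (p : ℕ) [Fact p.Prime] [CharP F p] {s s' b : Module.End F (Fin 8 → F)}
    {Δ t t' : F} (h2 : (2 : F) ≠ 0) (h3 : (3 : F) ≠ 0) (hs : s * s = 0) (hs' : s' * s' = 0)
    (h : s * s' * s = Δ • s) (h' : s' * s * s' = Δ • s') (hb : b * b = 0) (hsb : s * b = 0)
    (hbs : b * s = 0) (hsb' : s' * b = 0) (hbs' : b * s' = 0) (hΔ : Δ ≠ 0) (ht' : t' ≠ 0)
    (hu : 1 + (s + t • b) ∈ H) (hu' : 1 + (s' + t' • b) ∈ H) : ∃ r : F, r ≠ 0 ∧ 1 + r • b ∈ H := by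
  have key : ∀ j : F, j ≠ 0 → 1 + (j • s' + (j * t') • b) ∈ H → t + j * t' ≠ 0 → j * Δ + 4 ≠ 0 →
      ∃ r : F, r ≠ 0 ∧ 1 + r • b ∈ H := by
    intro j hj hu'' hr hΔ4
    refine ⟨_, hr, opposite_mem (s := s) (s' := j • s') (Δ := j * Δ) p hs ?_ ?_ ?_ hb hsb hbs ?_ ?_
      (mul_ne_zero hj hΔ) hΔ4 hu hu''⟩
    · rw [smul_mul_smul_comm, hs', smul_zero]
    · rw [mul_smul_comm, smul_mul_assoc, h, smul_smul]
    · rw [smul_mul_assoc, smul_mul_smul_comm, h', smul_smul, smul_smul]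
      congr 1; ring
    · rw [smul_mul_assoc, hsb', smul_zero]
    · rw [mul_smul_comm, hbs', smul_zero]
  have sq0 : (s' + t' • b) * (s' + t' • b) = 0 := by
    simp [add_mul, mul_add, hsb', hbs', hb, hs']
  have m1 : 1 + ((1 : F) • s' + (1 * t') • b) ∈ H := by simpa using hu'
  have m2 : 1 + ((-1 : F) • s' + (-1 * t') • b) ∈ H := by
    have e : (1 + (s' + t' • b)) * (1 - (s' + t' • b)) = 1 := by
      rw [mul_sub, mul_one, add_mul, one_mul, sq0]; abel
    convert inverse_mem hu' e using 1
    module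
  have m3 : 1 + ((2 : F) • s' + (2 * t') • b) ∈ H := by
    convert H.mul_mem hu' hu' using 1
    rw [add_mul, mul_add (s' + t' • b), mul_one, one_mul, sq0]
    module
  by_contra hcon
  have c1 := fun hr hd => hcon (key 1 one_ne_zero m1 hr hd)
  have c2 := fun hr hd => hcon (key (-1) (neg_ne_zero.mpr one_ne_zero) m2 hr hd)
  have c3 := fun hr hd => hcon (key 2 h2 m3 hr hd)
  have d1 : t + 1 * t' = 0 ∨ 1 * Δ + 4 = 0 := by by_contra! hh; exact c1 hh.1 hh.2
  have d2 : t + -1 * t' = 0 ∨ -1 * Δ + 4 = 0 := by by_contra! hh; exact c2 hh.1 hh.2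
  have d3 : t + 2 * t' = 0 ∨ 2 * Δ + 4 = 0 := by by_contra! hh; exact c3 hh.1 hh.2
  have hΔ2 : (2 : F) * Δ ≠ 0 := mul_ne_zero h2 hΔ
  have hΔ3 : (3 : F) * Δ ≠ 0 := mul_ne_zero h3 hΔ
  have ht2 : (2 : F) * t' ≠ 0 := mul_ne_zero h2 ht'
  have ht3 : (3 : F) * t' ≠ 0 := mul_ne_zero h3 ht'
  rcases d1 with d1 | d1 <;> rcases d2 with d2 | d2 <;> rcases d3 with d3 | d3
  · exact ht2 (by linear_combination d1 - d2)
  · exact ht2 (by linear_combination d1 - d2)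
  · exact ht' (by linear_combination d3 - d1)
  · exact hΔ3 (by linear_combination d3 - d2)
  · exact ht3 (by linear_combination d3 - d2)
  · exact hΔ (by linear_combination d3 - d1)
  · exact hΔ2 (by linear_combination d1 - d2)
  · exact hΔ (by linear_combination d3 - d1)

end OppositePlanes

section Frame

variable {F : Type*} [Field F]

theorem wedge_opposite {p q : Fin 8 → F} (p' q' : Fin 8 → F) (hpq : polarForm p q = 0) :
    wedge p q * wedge p' q' * wedge p q =
      (polarForm p q' * polarForm q p' - polarForm p p' * polarForm q q') • wedge p q := by
  refine LinearMap.ext fun z => ?_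
  have hqp : polarForm q p = 0 := by rw [polarForm_comm, hpq]
  simp [Module.End.mul_apply, wedge_apply, hpq, hqp, polarForm_comm p' p,
    polarForm_comm p' q, polarForm_comm q' p, polarForm_comm q' q]
  module

/-- Two opposite totally isotropic planes `⟨p, q⟩`, `⟨p', q'⟩` and a totally isotropic plane
`⟨v, w⟩` orthogonal to both. -/
structure OppositeFrame (p q p' q' v w : Fin 8 → F) : Prop where
  pp : polarForm p p = 0
  pq : polarForm p q = 0
  qq : polarForm q q = 0
  pp' : polarForm p' p' = 0
  pq' : polarForm p' q' = 0
  qq' : polarForm q' q' = 0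
  cross_pp : polarForm p p' = 0
  cross_pq : polarForm p q' = 1
  cross_qp : polarForm q p' = 1
  cross_qq : polarForm q q' = 0
  vp : polarForm v p = 0
  vq : polarForm v q = 0
  vp' : polarForm v p' = 0
  vq' : polarForm v q' = 0
  wp : polarForm w p = 0
  wq : polarForm w q = 0
  wp' : polarForm w p' = 0
  wq' : polarForm w q' = 0
  vv : polarForm v v = 0
  vw : polarForm v w = 0
  ww : polarForm w w = 0

variable {p q p' q' v w : Fin 8 → F}

theorem OppositeFrame.symm (h : OppositeFrame p q p' q' v w) : OppositeFrame p' q' p q v w :=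
  ⟨h.pp', h.pq', h.qq', h.pp, h.pq, h.qq, by rw [polarForm_comm, h.cross_pp],
    by rw [polarForm_comm, h.cross_qp], by rw [polarForm_comm, h.cross_pq],
    by rw [polarForm_comm, h.cross_qq], h.vp', h.vq', h.vp, h.vq, h.wp', h.wq', h.wp, h.wq, h.vv,
    h.vw, h.ww⟩

theorem OppositeFrame.products (h : OppositeFrame p q p' q' v w) (A A' : F) :
    (A • wedge p q) * (A • wedge p q) = 0 ∧
    (A • wedge p q) * (A' • wedge p' q') * (A • wedge p q) = (A * A') • A • wedge p q ∧
    wedge v w * wedge v w = 0 ∧ (A • wedge p q) * wedge v w = 0 ∧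
    wedge v w * (A • wedge p q) = 0 := by
  refine ⟨?_, ?_, ?_, ?_, ?_⟩
  · rw [smul_mul_smul_comm, wedge_mul_wedge h.pp h.pq (by rw [polarForm_comm, h.pq]) h.qq,
      smul_zero]
  · rw [smul_mul_smul_comm, smul_mul_smul_comm, wedge_opposite _ _ h.pq, h.cross_pp,
      h.cross_pq, h.cross_qp, smul_smul, smul_smul]
    congr 1; ring
  · exact wedge_mul_wedge h.vv h.vw (by rw [polarForm_comm, h.vw]) h.ww
  · rw [smul_mul_assoc, wedge_mul_wedge (by rw [polarForm_comm, h.vp])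
      (by rw [polarForm_comm, h.wp]) (by rw [polarForm_comm, h.vq]) (by rw [polarForm_comm, h.wq]),
      smul_zero]
  · rw [mul_smul_comm, wedge_mul_wedge h.vp h.vq h.wp h.wq, smul_zero]

variable [Finite F] {H : Submonoid (Module.End F (Fin 8 → F))}

theorem OppositeFrame.mem (h : OppositeFrame p q p' q' v w) (r : ℕ) [Fact r.Prime] [CharP F r]
    {A A' t t' : F} (hA : A * A' ≠ 0) (hA4 : A * A' + 4 ≠ 0)
    (hu : 1 + (A • wedge p q + t • wedge v w) ∈ H)
    (hu' : 1 + (A' • wedge p' q' + t' • wedge v w) ∈ H) : 1 + (t + t') • wedge v w ∈ H := by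
  obtain ⟨k1, k2, k3, k4, k5⟩ := h.products A A'
  obtain ⟨l1, l2, -, l4, l5⟩ := h.symm.products A' A
  rw [mul_comm A' A] at l2
  exact opposite_mem r k1 l1 k2 l2 k3 k4 k5 l4 l5 hA hA4 hu hu'

theorem OppositeFrame.exists_mem (h : OppositeFrame p q p' q' v w) (r : ℕ) [Fact r.Prime]
    [CharP F r] {A A' t t' : F} (h2 : (2 : F) ≠ 0) (h3 : (3 : F) ≠ 0) (hA : A * A' ≠ 0)
    (ht' : t' ≠ 0) (hu : 1 + (A • wedge p q + t • wedge v w) ∈ H)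
    (hu' : 1 + (A' • wedge p' q' + t' • wedge v w) ∈ H) :
    ∃ c : F, c ≠ 0 ∧ 1 + c • wedge v w ∈ H := by
  obtain ⟨k1, k2, k3, k4, k5⟩ := h.products A A'
  obtain ⟨l1, l2, -, l4, l5⟩ := h.symm.products A' A
  rw [mul_comm A' A] at l2
  exact exists_opposite_mem r h2 h3 k1 l1 k2 l2 k3 k4 k5 l4 l5 hA ht' hu hu'

/-- The inverse of an element as in `OppositeFrame.mem`. -/
theorem OppositeFrame.neg_mem (h : OppositeFrame p q p' q' v w) {A t : F}
    (hu : 1 + (A • wedge p q + t • wedge v w) ∈ H) :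
    1 + ((-A) • wedge p q + (-t) • wedge v w) ∈ H := by
  obtain ⟨k1, -, k3, k4, k5⟩ := h.products A 1
  have k : (A • wedge p q + t • wedge v w) * (A • wedge p q + t • wedge v w) = 0 := by
    rw [add_mul, mul_add, mul_add, k1, mul_smul_comm, k4, smul_mul_assoc t, k5,
        smul_mul_smul_comm t,
      k3]
    simp
  convert inverse_mem hu (g' := 1 - (A • wedge p q + t • wedge v w)) ?_ using 1
  · module
  · rw [mul_sub, mul_one, add_mul, one_mul, k]
    abel

/-- The central commutator obtained when one of the two elements has no component in its plane. -/
theorem OppositeFrame.mem_of_commutator (h : OppositeFrame p q p' q' v w) {A t t' α β γ ε : F}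
    (hu : 1 + (wedge p (α • v + β • w) + wedge q (γ • v + ε • w) + t • wedge v w) ∈ H)
    (hu' : 1 + (A • wedge p' q' + t' • wedge v w) ∈ H) :
    1 + (2 * A * (α * ε - β * γ)) • wedge v w ∈ H := by
  set N := wedge p (α • v + β • w) + wedge q (γ • v + ε • w) + t • wedge v w with hN
  set N' := A • wedge p' q' + t' • wedge v w with hN'
  set M := -wedge p' (α • v + β • w) + wedge q' (γ • v + ε • w) with hM
  have flip : ∀ a b : Fin 8 → F, polarForm a b = 0 → polarForm b a = 0 := fun a b hab => by
    rw [polarForm_comm, hab]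
  have flip1 : ∀ a b : Fin 8 → F, polarForm a b = 1 → polarForm b a = 1 := fun a b hab => by
    rw [polarForm_comm, hab]
  have g1 := h.pp; have g2 := h.pq; have g3 := h.qq; have g4 := h.pp'; have g5 := h.pq'
  have g6 := h.qq'; have g7 := h.cross_pp; have g8 := h.cross_pq; have g9 := h.cross_qp
  have g10 := h.cross_qq; have g11 := h.vp; have g12 := h.vq; have g13 := h.vp'
  have g14 := h.vq'; have g15 := h.wp; have g16 := h.wq; have g17 := h.wp'; have g18 := h.wq'
  have g19 := h.vv; have g20 := h.vw; have g21 := h.ww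
  have f2 := flip _ _ g2; have f5 := flip _ _ g5; have f7 := flip _ _ g7
  have f8 := flip1 _ _ g8; have f9 := flip1 _ _ g9; have f10 := flip _ _ g10
  have f11 := flip _ _ g11; have f12 := flip _ _ g12; have f13 := flip _ _ g13
  have f14 := flip _ _ g14; have f15 := flip _ _ g15; have f16 := flip _ _ g16
  have f17 := flip _ _ g17; have f18 := flip _ _ g18; have f20 := flip _ _ g20
  have hN'2 : N' * N' = 0 := by
    refine LinearMap.ext fun z => ?_
    simp [hN', Module.End.mul_apply, wedge_apply, g4, g5, g6, f5, g13, g14, g17, g18, f13, f14,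
      f17, f18, g19, g20, g21, f20]
  have hconj : (1 + N') * (1 + N) * (1 - N') = 1 + (N + A • M) := by
    have e : (1 + N') * (1 - N') = 1 := by rw [mul_sub, mul_one, add_mul, one_mul, hN'2]; abel
    have e' : (1 + N') * N * (1 - N') = N + A • M := by
      refine LinearMap.ext fun z => ?_
      simp [hN', hN, hM, Module.End.mul_apply, wedge_apply, g1, g2, g3, g4, g5, g6, g7, g8, g9, g10,
        g11, g12, g13, g14, g15, g16, g17, g18, g19, g20, g21, f2, f5, f7, f8, f9, f10, f11, f12,
        f13, f14, f15, f16, f17, f18, f20]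
      module
    rw [mul_add (1 + N'), mul_one, add_mul, e, e']
  have hv : 1 + (N + A • M) ∈ H := by
    rw [← hconj]
    refine H.mul_mem (H.mul_mem hu' hu) (inverse_mem hu' ?_)
    rw [mul_sub, mul_one, add_mul, one_mul, hN'2]; abel
  have hNN : N * N = 0 := by
    refine LinearMap.ext fun z => ?_
    simp [hN, Module.End.mul_apply, wedge_apply, g1, g2, g3,
        g11, g12, g15, g16, g19, g20, g21, f2, f11, f12, f15, f16, f20]
  have hMM : M * M = 0 := by
    refine LinearMap.ext fun z => ?_
    simp [hM, Module.End.mul_apply, wedge_apply, g4, g5, g6,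
        g13, g14, g17, g18, g19, g20, g21, f5, f13, f14, f17, f18, f20]
  have hNM : N * M = (α * ε - β * γ) • wedge v w := by
    refine LinearMap.ext fun z => ?_
    simp [hN, hM, Module.End.mul_apply, wedge_apply, g1, g2, g3, g4, g5, g6, g7, g8, g9, g10,
        g11, g12, g13, g14, g15, g16, g17, g18, g19, g20, g21, f2, f5, f7, f8, f9, f10, f11, f12,
        f13, f14, f15, f16, f17, f18, f20]
    module
  have hMN : M * N = (-(α * ε - β * γ)) • wedge v w := by
    refine LinearMap.ext fun z => ?_
    simp [hN, hM, Module.End.mul_apply, wedge_apply, g1, g2, g3, g4, g5, g6, g7, g8, g9, g10,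
        g11, g12, g13, g14, g15, g16, g17, g18, g19, g20, g21, f2, f5, f7, f8, f9, f10, f11, f12,
        f13, f14, f15, f16, f17, f18, f20]
    module
  have hbN : wedge v w * N = 0 := by
    refine LinearMap.ext fun z => ?_
    simp [hN, Module.End.mul_apply, wedge_apply,
        g11, g12, g15, g16, g19, g20, g21, f11, f12, f15, f16, f20]
  have hbM : wedge v w * M = 0 := by
    refine LinearMap.ext fun z => ?_
    simp [hM, Module.End.mul_apply, wedge_apply,
        g13, g14, g17, g18, g19, g20, g21, f13, f14, f17, f18, f20]
  clear_value N N' M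
  have key := commutator_mem (A := N) (B := N + A • M) hNN ?_ ?_ ?_ hu hv
  · convert key using 2
    rw [mul_add, add_mul, hNN, mul_smul_comm, smul_mul_assoc, hNM, hMN]
    module
  · simp [add_mul, mul_add, hNN, hMM, hNM, hMN]
    module
  · rw [mul_add, hNN, zero_add, mul_smul_comm, hNM, smul_mul_assoc, smul_mul_assoc, hbN, smul_zero,
      smul_zero]
  · rw [add_mul, hNN, zero_add, smul_mul_assoc, hMN, mul_add]
    simp only [smul_neg, neg_mul, smul_mul_assoc, mul_smul_comm, hbN, hbM, smul_zero, neg_zero,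
        add_zero]

end Frame

section MainCase

variable {F : Type*} [Field F]

/-- The eighth basis vector. -/
def e8 : Fin 8 → F := ![0, 0, 0, 0, 0, 0, 0, 1]

theorem yEnd_yEnd_e2 : yEnd (yEnd (e2 : Fin 8 → F)) = e8 := by
  simp [yEnd_apply, e2, e8]

theorem oppositeFrame_e2_e8 (α β γ ε α' β' γ' ε' : F) :
    OppositeFrame (F := F) (e2 + (α • e1 + β • mv 0)) (mv 1 + (γ • e1 + ε • mv 0))
      (e8 + (α' • e1 + β' • mv 0)) (mv 2 + (γ' • e1 + ε' • mv 0)) e1 (mv 0) := by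
  have h2 : ∀ i : Fin 3, polarForm (e2 : Fin 8 → F) (mv i) = if i = 2 then 1 else 0 := fun i => by
    fin_cases i <;> simp [polarForm, e2, mv]
  have h2' : ∀ i : Fin 3, polarForm (mv i : Fin 8 → F) e2 = if i = 2 then 1 else 0 := fun i => by
    rw [polarForm_comm, h2]
  have h8 : ∀ i : Fin 3, polarForm (e8 : Fin 8 → F) (mv i) = if i = 1 then 1 else 0 := fun i => by
    fin_cases i <;> simp [polarForm, e8, mv]
  have h8' : ∀ i : Fin 3, polarForm (mv i : Fin 8 → F) e8 = if i = 1 then 1 else 0 := fun i => by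
    rw [polarForm_comm, h8]
  have k1 : polarForm (e1 : Fin 8 → F) e2 = 0 := by simp [polarForm, e1, e2]
  have k2 : polarForm (e1 : Fin 8 → F) e8 = 0 := by simp [polarForm, e1, e8]
  have k3 : polarForm (e2 : Fin 8 → F) e8 = 0 := by simp [polarForm, e2, e8]
  have k4 : polarForm (e2 : Fin 8 → F) e2 = 0 := by simp [polarForm, e2]
  have k5 : polarForm (e8 : Fin 8 → F) e8 = 0 := by simp [polarForm, e8]
  have k6 : polarForm (e2 : Fin 8 → F) e1 = 0 := by rw [polarForm_comm, k1]
  have k7 : polarForm (e8 : Fin 8 → F) e1 = 0 := by rw [polarForm_comm, k2]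
  constructor <;> simp [h2, h2', h8, h8', k1, k2, k3, k4, k5, k6, k7]

variable [Finite F] {H : Submonoid (Module.End F (Fin 8 → F))}

/-- A nontrivial root element for the plane `⟨e1, x e1⟩` outside two exceptional families. -/
theorem exists_root_mem_of_generic (p : ℕ) [Fact p.Prime] [CharP F p] {a : F} (h2 : (2 : F) ≠ 0)
    (ha0 : a ≠ 0) (ha2 : a + 2 ≠ 0) (ha2' : a - 2 ≠ 0) (hδ : 16 - 3 * a ^ 2 ≠ 0)
    (hη : a ^ 2 + a - 3 ≠ 0) (hX : xEnd a ∈ H) (hY : yEnd ∈ H) :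
    ∃ t : F, t ≠ 0 ∧ 1 + t • wedge e1 (mv 0) ∈ H := by
  have hu := one_add_omegaEnd_mem p ha0 ha2 ha2' hδ hX hY
  set κ : F := 2 / (16 - 3 * a ^ 2) with hκ
  have hκ0 : κ ≠ 0 := div_ne_zero h2 hδ
  set P : F := 2 * a ^ 2 + 3 * a - 4 with hP
  set R : F := a * (a + 2) with hR
  set G : F := 2 * a ^ 3 + 4 * a ^ 2 - 3 * a - 4 with hG
  set D : F := 3 * a ^ 2 + 5 * a - 4 with hD
  set D' : F := (a + 2) * (a ^ 2 + a - 4) with hD'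
  have hpf : P * D + R * D' - P * G = a * (16 - 3 * a ^ 2) * (a ^ 2 + a - 3) := by
    rw [hP, hR, hG, hD, hD']; ring
  have hpf0 : P * D + R * D' - P * G ≠ 0 := by
    rw [hpf]; exact mul_ne_zero (mul_ne_zero ha0 hδ) hη
  have hω : κ • omegaEnd a = κ • (-G • wedge e1 e2 - P • wedge e1 (mv 0) + R • wedge e1 (mv 1) +
      D' • wedge e2 (mv 0) + D • wedge e2 (mv 1) + P • wedge (mv 0) (mv 1)) := rfl
  have hu' : 1 + κ • (-G • wedge e1 e8 - P • wedge e1 (mv 2) + R • wedge e1 (mv 0) +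
      D' • wedge e8 (mv 2) + D • wedge e8 (mv 0) + P • wedge (mv 2) (mv 0)) ∈ H := by
    have hyy : (yEnd * yEnd) * yEnd = (1 : Module.End F (Fin 8 → F)) := by
      rw [mul_assoc, yEnd_mul_yEnd_mul_yEnd]
    have key := H.mul_mem (H.mul_mem (H.mul_mem hY hY) hu) hY
    rw [mul_add, mul_one, add_mul, hyy, hω] at key
    convert key using 2
    have hw : ∀ v w : Fin 8 → F, yEnd * yEnd * wedge v w * yEnd =
        wedge (yEnd (yEnd v)) (yEnd (yEnd w)) := fun v w =>
      wedge_conj (yEnd_preserves.mul yEnd_preserves) hyy v w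
    simp only [mul_smul_comm, smul_mul_assoc, mul_add, add_mul, mul_sub, sub_mul, hw, yEnd_e1,
      yEnd_mv, yEnd_yEnd_e2]
    rfl
  rw [hω] at hu
  clear_value P R G D D'
  have hflip : wedge (mv 0) e1 = -wedge (e1 : Fin 8 → F) (mv 0) := wedge_comm _ _
  by_cases hD0 : D = 0
  · have hD'0 : D' ≠ 0 := fun hD'0 => by
      rw [hD'] at hD'0
      have q1 := (mul_eq_zero.mp hD'0).resolve_left ha2
      rw [hD] at hD0
      have q2 : (2 : F) * 2 * 2 * 2 = 0 := by
        linear_combination 2 * q1 - (a - 3) * (hD0 - 3 * q1)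
      exact mul_ne_zero (mul_ne_zero (mul_ne_zero h2 h2) h2) h2 q2
    have fr := oppositeFrame_e2_e8 (0 : F) 0 0 0 (-(P / D')) (-(P / D')) (G / D') (D / D')
    have key := fr.mem_of_commutator (H := H) (A := κ * D') (t := -(κ * P))
      (t' := κ * (P * D + R * D' - P * G) / D')
      (α := κ * G) (β := κ * D') (γ := -(κ * R)) (ε := -(κ * P)) ?_ ?_
    · refine ⟨_, ?_, key⟩
      rw [hD0] at hpf0
      have e : 2 * (κ * D') * (κ * G * -(κ * P) - κ * D' * -(κ * R)) =
          2 * κ ^ 3 * D' * (P * 0 + R * D' - P * G) := by ring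
      rw [e]
      exact mul_ne_zero (mul_ne_zero (mul_ne_zero h2 (pow_ne_zero 3 hκ0)) hD'0) hpf0
    · convert hu using 2
      rw [hD0]
      simp only [wedge_add_left, wedge_add_right, wedge_smul_left, wedge_smul_right, wedge_self,
        hflip, wedge_comm e1 e2, wedge_comm e1 (mv 1), wedge_comm (mv 0) (mv 1)]
      module
    · convert hu' using 2
      simp only [wedge_add_left, wedge_add_right, wedge_smul_left, wedge_smul_right, wedge_self,
        hflip, wedge_comm e1 e8, wedge_comm e1 (mv 2), wedge_comm (mv 0) (mv 2)]
      match_scalars <;> field_simp <;> ring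
  · by_cases hD'0 : D' = 0
    · have fr := (oppositeFrame_e2_e8 (R / D) (P / D) (G / D) (D' / D) (0 : F) 0 0 0).symm
      have key := fr.mem_of_commutator (H := H) (A := κ * D)
        (t' := -(κ * (P * D + R * D' - P * G) / D)) (t := κ * R)
        (α := κ * G) (β := κ * D) (γ := κ * P) (ε := κ * P) ?_ ?_
      · refine ⟨_, ?_, key⟩
        rw [hD'0] at hpf0
        have e : 2 * (κ * D) * (κ * G * (κ * P) - κ * D * (κ * P)) =
            -(2 * κ ^ 3 * D * (P * D + R * 0 - P * G)) := by ring
        rw [e]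
        exact neg_ne_zero.mpr
          (mul_ne_zero (mul_ne_zero (mul_ne_zero h2 (pow_ne_zero 3 hκ0)) hD0) hpf0)
      · convert hu' using 2
        rw [hD'0]
        simp only [wedge_add_left, wedge_add_right, wedge_smul_left, wedge_smul_right, wedge_self,
          hflip, wedge_comm e1 e8, wedge_comm e1 (mv 2), wedge_comm (mv 0) (mv 2)]
        module
      · convert hu using 2
        simp only [wedge_add_left, wedge_add_right, wedge_smul_left, wedge_smul_right, wedge_self,
          hflip, wedge_comm e1 e2, wedge_comm e1 (mv 1), wedge_comm (mv 0) (mv 1)]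
        match_scalars <;> field_simp <;> ring
    · have fr := oppositeFrame_e2_e8 (R / D) (P / D) (G / D) (D' / D)
        (-(P / D')) (-(P / D')) (G / D') (D / D')
      have hN : 1 + ((κ * D) • wedge (e2 + ((R / D) • e1 + (P / D) • mv 0))
          (mv 1 + ((G / D) • e1 + (D' / D) • mv 0)) +
          (-(κ * (P * D + R * D' - P * G) / D)) • wedge e1 (mv 0)) ∈ H := by
        convert hu using 2
        simp only [wedge_add_left, wedge_add_right, wedge_smul_left, wedge_smul_right, wedge_self,
          hflip, wedge_comm e1 e2, wedge_comm e1 (mv 1), wedge_comm (mv 0) (mv 1)]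
        match_scalars <;> field_simp <;> ring
      have hN' : 1 + ((κ * D') • wedge (e8 + ((-(P / D')) • e1 + (-(P / D')) • mv 0))
          (mv 2 + ((G / D') • e1 + (D / D') • mv 0)) +
          (κ * (P * D + R * D' - P * G) / D') • wedge e1 (mv 0)) ∈ H := by
        convert hu' using 2
        simp only [wedge_add_left, wedge_add_right, wedge_smul_left, wedge_smul_right, wedge_self,
          hflip, wedge_comm e1 e8, wedge_comm e1 (mv 2), wedge_comm (mv 0) (mv 2)]
        match_scalars <;> field_simp <;> ring
      have hA : κ * D * (κ * D') ≠ 0 :=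
        mul_ne_zero (mul_ne_zero hκ0 hD0) (mul_ne_zero hκ0 hD'0)
      have ht : κ * (P * D + R * D' - P * G) ≠ 0 := mul_ne_zero hκ0 hpf0
      by_cases h3 : (3 : F) = 0
      · have hκ2 : κ = 2 := by
          rw [hκ, h3]
          have : (16 : F) - 0 * a ^ 2 = 1 := by linear_combination 5 * h3
          rw [this, div_one]
        by_contra hcon
        push Not at hcon
        have q1 : D' = D ∨ D * D' + 1 = 0 := by
          by_contra! hh
          refine hcon _ ?_ (fr.mem p hA ?_ hN hN')
          · have e : -(κ * (P * D + R * D' - P * G) / D) + κ * (P * D + R * D' - P * G) / D' =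
                κ * (P * D + R * D' - P * G) * (D - D') / (D * D') := by
              field_simp; ring
            rw [e]
            exact div_ne_zero (mul_ne_zero ht (sub_ne_zero.mpr hh.1.symm)) (mul_ne_zero hD0 hD'0)
          · have e : κ * D * (κ * D') + 4 = D * D' + 1 := by
              rw [hκ2]; linear_combination (D * D' + 1) * h3
            rw [e]; exact hh.2
        have q2 : D' = -D ∨ D * D' - 1 = 0 := by
          by_contra! hh
          refine hcon _ ?_ (fr.mem p ?_ ?_ hN (fr.symm.neg_mem hN'))
          · have e : -(κ * (P * D + R * D' - P * G) / D) + -(κ * (P * D + R * D' - P * G) / D') =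
                -(κ * (P * D + R * D' - P * G) * (D' - -D) / (D * D')) := by
              field_simp; ring
            rw [e]
            exact neg_ne_zero.mpr
              (div_ne_zero (mul_ne_zero ht (sub_ne_zero.mpr hh.1)) (mul_ne_zero hD0 hD'0))
          · rw [mul_neg]; exact neg_ne_zero.mpr hA
          · have e : κ * D * -(κ * D') + 4 = -(D * D' - 1) := by
              rw [hκ2]; linear_combination (-D * D' + 1) * h3
            rw [e]; exact neg_ne_zero.mpr hh.2
        have q3 : a * (a + 2) ≠ 0 := mul_ne_zero ha0 ha2
        have q4 : D ^ 2 - 1 = 0 → False := fun hh => q3 (by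
          rw [hD] at hh
          linear_combination hh - (3 * a ^ 4 + 10 * a ^ 3 - 14 * a + 5) * h3)
        rcases q1 with q1 | q1 <;> rcases q2 with q2 | q2
        · exact mul_ne_zero h2 hD0 (by linear_combination q2 - q1)
        · exact q4 (by rw [q1] at q2; linear_combination q2)
        · exact q4 (by rw [q2] at q1; linear_combination -q1)
        · exact h2 (by linear_combination q1 - q2)
      · exact fr.exists_mem p h2 h3 hA (div_ne_zero ht hD'0) hN hN'

end MainCase

/-- Removing a unipotent factor with two Jordan blocks of size three from the solution of a
polynomial equation, in a commutative algebra. -/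
theorem quintic_of_comm {F A : Type*} [Field F] [CommRing A] [Algebra F A] {b d h : F}
    {w w' K : A} (hh : 2 * h = 1) (hw : w * w' = 1) (hK : K * K * K = 0) (hwK : w * K = K + K * K)
    (hE : (w - 1) * ((w + w') * (w + w') + b • (w + w') + (d - 2) • 1) =
      (2 + 2 * b + d) • (K + h • (K * K))) :
    (w * (1 - K + h • (K * K)) - 1) * ((w * (1 - K + h • (K * K))) ^ 4 +
      b • (w * (1 - K + h • (K * K))) ^ 3 + d • (w * (1 - K + h • (K * K))) ^ 2 +
      b • (w * (1 - K + h • (K * K))) + 1) = 0 := by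
  have hh' : 2 * algebraMap F A h = 1 := by
    rw [← map_ofNat (algebraMap F A) 2, ← map_mul, hh, map_one]
  simp only [Algebra.smul_def, map_sub, map_add, map_mul, map_ofNat] at hE ⊢
  set β := algebraMap F A b
  set δ := algebraMap F A d
  set η := algebraMap F A h
  set Z := w * (1 - K + η * (K * K)) with hZ
  set Z' := w' * (1 + K + η * (K * K)) with hZ'
  have k0 : Z * Z' = 1 := by
    rw [hZ, hZ']
    linear_combination (1 + (2 * η - 1) * (K * K) + η ^ 2 * (K * K * K) * K) * hw +
      K * K * hh' + η ^ 2 * K * hK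
  have k1 : Z * K = K := by
    rw [hZ]; linear_combination (1 - K + η * K ^ 2) * hwK + (η * K + η - 1) * hK
  have k2 : Z' * K = K := by linear_combination K * k0 - Z' * k1
  have k3 : w = Z + K + η * (K * K) := by
    have : w = Z * (1 + K + η * (K * K)) := by
      rw [hZ]; linear_combination -w * K * K * hh' - w * η ^ 2 * K * hK
    linear_combination this + (1 + η * K) * k1
  have k4 : w' = Z' - K + η * (K * K) := by
    have : w' = Z' * (1 - K + η * (K * K)) := by
      rw [hZ']; linear_combination -w' * K * K * hh' - w' * η ^ 2 * K * hK
    linear_combination this + (η * K - 1) * k2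
  clear_value Z Z'
  have k5 : (Z - 1) * ((Z + Z') ^ 2 + β * (Z + Z') + δ - 2) = 0 := by
    have hT : w + w' = Z + Z' + K * K := by linear_combination k3 + k4 + K * K * hh'
    rw [hT] at hE
    rw [k3] at hE
    linear_combination hE - K * (2 * (Z + Z') + K * K + β) * k1 -
      (1 + η * K) * ((Z + Z') + 2 + β) * (k1 + k2) -
      (1 + η * K) * (2 * (Z + Z') + K * K + β) * hK
  linear_combination Z ^ 2 * k5 - (Z - 1) * (2 * Z ^ 2 + Z * Z' + 1 + β * Z) * k0

theorem quintic_of_commute {F A : Type*} [Field F] [Ring A] [Algebra F A] {b d h : F}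
    {w w' K : A} (hh : 2 * h = 1) (hw : w * w' = 1) (hw' : w' * w = 1) (hK : K * K * K = 0)
    (hc : w * K = K * w) (hwK : w * K = K + K * K)
    (hE : (w - 1) * ((w + w') * (w + w') + b • (w + w') + (d - 2) • 1) =
      (2 + 2 * b + d) • (K + h • (K * K))) :
    (w * (1 - K + h • (K * K)) - 1) * ((w * (1 - K + h • (K * K))) ^ 4 +
      b • (w * (1 - K + h • (K * K))) ^ 3 + d • (w * (1 - K + h • (K * K))) ^ 2 +
      b • (w * (1 - K + h • (K * K))) + 1) = 0 := by
  have hc' : w' * K = K * w' := by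
    calc w' * K = w' * K * (w * w') := by rw [hw, mul_one]
      _ = w' * (K * w) * w' := by simp only [mul_assoc]
      _ = (w' * w) * K * w' := by rw [← hc]; simp only [mul_assoc]
      _ = K * w' := by rw [hw', one_mul]
  have hcomm : ∀ x ∈ ({w, w', K} : Set A), ∀ y ∈ ({w, w', K} : Set A), x * y = y * x := by
    rintro x (rfl | rfl | rfl) y (rfl | rfl | rfl) <;> first | rfl | rw [hw, hw'] | assumption |
      (symm; assumption)
  letI := Algebra.adjoinCommRingOfComm F hcomm
  have := quintic_of_comm (F := F) (b := b) (d := d) (h := h)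
    (w := (⟨w, Algebra.subset_adjoin (by simp)⟩ : Algebra.adjoin F {w, w', K}))
    (w' := ⟨w', Algebra.subset_adjoin (by simp)⟩) (K := ⟨K, Algebra.subset_adjoin (by simp)⟩)
    hh (Subtype.ext hw) (Subtype.ext hK) (Subtype.ext hwK) (Subtype.ext hE)
  exact congrArg Subtype.val this

section Word

variable {F : Type*} [Field F]

/-- The word `x y x y x y⁻¹ x y⁻¹`. -/
def wEnd (a : F) : Module.End F (Fin 8 → F) :=
  xEnd a * yEnd * (xEnd a * yEnd) * (xEnd a * (yEnd * yEnd) * (xEnd a * (yEnd * yEnd)))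

/-- The word `y x y x y⁻¹ x y⁻¹ x`. -/
def wInv (a : F) : Module.End F (Fin 8 → F) :=
  yEnd * xEnd a * (yEnd * xEnd a) * (yEnd * yEnd * xEnd a * (yEnd * yEnd * xEnd a))

theorem xyxy_apply (a : F) (z : Fin 8 → F) :
    (xEnd a * yEnd * (xEnd a * yEnd) : Module.End F (Fin 8 → F)) z = ![-z 0 + a * z 1 +
        2 * a * z 2 + 2 * z 5 - z 6 + z 7,
      z 7,
      -(1 + a) * z 0 + (1 + a) * z 1 + (1 + 2 * a + a ^ 2) * z 2 + z 4 + (2 + a) * z 5 - z 6 +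
        a * z 7,
      z 0 - a * z 2 - z 5 - z 7,
      -(1 + a) * z 2 - z 5 - z 7,
      -z 1 - (1 - a) * z 2 + z 3 + z 5 + z 7,
      -z 0 + 2 * a * z 2 + 2 * z 5 + 2 * z 7,
      -(1 + a) * z 0 + (1 + a) * z 1 + (2 * a + 2 * a ^ 2) * z 2 + 2 * z 4 + (2 +
        2 * a) * z 5 - z 6 + 2 * a * z 7] := by
  simp only [Module.End.mul_apply, xEnd_apply, yEnd_apply]
  funext i
  fin_cases i <;> simp <;> ring

theorem xYxY_apply (a : F) (z : Fin 8 → F) :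
    (xEnd a * (yEnd * yEnd) * (xEnd a * (yEnd * yEnd)) : Module.End F (Fin 8 → F)) z = ![
        2 * z 5 + z 7,
      z 6,
      a * z 4 + (1 + a) * z 5 - z 6 + (1 + a) * z 7,
      -z 4 - z 5 - z 7,
      z 1 - z 3 - z 4 - (1 + a) * z 5 - (1 + a) * z 7,
      -z 0 - z 1 + z 2 + 2 * z 3 + z 4 + 2 * a * z 5 + z 6 + a * z 7,
      -z 0 - z 1 + 2 * z 3 + 2 * z 4 + (2 + 2 * a) * z 5 + z 6 + (2 + a) * z 7,
      -(1 + a) * z 0 - a * z 1 + 2 * a * z 3 + 2 * a * z 4 + (2 * a + 2 * a ^ 2) * z 5 - (1 -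
        a) * z 6 + (1 + 2 * a + a ^ 2) * z 7] := by
  simp only [Module.End.mul_apply, xEnd_apply, yEnd_apply]
  funext i
  fin_cases i <;> simp <;> ring

theorem yxyx_apply (a : F) (z : Fin 8 → F) :
    (yEnd * xEnd a * (yEnd * xEnd a) : Module.End F (Fin 8 → F)) z = ![-z 0 + z 1 + 2 * z 2 +
        2 * a * z 3 + a * z 6 - z 7,
      -(1 + a) * z 0 + 2 * a * z 1 + (2 + 2 * a) * z 2 + (2 * a + 2 * a ^ 2) * z 3 + 2 * z 4 +
        (1 + a) * z 6 - z 7,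
      z 1 + z 2 - (1 - a) * z 3 + z 5 - z 6,
      -(1 + a) * z 0 + a * z 1 + (2 + a) * z 2 + (1 + 2 * a + a ^ 2) * z 3 + z 4 + (1 +
        a) * z 6 - z 7,
      -z 1 - z 2 - (1 + a) * z 3,
      z 0 - z 1 - z 2 - a * z 3,
      z 1,
      -z 0 + 2 * z 1 + 2 * z 2 + 2 * a * z 3] := by
  simp only [Module.End.mul_apply, xEnd_apply, yEnd_apply]
  funext i
  fin_cases i <;> simp <;> ring

theorem YxYx_apply (a : F) (z : Fin 8 → F) :
    (yEnd * yEnd * xEnd a * (yEnd * yEnd * xEnd a) : Module.End F (Fin 8 → F)) z = ![2 * z 3 +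
        z 6,
      -z 0 + z 1 + 2 * z 2 + (2 + 2 * a) * z 3 + 2 * z 4 + (2 + a) * z 6 - z 7,
      -z 3 - z 4 - z 6,
      -z 0 + z 1 + 2 * z 2 + 2 * a * z 3 + z 4 + z 5 + a * z 6 - z 7,
      -z 2 - (1 + a) * z 3 - z 4 - (1 + a) * z 6 + z 7,
      -z 1 + (1 + a) * z 3 + a * z 4 + (1 + a) * z 6,
      -(1 + a) * z 0 - (1 - a) * z 1 + 2 * a * z 2 + (2 * a + 2 * a ^ 2) * z 3 + 2 * a * z 4 +
        (1 + 2 * a + a ^ 2) * z 6 - a * z 7,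
      z 1] := by
  simp only [Module.End.mul_apply, xEnd_apply, yEnd_apply]
  funext i
  fin_cases i <;> simp <;> ring

theorem wEnd_apply (a : F) (z : Fin 8 → F) :
    wEnd a z = ![-(2 + a) * z 0 - (1 + a) * z 1 + 2 * z 2 + (2 + 2 * a) * z 3 + (2 * a +
        2 * a ^ 2) * z 4 - (4 - 6 * a - 4 * a ^ 2) * z 5 - (2 - 5 * a - 3 * a ^ 2) * z 7,
      -(1 + a) * z 0 - a * z 1 + 2 * a * z 3 + 2 * a * z 4 + (2 * a + 2 * a ^ 2) * z 5 - (1 -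
        a) * z 6 + (1 + 2 * a + a ^ 2) * z 7,
      -(1 + 2 * a + a ^ 2) * z 0 - (a + a ^ 2) * z 1 + (2 + a) * z 2 + (1 + 2 * a +
        2 * a ^ 2) * z 3 - (1 - 2 * a - 4 * a ^ 2 - a ^ 3) * z 4 - (4 - 2 * a - 7 * a ^ 2 -
        3 * a ^ 3) * z 5 + (1 - a) * z 6 - (3 - 3 * a - 6 * a ^ 2 - 2 * a ^ 3) * z 7,
      (2 + a) * z 0 + (1 + a) * z 1 - z 2 - (2 + 2 * a) * z 3 - (1 + 2 * a + a ^ 2) * z 4 +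
        (2 - 5 * a - 3 * a ^ 2) * z 5 - (4 * a + 2 * a ^ 2) * z 7,
      (2 + a) * z 0 + (1 + a) * z 1 - z 2 - (2 + 2 * a) * z 3 - (1 + 3 * a + a ^ 2) * z 4 -
        (1 + 6 * a + 3 * a ^ 2) * z 5 + z 6 - (2 + 5 * a + 2 * a ^ 2) * z 7,
      -(2 + a) * z 0 - (1 + a) * z 1 + z 2 + (2 + 2 * a) * z 3 + (a + a ^ 2) * z 4 - (2 -
        4 * a - 3 * a ^ 2) * z 5 - (1 - 3 * a - 2 * a ^ 2) * z 7,
      -(4 + 2 * a) * z 0 - (2 + 2 * a) * z 1 + 2 * z 2 + (4 + 4 * a) * z 3 + (2 + 4 * a +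
        2 * a ^ 2) * z 4 - (2 - 10 * a - 6 * a ^ 2) * z 5 + (1 + 8 * a + 4 * a ^ 2) * z 7,
      -(1 + 4 * a + 2 * a ^ 2) * z 0 + (1 - 2 * a - 2 * a ^ 2) * z 1 + (2 + 2 * a) * z 2 +
        (4 * a + 4 * a ^ 2) * z 3 - (2 - 2 * a - 6 * a ^ 2 - 2 * a ^ 3) * z 4 - (6 -
        12 * a ^ 2 - 6 * a ^ 3) * z 5 + (2 - a) * z 6 - (5 - 2 * a - 10 * a ^ 2 -
        4 * a ^ 3) * z 7] := by
  rw [wEnd, Module.End.mul_apply, xYxY_apply, xyxy_apply]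
  funext i
  fin_cases i <;> simp <;> ring

theorem wInv_apply (a : F) (z : Fin 8 → F) :
    wInv a z = ![-(1 + 3 * a + a ^ 2) * z 0 + (a + a ^ 2) * z 1 + (2 + 4 * a +
        2 * a ^ 2) * z 2 - (2 - 2 * a - 6 * a ^ 2 - 2 * a ^ 3) * z 3 + (2 * a +
        2 * a ^ 2) * z 4 + 2 * a * z 5 - (1 - 2 * a - 4 * a ^ 2 - a ^ 3) * z 6 - (1 + 2 * a +
        a ^ 2) * z 7,
      -(1 + 6 * a + 3 * a ^ 2) * z 0 - (2 - 4 * a - 3 * a ^ 2) * z 1 - (2 - 10 * a -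
        6 * a ^ 2) * z 2 - (6 - 12 * a ^ 2 - 6 * a ^ 3) * z 3 - (4 - 6 * a - 4 * a ^ 2) * z 4 +
        (2 * a + 2 * a ^ 2) * z 5 - (4 - 2 * a - 7 * a ^ 2 - 3 * a ^ 3) * z 6 + (2 - 5 * a -
        3 * a ^ 2) * z 7,
      z 0 + (2 - a) * z 3 - (1 - a) * z 5 + (1 - a) * z 6,
      -(2 + 5 * a + 2 * a ^ 2) * z 0 - (1 - 3 * a - 2 * a ^ 2) * z 1 + (1 + 8 * a +
        4 * a ^ 2) * z 2 - (5 - 2 * a - 10 * a ^ 2 - 4 * a ^ 3) * z 3 - (2 - 5 * a -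
        3 * a ^ 2) * z 4 + (1 + 2 * a + a ^ 2) * z 5 - (3 - 3 * a - 6 * a ^ 2 -
        2 * a ^ 3) * z 6 - (4 * a + 2 * a ^ 2) * z 7,
      (2 + a) * z 0 - (2 + a) * z 1 - (4 + 2 * a) * z 2 - (1 + 4 * a + 2 * a ^ 2) * z 3 - (2 +
        a) * z 4 - (1 + a) * z 5 - (1 + 2 * a + a ^ 2) * z 6 + (2 + a) * z 7,
      (1 + a) * z 0 - (1 + a) * z 1 - (2 + 2 * a) * z 2 + (1 - 2 * a - 2 * a ^ 2) * z 3 - (1 +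
        a) * z 4 - a * z 5 - (a + a ^ 2) * z 6 + (1 + a) * z 7,
      -z 0 + z 1 + 2 * z 2 + (2 + 2 * a) * z 3 + 2 * z 4 + (2 + a) * z 6 - z 7,
      -(2 + 2 * a) * z 0 + (2 + 2 * a) * z 1 + (4 + 4 * a) * z 2 + (4 * a + 4 * a ^ 2) * z 3 +
        (2 + 2 * a) * z 4 + 2 * a * z 5 + (1 + 2 * a + 2 * a ^ 2) * z 6 - (2 + 2 * a) * z 7] := by
  rw [wInv, Module.End.mul_apply, YxYx_apply, yxyx_apply]
  funext i
  fin_cases i <;> simp <;> ring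

theorem xEnd_mul_cancel (a : F) (t : Module.End F (Fin 8 → F)) : xEnd a * (xEnd a * t) = t := by
  rw [← mul_assoc, xEnd_mul_xEnd, one_mul]

theorem yEnd_mul_cancel (t : Module.End F (Fin 8 → F)) : yEnd * (yEnd * (yEnd * t)) = t := by
  have h : yEnd * (yEnd * (yEnd * t)) = yEnd * (yEnd * yEnd) * t := by simp only [mul_assoc]
  rw [h, yEnd_mul_yEnd_mul_yEnd, one_mul]

theorem wEnd_mul_wInv (a : F) : wEnd a * wInv a = 1 := by
  simp only [wEnd, wInv, mul_assoc, xEnd_mul_cancel, yEnd_mul_cancel, xEnd_mul_xEnd,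
      yEnd_mul_yEnd_mul_yEnd]

theorem wInv_mul_wEnd (a : F) : wInv a * wEnd a = 1 := by
  simp only [wEnd, wInv, mul_assoc, xEnd_mul_cancel, yEnd_mul_cancel, xEnd_mul_xEnd,
      yEnd_mul_yEnd_mul_yEnd]

theorem wEnd_preserves (a : F) : Preserves (wEnd a) := by
  have hxy := (xEnd_preserves a).mul yEnd_preserves
  have hxyy := (xEnd_preserves a).mul (yEnd_preserves.mul yEnd_preserves)
  exact (hxy.mul hxy).mul (hxyy.mul hxyy)

/-- A singular vector fixed by `wEnd a`. -/
def vv : Fin 8 → F := ![1, -1, 1, 0, 0, 0, 0, 0]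

/-- A vector fixed by `wEnd a` modulo `vv`. -/
def nv (a : F) : Fin 8 → F :=
  ![0, 12 - 11 * a - 4 * a ^ 2 + 2 * a ^ 3, 3 + 3 * a - 4 * a ^ 2 - 2 * a ^ 3, 0,
    2 * a ^ 2 + 2 * a - 3, 4 * a ^ 2 + 2 * a - 6, 2 * a ^ 2 - 3, 9 - 4 * a - 6 * a ^ 2]

theorem QPlus_vv : QPlus F vv = 0 := by simp [QPlus, vv]

theorem QPlus_nv (a : F) :
    QPlus F (nv a) = (a - 1) * (81 - 68 * a ^ 2 - 16 * a ^ 3 + 4 * a ^ 4) := by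
  simp [QPlus, nv]; ring

theorem polarForm_nv_vv (a : F) : polarForm (nv a) vv = 0 := by
  simp [polarForm, nv, vv]; ring

theorem wEnd_vv (a : F) : wEnd a vv = vv := by
  rw [wEnd_apply]
  funext i
  fin_cases i <;> simp [vv] <;> ring

theorem wEnd_nv (a : F) :
    wEnd a (nv a) = nv a - (4 * a * (a + 2) * (a - 1)) • vv := by
  rw [wEnd_apply]
  funext i
  rw [Pi.sub_apply, Pi.smul_apply]
  fin_cases i <;> simp [vv, nv] <;> ring

end Word

section Word

variable {F : Type*} [Field F]

theorem wEnd_add_wInv_apply (a : F) (z : Fin 8 → F) :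
    (wEnd a + wInv a) z = ![-(3 + 4 * a + a ^ 2) * z 0 - (1 - a ^ 2) * z 1 + (4 + 4 * a +
        2 * a ^ 2) * z 2 + (4 * a + 6 * a ^ 2 + 2 * a ^ 3) * z 3 + (4 * a + 4 * a ^ 2) * z 4 -
        (4 - 8 * a - 4 * a ^ 2) * z 5 - (1 - 2 * a - 4 * a ^ 2 - a ^ 3) * z 6 - (3 - 3 * a -
        2 * a ^ 2) * z 7,
      -(2 + 7 * a + 3 * a ^ 2) * z 0 - (2 - 3 * a - 3 * a ^ 2) * z 1 - (2 - 10 * a -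
        6 * a ^ 2) * z 2 - (6 - 2 * a - 12 * a ^ 2 - 6 * a ^ 3) * z 3 - (4 - 8 * a -
        4 * a ^ 2) * z 4 + (4 * a + 4 * a ^ 2) * z 5 - (5 - 3 * a - 7 * a ^ 2 -
        3 * a ^ 3) * z 6 + (3 - 3 * a - 2 * a ^ 2) * z 7,
      -(2 * a + a ^ 2) * z 0 - (a + a ^ 2) * z 1 + (2 + a) * z 2 + (3 + a + 2 * a ^ 2) * z 3 -
        (1 - 2 * a - 4 * a ^ 2 - a ^ 3) * z 4 - (5 - 3 * a - 7 * a ^ 2 - 3 * a ^ 3) * z 5 +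
        (2 - 2 * a) * z 6 - (3 - 3 * a - 6 * a ^ 2 - 2 * a ^ 3) * z 7,
      -(4 * a + 2 * a ^ 2) * z 0 + (4 * a + 2 * a ^ 2) * z 1 + (8 * a + 4 * a ^ 2) * z 2 - (7 -
        10 * a ^ 2 - 4 * a ^ 3) * z 3 - (3 - 3 * a - 2 * a ^ 2) * z 4 + (3 - 3 * a -
        2 * a ^ 2) * z 5 - (3 - 3 * a - 6 * a ^ 2 - 2 * a ^ 3) * z 6 - (8 * a + 4 * a ^ 2) * z 7,
      (4 + 2 * a) * z 0 - z 1 - (5 + 2 * a) * z 2 - (3 + 6 * a + 2 * a ^ 2) * z 3 - (3 +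
        4 * a + a ^ 2) * z 4 - (2 + 7 * a + 3 * a ^ 2) * z 5 - (2 * a + a ^ 2) * z 6 - (4 * a +
        2 * a ^ 2) * z 7,
      -z 0 - (2 + 2 * a) * z 1 - (1 + 2 * a) * z 2 + (3 - 2 * a ^ 2) * z 3 - (1 -
        a ^ 2) * z 4 - (2 - 3 * a - 3 * a ^ 2) * z 5 - (a + a ^ 2) * z 6 + (4 * a +
        2 * a ^ 2) * z 7,
      -(5 + 2 * a) * z 0 - (1 + 2 * a) * z 1 + 4 * z 2 + (6 + 6 * a) * z 3 + (4 + 4 * a +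
        2 * a ^ 2) * z 4 - (2 - 10 * a - 6 * a ^ 2) * z 5 + (2 + a) * z 6 + (8 * a +
        4 * a ^ 2) * z 7,
      -(3 + 6 * a + 2 * a ^ 2) * z 0 + (3 - 2 * a ^ 2) * z 1 + (6 + 6 * a) * z 2 + (8 * a +
        8 * a ^ 2) * z 3 + (4 * a + 6 * a ^ 2 + 2 * a ^ 3) * z 4 - (6 - 2 * a - 12 * a ^ 2 -
        6 * a ^ 3) * z 5 + (3 + a + 2 * a ^ 2) * z 6 - (7 - 10 * a ^ 2 - 4 * a ^ 3) * z 7] := by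
  rw [LinearMap.add_apply, wEnd_apply, wInv_apply]
  funext i
  rw [Pi.add_apply]
  fin_cases i <;> simp <;> ring

set_option maxHeartbeats 2000000 in
theorem wEnd_quadratic_apply (a : F) (z : Fin 8 → F) :
    ((wEnd a + wInv a) * (wEnd a + wInv a) + (14 - 12 * a ^ 2 - 4 * a ^ 3) • (wEnd a + wInv a) +
      (51 - 44 * a ^ 2 - 8 * a ^ 3 + 4 * a ^ 4 - 2) • (1 : Module.End F (Fin 8 → F))) z =
      ![(36 - 24 * a - 49 * a ^ 2 - 10 * a ^ 3 + 2 * a ^ 4) * z 0 - (9 + 6 * a - 3 * a ^ 2 -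
        6 * a ^ 3 - 2 * a ^ 4) * z 1 + (36 + 18 * a - 16 * a ^ 2 + 4 * a ^ 4) * z 2 + (24 * a +
        28 * a ^ 2 - 4 * a ^ 4) * z 3 + (16 * a ^ 2 + 16 * a ^ 3 - 4 * a ^ 4 -
        4 * a ^ 5) * z 4 - (36 - 30 * a - 28 * a ^ 2 + 6 * a ^ 3 - 4 * a ^ 4 -
        4 * a ^ 5) * z 5 - (9 - 24 * a - 28 * a ^ 2 + 5 * a ^ 3 + 10 * a ^ 4 +
        2 * a ^ 5) * z 6 - (27 - 3 * a - 28 * a ^ 2 - 2 * a ^ 3 + 4 * a ^ 4) * z 7,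
      -(18 + 27 * a + 9 * a ^ 2 - 4 * a ^ 3 - 2 * a ^ 4) * z 0 + (45 - 3 * a - 37 * a ^ 2 -
        8 * a ^ 3 + 2 * a ^ 4) * z 1 - (18 - 24 * a - 40 * a ^ 2 - 4 * a ^ 3 +
        4 * a ^ 4) * z 2 - (54 - 36 * a - 64 * a ^ 2 - 8 * a ^ 3 + 4 * a ^ 4) * z 3 - (36 -
        30 * a - 28 * a ^ 2 + 6 * a ^ 3 - 4 * a ^ 4 - 4 * a ^ 5) * z 4 + (16 * a ^ 2 +
        16 * a ^ 3 - 4 * a ^ 4 - 4 * a ^ 5) * z 5 - (45 - 27 * a - 43 * a ^ 2 - a ^ 3 -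
        2 * a ^ 5) * z 6 + (27 - 3 * a - 28 * a ^ 2 - 2 * a ^ 3 + 4 * a ^ 4) * z 7,
      -(18 * a + 21 * a ^ 2 + 10 * a ^ 3 + 2 * a ^ 4) * z 0 + (9 * a - 3 * a ^ 2 - 8 * a ^ 3 -
        2 * a ^ 4) * z 1 + (81 + 27 * a - 50 * a ^ 2 - 14 * a ^ 3 + 4 * a ^ 4) * z 2 + (27 +
        3 * a + 6 * a ^ 2 + 14 * a ^ 3 + 4 * a ^ 4) * z 3 - (9 - 24 * a - 28 * a ^ 2 +
        5 * a ^ 3 + 10 * a ^ 4 + 2 * a ^ 5) * z 4 - (45 - 27 * a - 43 * a ^ 2 - a ^ 3 -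
        2 * a ^ 5) * z 5 + (18 - 6 * a + 12 * a ^ 3 + 4 * a ^ 4) * z 6 - (27 - 3 * a -
        28 * a ^ 2 - 2 * a ^ 3 + 4 * a ^ 4) * z 7,
      -(27 - 3 * a - 28 * a ^ 2 - 2 * a ^ 3 + 4 * a ^ 4) * z 4 + (27 - 3 * a - 28 * a ^ 2 -
        2 * a ^ 3 + 4 * a ^ 4) * z 5 - (27 - 3 * a - 28 * a ^ 2 - 2 * a ^ 3 + 4 * a ^ 4) * z 6,
      (36 + 42 * a + 12 * a ^ 2) * z 0 - (9 - 10 * a ^ 2 - 4 * a ^ 3) * z 1 - (45 + 42 * a +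
        2 * a ^ 2 - 4 * a ^ 3) * z 2 - (27 + 42 * a + 22 * a ^ 2 + 4 * a ^ 3) * z 3 + (36 -
        24 * a - 49 * a ^ 2 - 10 * a ^ 3 + 2 * a ^ 4) * z 4 - (18 + 27 * a + 9 * a ^ 2 -
        4 * a ^ 3 - 2 * a ^ 4) * z 5 - (18 * a + 21 * a ^ 2 + 10 * a ^ 3 + 2 * a ^ 4) * z 6,
      -(9 - 10 * a ^ 2 - 4 * a ^ 3) * z 0 - (18 + 6 * a - 16 * a ^ 2 - 8 * a ^ 3) * z 1 - (9 +
        6 * a - 6 * a ^ 2 - 4 * a ^ 3) * z 2 + (27 + 6 * a - 26 * a ^ 2 - 12 * a ^ 3) * z 3 -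
        (9 + 6 * a - 3 * a ^ 2 - 6 * a ^ 3 - 2 * a ^ 4) * z 4 + (45 - 3 * a - 37 * a ^ 2 -
        8 * a ^ 3 + 2 * a ^ 4) * z 5 + (9 * a - 3 * a ^ 2 - 8 * a ^ 3 - 2 * a ^ 4) * z 6,
      -(45 + 42 * a + 2 * a ^ 2 - 4 * a ^ 3) * z 0 - (9 + 6 * a - 6 * a ^ 2 -
        4 * a ^ 3) * z 1 + (36 + 36 * a + 8 * a ^ 2) * z 2 + (54 + 48 * a - 4 * a ^ 2 -
        8 * a ^ 3) * z 3 + (36 + 18 * a - 16 * a ^ 2 + 4 * a ^ 4) * z 4 - (18 - 24 * a -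
        40 * a ^ 2 - 4 * a ^ 3 + 4 * a ^ 4) * z 5 + (81 + 27 * a - 50 * a ^ 2 - 14 * a ^ 3 +
        4 * a ^ 4) * z 6,
      -(27 + 42 * a + 22 * a ^ 2 + 4 * a ^ 3) * z 0 + (27 + 6 * a - 26 * a ^ 2 -
        12 * a ^ 3) * z 1 + (54 + 48 * a - 4 * a ^ 2 - 8 * a ^ 3) * z 2 + (36 * a +
        48 * a ^ 2 + 16 * a ^ 3) * z 3 + (24 * a + 28 * a ^ 2 - 4 * a ^ 4) * z 4 - (54 -
        36 * a - 64 * a ^ 2 - 8 * a ^ 3 + 4 * a ^ 4) * z 5 + (27 + 3 * a + 6 * a ^ 2 +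
        14 * a ^ 3 + 4 * a ^ 4) * z 6] := by
  rw [LinearMap.add_apply, LinearMap.add_apply, Module.End.mul_apply, LinearMap.smul_apply,
    LinearMap.smul_apply, Module.End.one_apply]
  have hu := wEnd_add_wInv_apply a z
  generalize (wEnd a + wInv a) z = u at hu ⊢
  rw [wEnd_add_wInv_apply a u]
  have h0 := congrFun hu 0
  have h1 := congrFun hu 1
  have h2 := congrFun hu 2
  have h3 := congrFun hu 3
  have h4 := congrFun hu 4
  have h5 := congrFun hu 5
  have h6 := congrFun hu 6
  have h7 := congrFun hu 7
  simp only [Matrix.cons_val] at h0 h1 h2 h3 h4 h5 h6 h7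
  clear hu
  funext i
  simp only [Pi.add_apply, Pi.smul_apply, smul_eq_mul]
  fin_cases i <;> simp only [Fin.zero_eta, Fin.mk_one, Fin.reduceFinMk, Matrix.cons_val, h0, h1,
      h2, h3, h4, h5, h6, h7] <;> ring

set_option maxHeartbeats 2000000 in
/-- The rank one map `z ↦ B(z, vv) vv`. -/
def wedgeSq : Module.End F (Fin 8 → F) where
  toFun z := polarForm z vv • vv
  map_add' z w := by rw [polarForm_add_left, add_smul]
  map_smul' c z := by rw [polarForm_smul_left, mul_smul, RingHom.id_apply]

theorem wedgeSq_apply (z : Fin 8 → F) : wedgeSq z = polarForm z vv • vv := rfl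

theorem wEnd_quintic (a : F) :
    (wEnd a - 1) * ((wEnd a + wInv a) * (wEnd a + wInv a) +
      (14 - 12 * a ^ 2 - 4 * a ^ 3) • (wEnd a + wInv a) +
      (51 - 44 * a ^ 2 - 8 * a ^ 3 + 4 * a ^ 4 - 2) • (1 : Module.End F (Fin 8 → F))) =
      (2 * a * (a + 2)) • (wedge vv (nv a) - (2 * a * (a + 2) * (a - 1)) • wedgeSq) := by
  refine LinearMap.ext fun z => ?_
  rw [Module.End.mul_apply]
  have hu := wEnd_quadratic_apply a z
  generalize ((wEnd a + wInv a) * (wEnd a + wInv a) + _ +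
        _ : Module.End F (Fin 8 → F)) z = u at hu ⊢
  rw [LinearMap.sub_apply, Module.End.one_apply, wEnd_apply, LinearMap.smul_apply,
    LinearMap.sub_apply, LinearMap.smul_apply, wedge_apply, wedgeSq_apply]
  have h0 := congrFun hu 0
  have h1 := congrFun hu 1
  have h2 := congrFun hu 2
  have h3 := congrFun hu 3
  have h4 := congrFun hu 4
  have h5 := congrFun hu 5
  have h6 := congrFun hu 6
  have h7 := congrFun hu 7
  simp only [Matrix.cons_val] at h0 h1 h2 h3 h4 h5 h6 h7
  clear hu
  funext i
  simp only [Pi.sub_apply, Pi.smul_apply, smul_eq_mul, polarForm, vv, nv]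
  fin_cases i <;> simp only [Fin.zero_eta, Fin.mk_one, Fin.reduceFinMk, Matrix.cons_val, h0, h1,
      h2, h3, h4, h5, h6, h7] <;> ring

end Word

section Extract

open Polynomial

variable {F : Type*} [Field F]

theorem separable_quintic {b d : F} (h1 : 2 + 2 * b + d ≠ 0) (h2 : 2 - 2 * b + d ≠ 0)
    (h3 : b ^ 2 - 4 * (d - 2) ≠ 0) :
    ((X - 1) * (X ^ 4 + C b * X ^ 3 + C d * X ^ 2 + C b * X + 1) : F[X]).Separable := by
  refine Separable.mul (by simpa using separable_X_sub_C (x := (1 : F)))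
    (separable_palindromic h1 h2 h3) ?_
  refine ⟨-C (2 + 2 * b + d)⁻¹ *
      (X ^ 3 + (1 + C b) * X ^ 2 + (1 + C b + C d) * X + (1 + 2 * C b + C d)),
      C (2 + 2 * b + d)⁻¹, ?_⟩
  have : C (2 + 2 * b + d)⁻¹ * C (2 + 2 * b + d) = (1 : F[X]) := by
    rw [← C_mul, inv_mul_cancel₀ h1, C_1]
  simp only [C_add, C_mul, C_ofNat] at this ⊢
  linear_combination this

theorem aeval_quintic {A : Type*} [Ring A] [Algebra F A] (b d : F) (Z : A) :
    aeval Z ((X - 1) * (X ^ 4 + C b * X ^ 3 + C d * X ^ 2 + C b * X + 1) : F[X]) =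
      (Z - 1) * (Z ^ 4 + b • Z ^ 3 + d • Z ^ 2 + b • Z + 1) := by
  simp [Algebra.smul_def]

theorem aeval_quintic_of_commute {A : Type*} [Ring A] [Algebra F A] {b d h : F}
    {w w' K U : A} (hh : 2 * h = 1) (hw : w * w' = 1) (hw' : w' * w = 1) (hK : K * K * K = 0)
    (hc : w * K = K * w) (hwK : w * K = K + K * K)
    (hE : (w - 1) * ((w + w') * (w + w') + b • (w + w') + (d - 2) • 1) =
      (2 + 2 * b + d) • (K + h • (K * K))) (hU : U = 1 - K + h • (K * K)) :
    aeval (w * U) ((X - 1) * (X ^ 4 + C b * X ^ 3 + C d * X ^ 2 + C b * X + 1) : F[X]) = 0 := by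
  rw [aeval_quintic, hU]
  exact quintic_of_commute hh hw hw' hK hc hwK hE

theorem siegel_eq_one_add {v n : Fin 8 → F} (h2 : (2 : F) ≠ 0) (hv : QPlus F v = 0)
    (hn : polarForm n v = 0) :
    siegel v n = 1 + (wedge v n + (2 : F)⁻¹ • (wedge v n * wedge v n)) := by
  have hvv : polarForm v v = 0 := by rw [polarForm_self, hv, mul_zero]
  refine LinearMap.ext fun z => ?_
  have hvn : polarForm v n = 0 := by rw [polarForm_comm, hn]
  simp [siegel_apply, wedge_apply, Module.End.mul_apply, hn, hvn, hvv, polarForm_self]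
  match_scalars <;> field_simp
  ring

variable [Finite F] {H : Submonoid (Module.End F (Fin 8 → F))}

/-- The unipotent part of `wEnd a` at the eigenvalue `1`, provided that removing it leaves a map
annihilated by a separable polynomial. -/
theorem siegel_vv_mem_of_separable (p : ℕ) [Fact p.Prime] [CharP F p] {a : F} {r : F[X]}
    (h2 : (2 : F) ≠ 0) (hg : 81 - 68 * a ^ 2 - 16 * a ^ 3 + 4 * a ^ 4 ≠ 0) (hr : r.Separable)
    (hrZ : ∀ K : Module.End F (Fin 8 → F), K * K * K = 0 → wEnd a * K = K * wEnd a →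
      wEnd a * K = K + K * K →
      (81 - 68 * a ^ 2 - 16 * a ^ 3 + 4 * a ^ 4) • K = (2 * a * (a + 2)) • wedge vv (nv a) →
      (81 - 68 * a ^ 2 - 16 * a ^ 3 + 4 * a ^ 4) • (K * K) =
        (-(8 * a ^ 2 * (a + 2) ^ 2 * (a - 1))) • wedgeSq →
      aeval (wEnd a * (1 - K + (2 : F)⁻¹ • (K * K))) r = 0)
    (hX : xEnd a ∈ H) (hY : yEnd ∈ H) :
    siegel vv ((2 * a * (a + 2) / (81 - 68 * a ^ 2 - 16 * a ^ 3 + 4 * a ^ 4)) • nv a) ∈ H := by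
  set g : F := 81 - 68 * a ^ 2 - 16 * a ^ 3 + 4 * a ^ 4 with hgdef
  set n : Fin 8 → F := (2 * a * (a + 2) / g) • nv a with hn
  set K := wedge vv n with hK
  have hvv : polarForm (vv : Fin 8 → F) vv = 0 := by rw [polarForm_self, QPlus_vv, mul_zero]
  have hnv : polarForm n vv = 0 := by rw [hn, polarForm_smul_left, polarForm_nv_vv, mul_zero]
  have hvn : polarForm vv n = 0 := by rw [polarForm_comm, hnv]
  have hnn : polarForm n n = 8 * a ^ 2 * (a + 2) ^ 2 * (a - 1) / g := by
    rw [polarForm_self, hn, QPlus_smul, QPlus_nv, ← hgdef]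
    field_simp; ring
  have hKK : K * K = (-(8 * a ^ 2 * (a + 2) ^ 2 * (a - 1) / g)) • wedgeSq := by
    refine LinearMap.ext fun z => ?_
    simp [hK, Module.End.mul_apply, wedge_apply, wedgeSq_apply, hvv, hnv, hvn, hnn]
    module
  have hKKK : K * K * K = 0 := by
    refine LinearMap.ext fun z => ?_
    rw [hKK]
    simp [hK, Module.End.mul_apply, wedge_apply, wedgeSq_apply, hvv, hnv, hvn]
  have hwn : wEnd a n = n - (8 * a ^ 2 * (a + 2) ^ 2 * (a - 1) / g) • vv := by
    rw [hn, map_smul, wEnd_nv]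
    match_scalars <;> field_simp; ring
  have hwK : wEnd a * K = K + K * K := by
    refine LinearMap.ext fun z => ?_
    rw [hKK]
    simp only [hK, Module.End.mul_apply, wedge_apply, wedgeSq_apply, LinearMap.add_apply,
      LinearMap.smul_apply, map_sub, map_smul, hwn, wEnd_vv]
    module
  have hconj : wEnd a * K * wInv a = K := by
    have h0 (c : F) : wedge (vv : Fin 8 → F) (c • vv) = 0 := by
      rw [wedge_smul_right, wedge_self, smul_zero]
    rw [hK, wedge_conj (wEnd_preserves a) (wEnd_mul_wInv a), wEnd_vv, hwn, wedge_sub_right, h0,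
      sub_zero]
  have hcK : wEnd a * K = K * wEnd a := by
    have := congrArg (· * wEnd a) hconj
    simpa only [mul_assoc, wInv_mul_wEnd, mul_one] using this
  have hU : siegel vv n = 1 + (K + (2 : F)⁻¹ • (K * K)) := siegel_eq_one_add h2 QPlus_vv hnv
  have hU' : siegel vv (-n) = 1 - K + (2 : F)⁻¹ • (K * K) := by
    rw [siegel_eq_one_add h2 QPlus_vv (by simp [hnv]), wedge_neg_right, ← hK]
    have : (-K) * (-K) = K * K := LinearMap.ext fun z => by simp [Module.End.mul_apply]
    rw [this]
    abel
  have hUU : siegel vv (-n) * siegel vv n = 1 := by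
    have := siegel_mul_neg (QPlus_vv (F := F)) (n := -n) (by simp [hnv])
    rwa [neg_neg] at this
  have hUU' : siegel vv n * siegel vv (-n) = 1 := siegel_mul_neg (QPlus_vv (F := F)) hnv
  have hwU : wEnd a * siegel vv n = siegel vv n * wEnd a := by
    rw [hU]
    simp only [mul_add, add_mul, mul_one, one_mul, mul_smul_comm, smul_mul_assoc, ← hcK]
    rw [← mul_assoc, hcK, mul_assoc, hcK, mul_assoc]
  refine unipotent_part_mem (w := wEnd a) (Z := wEnd a * siegel vv (-n)) p ?_ ?_ ?_ ?_ ?_ hr ?_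
  · exact mul_mem (mul_mem (mul_mem hX hY) (mul_mem hX hY))
      (mul_mem (mul_mem hX (mul_mem hY hY)) (mul_mem hX (mul_mem hY hY)))
  · exact IsUnit.of_mul_eq_one _ (wEnd_mul_wInv a)
  · rw [mul_assoc, hUU, mul_one]
  · change _ * _ = _ * _
    rw [mul_assoc, hUU, mul_one, ← mul_assoc, ← hwU, mul_assoc, hUU', mul_one]
  · rw [siegel_pow QPlus_vv hnv, CharP.cast_eq_zero, zero_smul, siegel_zero]
  · rw [hU']
    refine hrZ K hKKK hcK hwK ?_ ?_
    · rw [hK, hn, wedge_smul_right, smul_smul, mul_div_cancel₀ _ hg]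
    · rw [hKK, smul_smul, mul_neg, mul_div_cancel₀ _ hg]

theorem siegel_vv_mem (p : ℕ) [Fact p.Prime] [CharP F p] {a : F} (h2 : (2 : F) ≠ 0) (ha0 : a ≠ 0)
    (ha2 : a + 2 ≠ 0) (ha1 : a - 1 ≠ 0) (h5 : a ^ 2 + 5 * a + 5 ≠ 0) (hm : 2 * a ^ 2 - 5 ≠ 0)
    (hg : 81 - 68 * a ^ 2 - 16 * a ^ 3 + 4 * a ^ 4 ≠ 0) (hX : xEnd a ∈ H) (hY : yEnd ∈ H) :
    siegel vv ((2 * a * (a + 2) / (81 - 68 * a ^ 2 - 16 * a ^ 3 + 4 * a ^ 4)) • nv a) ∈ H := by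
  have hg' : (2 : F) + 2 * (14 - 12 * a ^ 2 - 4 * a ^ 3) +
      (51 - 44 * a ^ 2 - 8 * a ^ 3 + 4 * a ^ 4) =
      81 - 68 * a ^ 2 - 16 * a ^ 3 + 4 * a ^ 4 := by ring
  refine siegel_vv_mem_of_separable p h2 hg
    (separable_quintic (b := 14 - 12 * a ^ 2 - 4 * a ^ 3)
      (d := 51 - 44 * a ^ 2 - 8 * a ^ 3 + 4 * a ^ 4) ?_ ?_ ?_)
    (fun K hKKK hcK hwK hK hKK => aeval_quintic_of_commute (mul_inv_cancel₀ h2) (wEnd_mul_wInv a)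
      (wInv_mul_wEnd a) hKKK hcK hwK ?_ rfl) hX hY
  · rw [hg']; exact hg
  · have h : (2 : F) - 2 * (14 - 12 * a ^ 2 - 4 * a ^ 3) +
        (51 - 44 * a ^ 2 - 8 * a ^ 3 + 4 * a ^ 4) = (2 * a ^ 2 - 5) ^ 2 := by ring
    rw [h]; exact pow_ne_zero 2 hm
  · have h : (14 - 12 * a ^ 2 - 4 * a ^ 3) ^ 2 -
        4 * (51 - 44 * a ^ 2 - 8 * a ^ 3 + 4 * a ^ 4 - 2) =
        2 * 2 * 2 * 2 * a ^ 2 * (a - 1) * (a + 2) * (a ^ 2 + 5 * a + 5) := by ring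
    rw [h]
    exact mul_ne_zero (mul_ne_zero (mul_ne_zero (mul_ne_zero (mul_ne_zero (mul_ne_zero
      (mul_ne_zero h2 h2) h2) h2) (pow_ne_zero 2 ha0)) ha1) ha2) h5
  · rw [hg', wEnd_quintic, smul_add, smul_comm _ (2 : F)⁻¹, hK, hKK]
    match_scalars <;> field_simp
    ring

end Extract

section LinkedPair

variable {F : Type*} [Field F]

theorem siegel_eq_siegel_of_wedge_eq {v n v' n' : Fin 8 → F} (hn : QPlus F n = 0)
    (hn' : QPlus F n' = 0) (h : wedge v n = wedge v' n') : siegel v n = siegel v' n' := by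
  rw [siegel_eq_one_add_wedge v hn, siegel_eq_one_add_wedge v' hn', h]

variable [Finite F] {H : Submonoid (Module.End F (Fin 8 → F))}

theorem opposite_mem_of_commute (p : ℕ) [Fact p.Prime] [CharP F p]
    {s s' b : Module.End F (Fin 8 → F)} {Δ t t' : F} (hs : s * s = 0) (hs' : s' * s' = 0)
    (h : s * s' * s = Δ • s) (h' : s' * s * s' = Δ • s') (hb : b * b = 0) (hsb : Commute s b)
    (hsb' : Commute s' b) (hΔ : Δ ≠ 0) (hΔ4 : Δ + 4 ≠ 0) (hu : (1 + s) * (1 + t • b) ∈ H)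
    (hu' : (1 + s') * (1 + t' • b) ∈ H) : 1 + (t + t') • b ∈ H := by
  have hsmul (c : F) : (c • b) * (c • b) = 0 := by rw [smul_mul_smul_comm, hb, smul_zero]
  have hunit {n : Module.End F (Fin 8 → F)} (hn : n * n = 0) : IsUnit (1 + n) :=
    IsUnit.of_mul_eq_one (1 - n) (by rw [mul_sub, mul_one, add_mul, one_mul, hn]; abel)
  have hc (c : F) : Commute (1 + s) (1 + c • b) :=
    (Commute.one_left _).add_left ((Commute.one_right _).add_right (hsb.smul_right c))
  have hc' (c : F) : Commute (1 + s') (1 + c • b) :=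
    (Commute.one_left _).add_left ((Commute.one_right _).add_right (hsb'.smul_right c))
  have ht : (1 + t • b) * (1 + t' • b) = 1 + (t + t') • b := by
    rw [mul_add, mul_one, add_mul, one_mul, smul_mul_smul_comm, hb]
    module
  refine unipotent_part_mem p (mul_mem hu hu') (((hunit hs).mul (hunit (hsmul t))).mul
    ((hunit hs').mul (hunit (hsmul t')))) ?_ ((hc (t + t')).mul_left (hc' (t + t')))
    (one_add_pow_char (F := F) p (hsmul _))
    (separable_cubic (τ := 2 + Δ) (by simpa using hΔ) ?_) ?_
  · rw [← ht, mul_assoc, mul_assoc, ← mul_assoc (1 + t • b), ← (hc' t).eq, mul_assoc]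
  · convert hΔ4 using 1; ring
  · rw [aeval_cubic]
    exact opposite_cubic hs hs' h h'

/-- Two Siegel elements with orthogonal singular first vectors, each of whose second vectors is
linked to the first vector of the other one. -/
theorem exists_mem_of_linked (p : ℕ) [Fact p.Prime] [CharP F p] (h2 : (2 : F) ≠ 0)
    (h3 : (3 : F) ≠ 0) {v w n m : Fin 8 → F} {β : F} (hv : QPlus F v = 0) (hw : QPlus F w = 0)
    (hvw : polarForm v w = 0) (hnv : polarForm n v = 0) (hmw : polarForm m w = 0)
    (hnw : polarForm n w = β) (hmv : polarForm m v = β) (hβ : β ≠ 0) (hm : QPlus F m = QPlus F n)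
    (hn : QPlus F n ≠ 0) (h : siegel v n ∈ H) (h' : siegel w m ∈ H) :
    ∃ c : F, c ≠ 0 ∧ siegel v (c • w) ∈ H := by
  set t := QPlus F n / β with ht
  have htβ : t * β = QPlus F n := div_mul_cancel₀ _ hβ
  have ht0 : t ≠ 0 := div_ne_zero hn hβ
  have hwv : polarForm w v = 0 := by rw [polarForm_comm, hvw]
  have hvv : polarForm v v = 0 := by rw [polarForm_self, hv, mul_zero]
  have hww : polarForm w w = 0 := by rw [polarForm_self, hw, mul_zero]
  have hvn : polarForm v n = 0 := by rw [polarForm_comm, hnv]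
  have hwm : polarForm w m = 0 := by rw [polarForm_comm, hmw]
  have hwn : polarForm w n = β := by rw [polarForm_comm, hnw]
  have hvm : polarForm v m = β := by rw [polarForm_comm, hmv]
  have hnn : polarForm n n = 2 * (t * β) := by rw [polarForm_self, htβ]
  have hmm : polarForm m m = 2 * (t * β) := by rw [polarForm_self, hm, htβ]
  have hn' : QPlus F (n - t • w) = 0 := by
    rw [sub_eq_add_neg, QPlus_add, QPlus_neg, QPlus_smul, hw, ← htβ]
    simp [hnw]
  have hm' : QPlus F (m - t • v) = 0 := by
    rw [sub_eq_add_neg, QPlus_add, QPlus_neg, QPlus_smul, hv, hm, ← htβ]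
    simp [hmv]
  have key (j : F) (hj : j * β ^ 2 ≠ 0) (hj4 : j * β ^ 2 + 4 ≠ 0) (hjm : siegel w (j • m) ∈ H) :
      siegel v ((t + -(j * t)) • w) ∈ H := by
    rw [siegel_eq_one_add_wedge v (by rw [QPlus_smul, hw, mul_zero]), wedge_smul_right]
    refine opposite_mem_of_commute (s := wedge v (n - t • w)) (s' := wedge w (j • (m - t • v)))
      (Δ := j * β ^ 2) p ?_ ?_ ?_ ?_ ?_ ?_ ?_ hj hj4 ?_ ?_
    · refine wedge_mul_wedge hvv (by simp [hvn, hvw]) (by simp [hnv, hwv]) ?_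
      rw [polarForm_self, hn', mul_zero]
    · refine wedge_mul_wedge hww (by simp [hwm, hwv]) (by simp [hmw, hvw]) ?_
      rw [polarForm_self, QPlus_smul, hm', mul_zero, mul_zero]
    · rw [wedge_opposite _ _ (by simp [hvn, hvw])]
      simp [hvw, hvm, hvv, hnw, hww]
      congr 1; ring
    · rw [wedge_opposite _ _ (by simp [hwm, hwv])]
      simp [hwv, hwn, hww, hmv, hvv]
      congr 1; ring
    · exact wedge_mul_wedge hvv hvw hwv hww
    · refine LinearMap.ext fun z => ?_
      simp [Module.End.mul_apply, wedge_apply, hvv, hvw, hwv, hww, hvn, hnv, hnw, hwn]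
    · refine LinearMap.ext fun z => ?_
      simp [Module.End.mul_apply, wedge_apply, hvv, hvw, hwv, hww, hvm, hmv, hmw, hwm]
      module
    · have e : siegel v n = siegel v (n - t • w) * siegel v (t • w) := by
        rw [siegel_mul hv (by simp [hnv, hwv]) (by simp [hwv]), sub_add_cancel]
      rw [e, siegel_eq_one_add_wedge v hn', siegel_eq_one_add_wedge v (by rw [QPlus_smul, hw,
        mul_zero]), wedge_smul_right t v] at h
      exact h
    · have e : siegel w (j • m) = siegel w (j • (m - t • v)) * siegel w ((j * t) • v) := by
        rw [siegel_mul hw (by simp [hmw, hvw]) (by simp [hvw])]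
        congr 1; module
      rw [e, siegel_eq_one_add_wedge w (by rw [QPlus_smul, hm', mul_zero]),
        siegel_eq_one_add_wedge w (by rw [QPlus_smul, hv, mul_zero]), wedge_smul_right (j * t) w,
        wedge_comm v w, smul_neg, ← neg_smul] at hjm
      exact hjm
  have hβ2 : β ^ 2 ≠ 0 := pow_ne_zero 2 hβ
  by_cases h4 : β ^ 2 = 4
  · refine ⟨_, ?_, key 2 (mul_ne_zero h2 hβ2) ?_ ?_⟩
    · have e : t + -(2 * t) = -t := by ring
      rw [e]; exact neg_ne_zero.mpr ht0
    · have e : 2 * β ^ 2 + 4 = 2 * 2 * 3 := by rw [h4]; norm_num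
      rw [e]; exact mul_ne_zero (mul_ne_zero h2 h2) h3
    · rw [two_smul]; exact siegel_add_mem hw hmw hmw h' h'
  · refine ⟨_, ?_, key (-1) (by simpa using hβ) ?_ ?_⟩
    · have e : t + -(-1 * t) = 2 * t := by ring
      rw [e]; exact mul_ne_zero h2 ht0
    · intro h0; exact h4 (by linear_combination -h0)
    · rw [neg_one_smul]; exact siegel_neg_mem hw hmw h'

end LinkedPair

section Chain

variable {F : Type*} [Field F]

/-- The image of `vv` under `y⁻¹ * x * y`. -/
def vh (a : F) : Fin 8 → F := ![0, -1, 1, 0, 0, 1 - a, 1 - a, -1]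

/-- The image of `vh a` under `y⁻¹ * x * y * x * y⁻¹ * x * y⁻¹`. -/
def vk (a : F) : Fin 8 → F :=
  ![2 - 3 * a + 2 * a ^ 2 + 2 * a ^ 3, 1 + a + 2 * a ^ 2, -1 - a ^ 2, 1, -2 * a - a ^ 2,
    -4 * a + 4 * a ^ 2 + 3 * a ^ 3, -1 - 6 * a + 5 * a ^ 2 + 4 * a ^ 3, -1 + 2 * a]

/-- The image of `vv` under `x * y * x`. -/
def vl (a : F) : Fin 8 → F := ![0, -1, 1 - a, 1, 0, 0, -1, 1 - a]

/-- The image of `vh a` under `x * y * x`. -/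
def vr (a : F) : Fin 8 → F :=
  ![2 + a - a ^ 2, -1, 4 - a ^ 2, 0, 0, 0, 0, 4 - a ^ 2]

theorem yxy_vv (a : F) : yEnd (yEnd (xEnd a (yEnd vv))) = vh a := by
  funext i
  fin_cases i <;> simp [xEnd_apply, yEnd_apply, vv, vh] <;> ring

theorem yxy_vh (a : F) : yEnd (yEnd (xEnd a (yEnd (vh a)))) = vv := by
  funext i
  fin_cases i <;> simp [xEnd_apply, yEnd_apply, vv, vh]
  all_goals ring

theorem xEnd_vv (a : F) : xEnd a vv = vv := by
  funext i
  fin_cases i <;> simp [xEnd_apply, vv]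
  norm_num

theorem xEnd_yEnd_vv (a : F) : xEnd a (yEnd vv) = vl a := by
  funext i
  fin_cases i <;> simp [xEnd_apply, yEnd_apply, vv, vl] <;> ring

theorem xyx_vh (a : F) : xEnd a (yEnd (xEnd a (vh a))) = vr a := by
  funext i
  fin_cases i <;> simp [xEnd_apply, yEnd_apply, vr, vh] <;> ring

theorem longWord_vv (a : F) :
    yEnd (yEnd (xEnd a (yEnd (xEnd a (yEnd (yEnd (xEnd a (yEnd (yEnd vv))))))))) = yEnd vv := by
  have h : xEnd a (yEnd (yEnd (xEnd a (yEnd (yEnd vv))))) = ![0, 0, 0, 0, -1, 1, 0, -1] := by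
    funext i
    fin_cases i <;> simp [xEnd_apply, yEnd_apply, vv]
  rw [h]
  funext i
  fin_cases i <;> simp [xEnd_apply, yEnd_apply, vv]
  norm_num

theorem longWord_vh (a : F) :
    yEnd (yEnd (xEnd a (yEnd (xEnd a (yEnd (yEnd (xEnd a (yEnd (yEnd (vh a)))))))))) = vk a := by
  have h : xEnd a (yEnd (yEnd (xEnd a (yEnd (yEnd (vh a)))))) =
      ![1 - 2 * a, 1 - a, -1 - a ^ 2, a, -1 + a + a ^ 2, 3 - 2 * a ^ 2, 2 - 2 * a - 2 * a ^ 2,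
        -2 + 3 * a - 2 * a ^ 2 - 2 * a ^ 3] := by
    funext i
    fin_cases i <;> simp [xEnd_apply, yEnd_apply, vh] <;> ring
  rw [h]
  funext i
  fin_cases i <;> simp [xEnd_apply, yEnd_apply, vk] <;> ring

variable [Finite F] {H : Submonoid (Module.End F (Fin 8 → F))}

theorem siegel_commutator_mem_of_isotropic {v w n m : Fin 8 → F} (hv : QPlus F v = 0)
    (hw : QPlus F w = 0) (hvw : polarForm v w = 0) (hnv : polarForm n v = 0)
    (hmw : polarForm m w = 0) (hnw : polarForm n w = 0) (hmv : polarForm m v = 0)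
    (h : siegel v n ∈ H) (h' : siegel w m ∈ H) : siegel v (polarForm n m • w) ∈ H := by
  have e : siegel v n * siegel w m * siegel v (-n) * siegel w (-m) =
      siegel v (polarForm n m • w) := by
    have hvv : polarForm v v = 0 := by rw [polarForm_self, hv, mul_zero]
    have hww : polarForm w w = 0 := by rw [polarForm_self, hw, mul_zero]
    have hwv : polarForm w v = 0 := by rw [polarForm_comm, hvw]
    have hvn : polarForm v n = 0 := by rw [polarForm_comm, hnv]
    have hwm : polarForm w m = 0 := by rw [polarForm_comm, hmw]
    have hwn : polarForm w n = 0 := by rw [polarForm_comm, hnw]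
    have hvm : polarForm v m = 0 := by rw [polarForm_comm, hmv]
    refine LinearMap.ext fun z => ?_
    simp only [Module.End.mul_apply, siegel_apply, polarForm_add_left, polarForm_sub_left,
      polarForm_smul_left, polarForm_neg_left, polarForm_neg_right, polarForm_smul_right, QPlus_neg,
      QPlus_smul, hv, hw, hvv, hww, hvw, hwv, hnv, hvn, hmw, hwm, hnw, hwn, hmv, hvm,
      polarForm_self, polarForm_comm m n]
    module
  rw [← e]
  exact H.mul_mem (H.mul_mem (H.mul_mem h h') (siegel_neg_mem hv hnv h)) (siegel_neg_mem hw hmw h')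

theorem exists_siegel_vv_vh_mem_of_nv (p : ℕ) [Fact p.Prime] [CharP F p] {a l : F}
    (h2 : (2 : F) ≠ 0) (h3 : (3 : F) ≠ 0) (ha1 : a - 1 ≠ 0)
    (hg : 81 - 68 * a ^ 2 - 16 * a ^ 3 + 4 * a ^ 4 ≠ 0) (hl : l ≠ 0)
    (hβ : 18 - 25 * a - 2 * a ^ 2 + 8 * a ^ 3 = 0 →
      -18 - 36 * a - 70 * a ^ 2 + 184 * a ^ 3 + 60 * a ^ 4 - 88 * a ^ 5 - 32 * a ^ 6 ≠ 0)
    (hX : xEnd a ∈ H) (hY : yEnd ∈ H) (h : siegel vv (l • nv a) ∈ H) :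
    ∃ c : F, c ≠ 0 ∧ siegel vv (c • vh a) ∈ H := by
  have h' := siegel_yEnd_mem hY (siegel_yEnd_mem hY (siegel_xEnd_mem hX (siegel_yEnd_mem hY h)))
  set g : Module.End F (Fin 8 → F) := yEnd * (yEnd * (xEnd a * yEnd)) with hgdef
  have hgp : Preserves g := yEnd_preserves.mul (yEnd_preserves.mul
    ((xEnd_preserves a).mul yEnd_preserves))
  have hgv : g vv = vh a := yxy_vv a
  have hgw : g (vh a) = vv := yxy_vh a
  change siegel (g vv) (g (l • nv a)) ∈ H at h'
  have hnw : polarForm (l • nv a) (vh a) = l * (18 - 25 * a - 2 * a ^ 2 + 8 * a ^ 3) := by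
    rw [polarForm_smul_left]
    congr 1
    simp [polarForm, nv, vh]; ring
  have hw : QPlus F (vh a) = 0 := by simp [QPlus, vh]
  have hvw : polarForm vv (vh a) = 0 := by simp [polarForm, vv, vh]
  have hnv : polarForm (l • nv a) vv = 0 := by
    rw [polarForm_smul_left, polarForm_nv_vv, mul_zero]
  have hmw : polarForm (g (l • nv a)) (vh a) = 0 := by rw [← hgv, hgp.polarForm, hnv]
  have hmv : polarForm (g (l • nv a)) vv = l * (18 - 25 * a - 2 * a ^ 2 + 8 * a ^ 3) := by
    rw [← hgw, hgp.polarForm, hnw]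
  rw [hgv] at h'
  by_cases h0 : 18 - 25 * a - 2 * a ^ 2 + 8 * a ^ 3 = 0
  · rw [h0, mul_zero] at hnw hmv
    refine ⟨_, ?_, siegel_commutator_mem_of_isotropic QPlus_vv hw hvw hnv hmw hnw hmv h h'⟩
    have e : polarForm (l • nv a) (g (l • nv a)) = l * l * (-18 - 36 * a - 70 * a ^ 2 +
        184 * a ^ 3 + 60 * a ^ 4 - 88 * a ^ 5 - 32 * a ^ 6) := by
      have e' : g (nv a) = ![-9 + 4 * a + 6 * a ^ 2, -18 + 5 * a + 12 * a ^ 2 + 2 * a ^ 3,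
          3 + 3 * a - 4 * a ^ 2 - 2 * a ^ 3, -12 + 6 * a + 6 * a ^ 2, 15 - 8 * a - 8 * a ^ 2,
          -3 - a - a ^ 2 + 4 * a ^ 3 + 2 * a ^ 4, -18 * a + 5 * a ^ 2 + 12 * a ^ 3 + 2 * a ^ 4,
          0] := by
        change yEnd (yEnd (xEnd a (yEnd (nv a)))) = _
        funext i
        fin_cases i <;> simp [xEnd_apply, yEnd_apply, nv] <;> ring
      rw [map_smul, polarForm_smul_left, polarForm_smul_right, ← mul_assoc, e']
      congr 1
      simp [polarForm, nv]; ring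
    rw [e]
    exact mul_ne_zero (mul_ne_zero hl hl) (hβ h0)
  · refine exists_mem_of_linked p h2 h3 QPlus_vv hw hvw hnv hmw hnw hmv (mul_ne_zero hl h0)
      (hgp _) ?_ h h'
    rw [QPlus_smul, QPlus_nv]
    exact mul_ne_zero (pow_ne_zero 2 hl) (mul_ne_zero ha1 hg)

theorem exists_siegel_vv_vh_mem (p : ℕ) [Fact p.Prime] [CharP F p] {a : F} (h2 : (2 : F) ≠ 0)
    (h3 : (3 : F) ≠ 0) (ha0 : a ≠ 0) (ha2 : a + 2 ≠ 0) (ha1 : a - 1 ≠ 0)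
    (h5 : a ^ 2 + 5 * a + 5 ≠ 0) (hm : 2 * a ^ 2 - 5 ≠ 0)
    (hg : 81 - 68 * a ^ 2 - 16 * a ^ 3 + 4 * a ^ 4 ≠ 0)
    (hβ : 18 - 25 * a - 2 * a ^ 2 + 8 * a ^ 3 = 0 →
      -18 - 36 * a - 70 * a ^ 2 + 184 * a ^ 3 + 60 * a ^ 4 - 88 * a ^ 5 - 32 * a ^ 6 ≠ 0)
    (hX : xEnd a ∈ H) (hY : yEnd ∈ H) : ∃ c : F, c ≠ 0 ∧ siegel vv (c • vh a) ∈ H := by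
  have h := siegel_vv_mem p h2 ha0 ha2 ha1 h5 hm hg hX hY
  have hl : 2 * a * (a + 2) / (81 - 68 * a ^ 2 - 16 * a ^ 3 + 4 * a ^ 4) ≠ 0 :=
    div_ne_zero (mul_ne_zero (mul_ne_zero h2 ha0) ha2) hg
  generalize 2 * a * (a + 2) / (81 - 68 * a ^ 2 - 16 * a ^ 3 + 4 * a ^ 4) = l at h hl
  exact exists_siegel_vv_vh_mem_of_nv p h2 h3 ha1 hg hl hβ hX hY h

/-- The long root element attached to `⟨e1, mv 0⟩` from the one attached to `⟨vv, vh a⟩`. -/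
theorem exists_siegel_e1_of_vv {a c : F} (h2 : (2 : F) ≠ 0) (ha0 : a ≠ 0) (ha2 : a + 2 ≠ 0)
    (ha2' : a - 2 ≠ 0) (ha1 : a - 1 ≠ 0) (hr : a ^ 2 - a - 3 ≠ 0) (hc : c ≠ 0) (hX : xEnd a ∈ H)
    (hY : yEnd ∈ H) (h : siegel vv (c • vh a) ∈ H) : ∃ t : F, t ≠ 0 ∧ siegel e1 (t • mv 0) ∈ H := by
  have hy {v n : Fin 8 → F} (h : siegel v n ∈ H) := siegel_yEnd_mem hY (siegel_yEnd_mem hY h)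
  have hP := hy (siegel_xEnd_mem hX (siegel_yEnd_mem hY (siegel_xEnd_mem hX (hy
    (siegel_xEnd_mem hX (hy h))))))
  have hR := siegel_xEnd_mem hX (siegel_yEnd_mem hY (siegel_xEnd_mem hX h))
  simp only [map_smul, longWord_vv, longWord_vh, xEnd_vv, xEnd_yEnd_vv, xyx_vh] at hP hR
  set s := (a ^ 2 - 3) • vl a - a • vr a with hs
  have hyv : yEnd (vv : Fin 8 → F) = ![1, 0, 0, 1, 0, 0, -1, 0] := by
    funext i; fin_cases i <;> simp [yEnd_apply, vv]
  have ql : QPlus F (vl a) = 0 := by simp [QPlus, vl]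
  have qr : QPlus F (vr a) = 0 := by simp [QPlus, vr]
  have hlr : polarForm (vl a) (vr a) = 0 := by simp [polarForm, vl, vr]
  have hll : polarForm (vl a) (vl a) = 0 := by rw [polarForm_self, ql, mul_zero]
  have hrl : polarForm (vr a) (vl a) = 0 := by rw [polarForm_comm, hlr]
  have qs : QPlus F s = 0 := by
    rw [hs, sub_eq_add_neg, QPlus_add, QPlus_neg, QPlus_smul, QPlus_smul, ql, qr]
    simp [hlr]
  have hR' : siegel s ((c / a) • vl a) ∈ H := by
    convert hR using 1
    refine siegel_eq_siegel_of_wedge_eq (by rw [QPlus_smul, ql, mul_zero])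
      (by rw [QPlus_smul, qr, mul_zero]) ?_
    rw [hs, wedge_smul_right, wedge_smul_right, wedge_sub_left, wedge_smul_left, wedge_smul_left,
      wedge_self, wedge_comm]
    match_scalars; field_simp
  have qk : QPlus F (vk a) = 0 := by simp [QPlus, vk]; ring
  have qy : QPlus F (yEnd vv) = 0 := by rw [yEnd_preserves, QPlus_vv]
  have hky : polarForm (vk a) (yEnd vv) = 0 := by rw [hyv]; simp [polarForm, vk]; ring
  have hyl : polarForm (yEnd vv) (vl a) = 0 := by rw [hyv]; simp [polarForm, vl]
  have hyr : polarForm (yEnd vv) (vr a) = 0 := by rw [hyv]; simp [polarForm, vr]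
  have hkl : polarForm (vk a) (vl a) = -(2 * 2 * a ^ 2 * (a + 2) * (a - 1)) := by
    simp [polarForm, vk, vl]; ring
  have hkr : polarForm (vk a) (vr a) = -(2 * 2 * a * (a + 2) * (a - 1) * (a ^ 2 - 3)) := by
    simp [polarForm, vk, vr]; ring
  have hA := siegel_commutator_mem (q := yEnd vv) (p := c • vk a) (s := s) (r := (c / a) • vl a)
    (by rw [QPlus_smul, qk, mul_zero]) qy (by rw [QPlus_smul, ql, mul_zero]) qs (by simp [hky])
    (by simp [hs, hll, hlr]) (by simp [hyl]) (by simp [hs, hyl, hyr])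
    (by simp only [hs, polarForm_smul_left, polarForm_sub_right, polarForm_smul_right, hkl, hkr]
        ring) hP hR'
  have hk : s = (a ^ 2 - a - 3) • (mv 0 + (a - 1) • e1) + (a ^ 2 - 3) • yEnd vv := by
    rw [hyv]
    funext i
    simp only [hs, Pi.add_apply, Pi.sub_apply, Pi.smul_apply]
    fin_cases i <;> simp [vl, vr, mv, e1] <;> ring
  set k : Fin 8 → F := mv 0 + (a - 1) • e1 with hkdef
  clear_value k
  have hyk : polarForm k (yEnd vv) = 0 := by
    rw [hyv, hkdef]; simp [polarForm, mv, e1]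
  have qk' : QPlus F k = 0 := by rw [hkdef, QPlus_add]; simp [QPlus_smul]
  have hA' : ∃ d : F, d ≠ 0 ∧ siegel (yEnd vv) (d • k) ∈ H := by
    refine ⟨polarForm (c • vk a) ((c / a) • vl a) * (a ^ 2 - a - 3), mul_ne_zero ?_ hr, ?_⟩
    · rw [polarForm_smul_left, polarForm_smul_right, hkl]
      exact mul_ne_zero hc (mul_ne_zero (div_ne_zero hc ha0) (neg_ne_zero.mpr (mul_ne_zero
        (mul_ne_zero (mul_ne_zero (mul_ne_zero h2 h2) (pow_ne_zero 2 ha0)) ha2) ha1)))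
    · rw [hk, smul_add, smul_smul, smul_smul, siegel_add_smul_self qy (by simp [hyk])] at hA
      exact hA
  obtain ⟨d, hd, hA'⟩ := hA'
  have hxA := siegel_xEnd_mem hX hA'
  have hxk : xEnd a k = e1 + (a - 1) • mv 0 := by rw [hkdef]; simp
  rw [xEnd_yEnd_vv, map_smul, hxk] at hxA
  set l : Fin 8 → F := e1 + (a - 1) • mv 0 with hldef
  clear_value l
  have ql' : QPlus F l = 0 := by rw [hldef, QPlus_add]; simp [QPlus_smul]
  set u : Fin 8 → F := vh a + (-2 : F) • vv with hudef
  have hvh : QPlus F (vh a) = 0 := by simp [QPlus, vh]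
  have hhv : polarForm (vh a) vv = 0 := by simp [polarForm, vh, vv]
  have qu : QPlus F u = 0 := by rw [hudef, QPlus_add, QPlus_smul, hvh, QPlus_vv]; simp [hhv]
  have hW : siegel vv (c • u) ∈ H := by
    rw [hudef, smul_add, smul_smul, siegel_add_smul_self QPlus_vv (by simp [hhv])]
    exact h
  have hkv : polarForm k vv = 0 := by rw [hkdef]; simp [polarForm, mv, e1, vv]
  have hkh : polarForm k (vh a) = 0 := by rw [hkdef]; simp [polarForm, mv, e1, vh]
  have hyv1 : polarForm (yEnd vv : Fin 8 → F) vv = -1 := by rw [hyv]; simp [polarForm, vv]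
  have hyh : polarForm (yEnd vv) (vh a) = -2 := by rw [hyv]; simp [polarForm, vh]; ring
  have hvu : polarForm vv u = 0 := by
    rw [hudef]; simp [polarForm_self, QPlus_vv, polarForm_comm vv, hhv]
  have hku : polarForm k u = 0 := by rw [hudef]; simp [hkv, hkh]
  have hyu : polarForm (yEnd vv) u = 0 := by rw [hudef]; simp [hyv1, hyh]
  have hul : polarForm u l = 0 := by rw [hudef, hldef]; simp [polarForm, mv, e1, vh, vv]; ring
  have hkvl : polarForm k (vl a) = 0 := by rw [hkdef]; simp [polarForm, mv, e1, vl]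
  have hkl' : polarForm k l = 0 := by rw [hkdef, hldef]; simp
  have huvl : polarForm u (vl a) = a * (a - 1) := by
    rw [hudef]; simp [polarForm, vh, vv, vl]; ring
  have hlvl : polarForm (vl a) l = 0 := by rw [hldef]; simp [polarForm, mv, e1, vl]
  clear_value u
  have hB := siegel_commutator_mem (q := k) (p := (-d) • yEnd vv) (s := u) (r := (-c) • vv)
    (by simp [QPlus_neg, QPlus_smul, qy]) qk' (by simp [QPlus_neg, QPlus_smul, QPlus_vv]) qu
    (by simp [polarForm_comm _ k, hyk]) (by simp [hvu]) (by simp [hkv]) hku (by simp [hyu])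
    (by
      rw [neg_smul, ← siegel_swap (by simp [QPlus_neg, QPlus_smul, qy]) qk', siegel_smul_left]
      exact hA')
    (by
      rw [neg_smul, ← siegel_swap (by simp [QPlus_neg, QPlus_smul, QPlus_vv]) qu, siegel_smul_left]
      exact hW)
  have hC := siegel_commutator_mem (q := k) (s := l) (r := (-d) • vl a)
    (by simp [QPlus_neg, QPlus_smul, qu]) qk' (by simp [QPlus_neg, QPlus_smul, ql]) ql'
    (by simp [polarForm_comm u k, hku]) (by simp [hlvl]) (by simp [hkvl]) hkl' (by simp [hul]) hB
    (by
      rw [neg_smul, ← siegel_swap (by simp [QPlus_neg, QPlus_smul, ql]) ql', siegel_smul_left]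
      exact hxA)
  simp only [polarForm_smul_left, polarForm_smul_right, hyv1, huvl] at hC
  refine ⟨-d * (-c * -1) * (-d * (a * (a - 1))) * (a * (a - 2)), ?_, ?_⟩
  · refine mul_ne_zero (mul_ne_zero (mul_ne_zero (neg_ne_zero.mpr hd) ?_)
      (mul_ne_zero (neg_ne_zero.mpr hd) (mul_ne_zero ha0 ha1))) (mul_ne_zero ha0 ha2')
    simpa using hc
  · convert hC using 1
    refine siegel_eq_siegel_of_wedge_eq (by simp [QPlus_smul]) (by simp [QPlus_smul, ql']) ?_
    rw [wedge_smul_right, wedge_smul_right, hkdef, hldef]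
    simp only [wedge_add_left, wedge_add_right, wedge_smul_left, wedge_smul_right, wedge_self,
      wedge_comm e1 (mv 0)]
    module

end Chain

section Degenerate

open Polynomial

variable {F : Type*} [Field F]

theorem wEnd_sub_wInv_apply (a : F) (z : Fin 8 → F) :
    (wEnd a - wInv a) z = ![-(1 - 2 * a - a ^ 2) * z 0 - (1 + 2 * a + a ^ 2) * z 1 - (4 * a +
        2 * a ^ 2) * z 2 + (4 - 6 * a ^ 2 - 2 * a ^ 3) * z 3 - (4 - 4 * a - 4 * a ^ 2) * z 5 +
        (1 - 2 * a - 4 * a ^ 2 - a ^ 3) * z 6 - (1 - 7 * a - 4 * a ^ 2) * z 7,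
      (5 * a + 3 * a ^ 2) * z 0 + (2 - 5 * a - 3 * a ^ 2) * z 1 + (2 - 10 * a -
        6 * a ^ 2) * z 2 + (6 + 2 * a - 12 * a ^ 2 - 6 * a ^ 3) * z 3 + (4 - 4 * a -
        4 * a ^ 2) * z 4 + (3 - a - 7 * a ^ 2 - 3 * a ^ 3) * z 6 - (1 - 7 * a - 4 * a ^ 2) * z 7,
      -(2 + 2 * a + a ^ 2) * z 0 - (a + a ^ 2) * z 1 + (2 + a) * z 2 - (1 - 3 * a -
        2 * a ^ 2) * z 3 - (1 - 2 * a - 4 * a ^ 2 - a ^ 3) * z 4 - (3 - a - 7 * a ^ 2 -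
        3 * a ^ 3) * z 5 - (3 - 3 * a - 6 * a ^ 2 - 2 * a ^ 3) * z 7,
      (4 + 6 * a + 2 * a ^ 2) * z 0 + (2 - 2 * a - 2 * a ^ 2) * z 1 - (2 + 8 * a +
        4 * a ^ 2) * z 2 + (3 - 4 * a - 10 * a ^ 2 - 4 * a ^ 3) * z 3 + (1 - 7 * a -
        4 * a ^ 2) * z 4 + (1 - 7 * a - 4 * a ^ 2) * z 5 + (3 - 3 * a - 6 * a ^ 2 -
        2 * a ^ 3) * z 6,
      (3 + 2 * a) * z 1 + (3 + 2 * a) * z 2 - (1 - 2 * a - 2 * a ^ 2) * z 3 + (1 - 2 * a -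
        a ^ 2) * z 4 - (5 * a + 3 * a ^ 2) * z 5 + (2 + 2 * a + a ^ 2) * z 6 - (4 + 6 * a +
        2 * a ^ 2) * z 7,
      -(3 + 2 * a) * z 0 + (3 + 2 * a) * z 2 + (1 + 4 * a + 2 * a ^ 2) * z 3 + (1 + 2 * a +
        a ^ 2) * z 4 - (2 - 5 * a - 3 * a ^ 2) * z 5 + (a + a ^ 2) * z 6 - (2 - 2 * a -
        2 * a ^ 2) * z 7,
      -(3 + 2 * a) * z 0 - (3 + 2 * a) * z 1 + (2 + 2 * a) * z 3 + (4 * a + 2 * a ^ 2) * z 4 -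
        (2 - 10 * a - 6 * a ^ 2) * z 5 - (2 + a) * z 6 + (2 + 8 * a + 4 * a ^ 2) * z 7,
      (1 - 2 * a - 2 * a ^ 2) * z 0 - (1 + 4 * a + 2 * a ^ 2) * z 1 - (2 + 2 * a) * z 2 - (4 -
        6 * a ^ 2 - 2 * a ^ 3) * z 4 - (6 + 2 * a - 12 * a ^ 2 - 6 * a ^ 3) * z 5 + (1 -
        3 * a - 2 * a ^ 2) * z 6 - (3 - 4 * a - 10 * a ^ 2 - 4 * a ^ 3) * z 7] := by
  rw [LinearMap.sub_apply, wEnd_apply, wInv_apply]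
  funext i
  rw [Pi.sub_apply]
  fin_cases i <;> simp <;> ring

set_option maxHeartbeats 2000000 in
theorem wEnd_quartic {a : F} (hm : 2 * a ^ 2 - 5 = 0) :
    (wEnd a - wInv a) * (wEnd a + wInv a + (14 - 12 * a ^ 2 - 4 * a ^ 3 - 2) • 1) =
      (a * (a + 2)) • wedge vv (nv a) := by
  refine LinearMap.ext fun z => ?_
  rw [Module.End.mul_apply, LinearMap.add_apply, LinearMap.smul_apply, Module.End.one_apply,
      map_add,
    map_smul]
  have hu := wEnd_add_wInv_apply a z
  generalize (wEnd a + wInv a) z = u at hu ⊢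
  rw [wEnd_sub_wInv_apply a u, wEnd_sub_wInv_apply a z, LinearMap.smul_apply, wedge_apply]
  have h0 := congrFun hu 0
  have h1 := congrFun hu 1
  have h2 := congrFun hu 2
  have h3 := congrFun hu 3
  have h4 := congrFun hu 4
  have h5 := congrFun hu 5
  have h6 := congrFun hu 6
  have h7 := congrFun hu 7
  simp only [Matrix.cons_val] at h0 h1 h2 h3 h4 h5 h6 h7
  clear hu
  funext i
  simp only [Pi.sub_apply, Pi.add_apply, Pi.smul_apply, smul_eq_mul, polarForm, vv, nv]
  fin_cases i
  · simp only [Fin.zero_eta, Fin.mk_one, Fin.reduceFinMk, Matrix.cons_val, h0, h1, h2, h3, h4, h5,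
        h6, h7]
    linear_combination (z 0 + (1 - a ^ 2) * z 1 - a ^ 2 * z 2 - (4 + 2 * a - 3 * a ^ 2) * z 3 +
        (4 - 2 * a - 2 * a ^ 2 + a ^ 3) * z 5 - (1 + 2 * a - a ^ 2) * z 6 + (1 + a) * z 7) * hm
  · simp only [Fin.zero_eta, Fin.mk_one, Fin.reduceFinMk, Matrix.cons_val, h0, h1, h2, h3, h4, h5,
        h6, h7]
    linear_combination (a * z 0 - (2 + a - a ^ 2) * z 1 - (2 + 2 * a - a ^ 2) * z 2 - (6 -
        2 * a - a ^ 2) * z 3 - (4 - 2 * a - 2 * a ^ 2 + a ^ 3) * z 4 - (3 - 3 * a +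
        a ^ 3) * z 6 + (1 + a) * z 7) * hm
  · simp only [Fin.zero_eta, Fin.mk_one, Fin.reduceFinMk, Matrix.cons_val, h0, h1, h2, h3, h4, h5,
        h6, h7]
    linear_combination (2 * z 0 + (3 * a + a ^ 2) * z 1 - (2 - 3 * a - a ^ 2) * z 2 + (1 -
        3 * a - a ^ 2) * z 3 + (1 + 2 * a - a ^ 2) * z 4 + (3 - 3 * a + a ^ 3) * z 5 + (3 -
        3 * a - 2 * a ^ 2) * z 7) * hm
  · simp only [Fin.zero_eta, Fin.mk_one, Fin.reduceFinMk, Matrix.cons_val, h0, h1, h2, h3, h4, h5,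
        h6, h7]
    linear_combination (-(4 + 2 * a) * z 0 - (2 + 2 * a) * z 1 + 2 * z 2 - (3 - 4 * a -
        2 * a ^ 2) * z 3 - (1 + a) * z 4 - (1 + a) * z 5 - (3 - 3 * a - 2 * a ^ 2) * z 6) * hm
  · simp only [Fin.zero_eta, Fin.mk_one, Fin.reduceFinMk, Matrix.cons_val, h0, h1, h2, h3, h4, h5,
        h6, h7]
    linear_combination (-(3 + 2 * a) * z 1 - (3 + 2 * a) * z 2 + (1 + 2 * a) * z 3 - z 4 -
        a * z 5 - 2 * z 6 + (4 + 2 * a) * z 7) * hm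
  · simp only [Fin.zero_eta, Fin.mk_one, Fin.reduceFinMk, Matrix.cons_val, h0, h1, h2, h3, h4, h5,
        h6, h7]
    linear_combination ((3 + 2 * a) * z 0 - (3 + 2 * a) * z 2 - (1 + 2 * a) * z 3 - (1 -
        a ^ 2) * z 4 + (2 + a - a ^ 2) * z 5 - (3 * a + a ^ 2) * z 6 + (2 + 2 * a) * z 7) * hm
  · simp only [Fin.zero_eta, Fin.mk_one, Fin.reduceFinMk, Matrix.cons_val, h0, h1, h2, h3, h4, h5,
        h6, h7]
    linear_combination ((3 + 2 * a) * z 0 + (3 + 2 * a) * z 1 - (2 + 4 * a) * z 3 +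
        a ^ 2 * z 4 + (2 + 2 * a - a ^ 2) * z 5 + (2 - 3 * a - a ^ 2) * z 6 - 2 * z 7) * hm
  · simp only [Fin.zero_eta, Fin.mk_one, Fin.reduceFinMk, Matrix.cons_val, h0, h1, h2, h3, h4, h5,
        h6, h7]
    linear_combination (-(1 + 2 * a) * z 0 + (1 + 2 * a) * z 1 + (2 + 4 * a) * z 2 + (4 +
        2 * a - 3 * a ^ 2) * z 4 + (6 - 2 * a - a ^ 2) * z 5 - (1 - 3 * a - a ^ 2) * z 6 + (3 -
        4 * a - 2 * a ^ 2) * z 7) * hm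

theorem separable_quartic {b : F} (h2 : (2 : F) ≠ 0) (hb : b ≠ 0) (hb' : b - 4 ≠ 0) :
    ((X - 1) * ((X + 1) * (X ^ 2 + C (b - 2) * X + 1)) : F[X]).Separable := by
  have hC {t : F} (ht : t ≠ 0) : C t⁻¹ * C t = (1 : F[X]) := by
    rw [← C_mul, inv_mul_cancel₀ ht, C_1]
  refine Separable.mul (by simpa using separable_X_sub_C (x := (1 : F))) (Separable.mul
    (by simpa using separable_X_sub_C (x := (-1 : F))) ?_ ?_) ?_
  · refine ⟨C (b * (b - 4))⁻¹ * (-4), C (b * (b - 4))⁻¹ * (2 * X + C (b - 2)), ?_⟩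
    have := hC (mul_ne_zero hb hb')
    generalize C (b * (b - 4))⁻¹ = k at this ⊢
    simp only [derivative_add, derivative_X_pow, derivative_mul, derivative_C, derivative_X,
      derivative_one, C_mul, C_sub, C_ofNat] at this ⊢
    simp [C_ofNat]
    linear_combination this
  · refine ⟨C (b - 4)⁻¹ * (X + C (b - 3)), -C (b - 4)⁻¹, ?_⟩
    have := hC hb'
    simp only [C_sub, C_ofNat] at this ⊢
    linear_combination this
  · refine ⟨-C (2 * b)⁻¹ * (X ^ 2 + C b * X + C (2 * b - 1)), C (2 * b)⁻¹, ?_⟩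
    have := hC (mul_ne_zero h2 hb)
    simp only [C_sub, C_mul, C_ofNat, C_1] at this ⊢
    linear_combination this

theorem quartic_of_comm {A : Type*} [CommRing A] [Algebra F A] {b h : F}
    {w w' K : A} (hh : 2 * h = 1) (hw : w * w' = 1) (hK : K * K * K = 0) (hwK : w * K = K + K * K)
    (hE : (w - w') * (w + w' + (b - 2) • 1) = (2 * b) • K) :
    (w * (1 - K + h • (K * K)) - 1) * ((w * (1 - K + h • (K * K)) + 1) *
      ((w * (1 - K + h • (K * K))) ^ 2 + (b - 2) • (w * (1 - K + h • (K * K))) + 1)) = 0 := by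
  have hh' : 2 * algebraMap F A h = 1 := by
    rw [← map_ofNat (algebraMap F A) 2, ← map_mul, hh, map_one]
  simp only [Algebra.smul_def, map_sub, map_mul, map_ofNat] at hE ⊢
  set β := algebraMap F A b
  set η := algebraMap F A h
  set Z := w * (1 - K + η * (K * K)) with hZ
  set Z' := w' * (1 + K + η * (K * K)) with hZ'
  have k0 : Z * Z' = 1 := by
    rw [hZ, hZ']
    linear_combination (1 + (2 * η - 1) * (K * K) + η ^ 2 * (K * K * K) * K) * hw +
      K * K * hh' + η ^ 2 * K * hK
  have k1 : Z * K = K := by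
    rw [hZ]; linear_combination (1 - K + η * K ^ 2) * hwK + (η * K + η - 1) * hK
  have k2 : Z' * K = K := by linear_combination K * k0 - Z' * k1
  have k3 : w = Z + K + η * (K * K) := by
    have : w = Z * (1 + K + η * (K * K)) := by
      rw [hZ]; linear_combination -w * K * K * hh' - w * η ^ 2 * K * hK
    linear_combination this + (1 + η * K) * k1
  have k4 : w' = Z' - K + η * (K * K) := by
    have : w' = Z' * (1 - K + η * (K * K)) := by
      rw [hZ']; linear_combination -w' * K * K * hh' - w' * η ^ 2 * K * hK
    linear_combination this + (η * K - 1) * k2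
  clear_value Z Z'
  have k5 : (Z - Z') * (Z + Z' + β - 2) = 0 := by
    have hT : w + w' = Z + Z' + K * K := by linear_combination k3 + k4 + K * K * hh'
    have hD : w - w' = Z - Z' + 2 * K := by linear_combination k3 - k4
    rw [hT, hD] at hE
    linear_combination hE - 2 * (k1 + k2) - K * (k1 - k2) - 2 * hK
  linear_combination Z ^ 2 * k5 + (Z * Z' + 1 + (β - 2) * Z) * k0

theorem quartic_of_commute {A : Type*} [Ring A] [Algebra F A] {b h : F}
    {w w' K : A} (hh : 2 * h = 1) (hw : w * w' = 1) (hw' : w' * w = 1) (hK : K * K * K = 0)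
    (hc : w * K = K * w) (hwK : w * K = K + K * K)
    (hE : (w - w') * (w + w' + (b - 2) • 1) = (2 * b) • K) :
    (w * (1 - K + h • (K * K)) - 1) * ((w * (1 - K + h • (K * K)) + 1) *
      ((w * (1 - K + h • (K * K))) ^ 2 + (b - 2) • (w * (1 - K + h • (K * K))) + 1)) = 0 := by
  have hc' : w' * K = K * w' := by
    calc w' * K = w' * K * (w * w') := by rw [hw, mul_one]
      _ = w' * (K * w) * w' := by simp only [mul_assoc]
      _ = (w' * w) * K * w' := by rw [← hc]; simp only [mul_assoc]
      _ = K * w' := by rw [hw', one_mul]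
  have hcomm : ∀ x ∈ ({w, w', K} : Set A), ∀ y ∈ ({w, w', K} : Set A), x * y = y * x := by
    rintro x (rfl | rfl | rfl) y (rfl | rfl | rfl) <;> first | rfl | rw [hw, hw'] | assumption |
      (symm; assumption)
  letI := Algebra.adjoinCommRingOfComm F hcomm
  have := quartic_of_comm (F := F) (b := b) (h := h)
    (w := (⟨w, Algebra.subset_adjoin (by simp)⟩ : Algebra.adjoin F {w, w', K}))
    (w' := ⟨w', Algebra.subset_adjoin (by simp)⟩) (K := ⟨K, Algebra.subset_adjoin (by simp)⟩)
    hh (Subtype.ext hw) (Subtype.ext hK) (Subtype.ext hwK) (Subtype.ext hE)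
  exact congrArg Subtype.val this

theorem aeval_quartic_of_commute {A : Type*} [Ring A] [Algebra F A] {b h : F}
    {w w' K : A} (hh : 2 * h = 1) (hw : w * w' = 1) (hw' : w' * w = 1) (hK : K * K * K = 0)
    (hc : w * K = K * w) (hwK : w * K = K + K * K)
    (hE : (w - w') * (w + w' + (b - 2) • 1) = (2 * b) • K) :
    aeval (w * (1 - K + h • (K * K)))
      ((X - 1) * ((X + 1) * (X ^ 2 + C (b - 2) * X + 1)) : F[X]) = 0 := by
  rw [← quartic_of_commute hh hw hw' hK hc hwK hE]
  simp [Algebra.smul_def]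

variable [Finite F] {H : Submonoid (Module.End F (Fin 8 → F))}

theorem siegel_vv_mem_of_degenerate (p : ℕ) [Fact p.Prime] [CharP F p] {a : F}
    (h2 : (2 : F) ≠ 0) (ha0 : a ≠ 0) (ha2 : a + 2 ≠ 0) (ha1 : a - 1 ≠ 0)
    (h5 : a ^ 2 + 5 * a + 5 ≠ 0) (hm : 2 * a ^ 2 - 5 = 0)
    (hg : 81 - 68 * a ^ 2 - 16 * a ^ 3 + 4 * a ^ 4 ≠ 0) (hX : xEnd a ∈ H) (hY : yEnd ∈ H) :
    siegel vv ((2 * a * (a + 2) / (81 - 68 * a ^ 2 - 16 * a ^ 3 + 4 * a ^ 4)) • nv a) ∈ H := by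
  have hgb : 81 - 68 * a ^ 2 - 16 * a ^ 3 + 4 * a ^ 4 =
      2 * (2 * (14 - 12 * a ^ 2 - 4 * a ^ 3)) := by linear_combination (2 * a ^ 2 - 5) * hm
  have hb : 14 - 12 * a ^ 2 - 4 * a ^ 3 ≠ 0 := by
    intro h
    exact hg (by rw [hgb, h]; ring)
  refine siegel_vv_mem_of_separable p h2 hg
    (separable_quartic (b := 14 - 12 * a ^ 2 - 4 * a ^ 3) h2 hb ?_)
    (fun K hKKK hcK hwK hK hKK => aeval_quartic_of_commute (mul_inv_cancel₀ h2) (wEnd_mul_wInv a)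
      (wInv_mul_wEnd a) hKKK hcK hwK ?_) hX hY
  · intro h
    have h' : 2 * 2 * 2 * 2 * a ^ 2 * (a - 1) * (a + 2) * (a ^ 2 + 5 * a + 5) = 0 := by
      linear_combination (10 - 12 * a ^ 2 - 4 * a ^ 3) * h - 4 * (2 * a ^ 2 - 5) * hm
    revert h'
    exact mul_ne_zero (mul_ne_zero (mul_ne_zero (mul_ne_zero (mul_ne_zero (mul_ne_zero
      (mul_ne_zero h2 h2) h2) h2) (pow_ne_zero 2 ha0)) ha1) ha2) h5
  · have hK' : (2 : F) • (2 * (14 - 12 * a ^ 2 - 4 * a ^ 3)) • K =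
        (2 : F) • (a * (a + 2)) • wedge vv (nv a) := by
      rw [smul_smul, ← hgb, hK]; module
    rw [wEnd_quartic hm]
    exact (smul_right_injective _ h2 hK').symm

end Degenerate

/-- A row of an `8 × 8` matrix with natural number entries. -/
structure ModRow where
  (c0 c1 c2 c3 c4 c5 c6 c7 : ℕ)
  deriving DecidableEq

/-- An `8 × 8` matrix with natural number entries, standing for a matrix over a field of positive
characteristic. -/
structure ModMat where
  (r0 r1 r2 r3 r4 r5 r6 r7 : ModRow)
  deriving DecidableEq

namespace ModMat

/-- Evaluates `n` before passing it on. -/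
def force (n : ℕ) (k : ℕ → Bool) : Bool := Nat.casesOn n (k 0) fun m => k (Nat.succ m)

theorem force_eq (n : ℕ) (k : ℕ → Bool) : force n k = k n := by cases n <;> rfl

/-- The product of a row and a matrix, reduced modulo `p`. -/
def rowMul (p : ℕ) (r : ModRow) (B : ModMat) : ModRow :=
  match r with
  | ⟨c0, c1, c2, c3, c4, c5, c6, c7⟩ =>
    ⟨(c0 * B.r0.c0 + c1 * B.r1.c0 + c2 * B.r2.c0 + c3 * B.r3.c0 + c4 * B.r4.c0
        + c5 * B.r5.c0 + c6 * B.r6.c0 + c7 * B.r7.c0) % p,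
      (c0 * B.r0.c1 + c1 * B.r1.c1 + c2 * B.r2.c1 + c3 * B.r3.c1 + c4 * B.r4.c1
        + c5 * B.r5.c1 + c6 * B.r6.c1 + c7 * B.r7.c1) % p,
      (c0 * B.r0.c2 + c1 * B.r1.c2 + c2 * B.r2.c2 + c3 * B.r3.c2 + c4 * B.r4.c2
        + c5 * B.r5.c2 + c6 * B.r6.c2 + c7 * B.r7.c2) % p,
      (c0 * B.r0.c3 + c1 * B.r1.c3 + c2 * B.r2.c3 + c3 * B.r3.c3 + c4 * B.r4.c3
        + c5 * B.r5.c3 + c6 * B.r6.c3 + c7 * B.r7.c3) % p,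
      (c0 * B.r0.c4 + c1 * B.r1.c4 + c2 * B.r2.c4 + c3 * B.r3.c4 + c4 * B.r4.c4
        + c5 * B.r5.c4 + c6 * B.r6.c4 + c7 * B.r7.c4) % p,
      (c0 * B.r0.c5 + c1 * B.r1.c5 + c2 * B.r2.c5 + c3 * B.r3.c5 + c4 * B.r4.c5
        + c5 * B.r5.c5 + c6 * B.r6.c5 + c7 * B.r7.c5) % p,
      (c0 * B.r0.c6 + c1 * B.r1.c6 + c2 * B.r2.c6 + c3 * B.r3.c6 + c4 * B.r4.c6
        + c5 * B.r5.c6 + c6 * B.r6.c6 + c7 * B.r7.c6) % p,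
      (c0 * B.r0.c7 + c1 * B.r1.c7 + c2 * B.r2.c7 + c3 * B.r3.c7 + c4 * B.r4.c7
        + c5 * B.r5.c7 + c6 * B.r6.c7 + c7 * B.r7.c7) % p⟩

/-- Evaluates the entries of a row before passing it on. -/
def forceRow (r : ModRow) (k : ModRow → Bool) : Bool :=
  match r with
  | ⟨c0, c1, c2, c3, c4, c5, c6, c7⟩ =>
    force c0 fun c0 => force c1 fun c1 => force c2 fun c2 => force c3 fun c3 =>
      force c4 fun c4 => force c5 fun c5 => force c6 fun c6 => force c7 fun c7 =>
        k ⟨c0, c1, c2, c3, c4, c5, c6, c7⟩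

theorem forceRow_eq (r : ModRow) (k : ModRow → Bool) : forceRow r k = k r := by
  simp [forceRow, force_eq]

/-- The product of two matrices, reduced modulo `p`. -/
def mul (p : ℕ) (A B : ModMat) : ModMat :=
  ⟨rowMul p A.r0 B, rowMul p A.r1 B, rowMul p A.r2 B, rowMul p A.r3 B,
    rowMul p A.r4 B, rowMul p A.r5 B, rowMul p A.r6 B, rowMul p A.r7 B⟩

/-- Evaluates the product of two matrices modulo `p` before passing it on. -/
def mulThen (p : ℕ) (A B : ModMat) (k : ModMat → Bool) : Bool :=
  forceRow (rowMul p A.r0 B) fun r0 =>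
  forceRow (rowMul p A.r1 B) fun r1 =>
  forceRow (rowMul p A.r2 B) fun r2 =>
  forceRow (rowMul p A.r3 B) fun r3 =>
  forceRow (rowMul p A.r4 B) fun r4 =>
  forceRow (rowMul p A.r5 B) fun r5 =>
  forceRow (rowMul p A.r6 B) fun r6 =>
  forceRow (rowMul p A.r7 B) fun r7 =>
  k ⟨r0, r1, r2, r3, r4, r5, r6, r7⟩

theorem mulThen_eq (p : ℕ) (A B : ModMat) (k : ModMat → Bool) :
    mulThen p A B k = k (mul p A B) := by
  simp [mulThen, forceRow_eq, mul]

/-- Evaluates `C * A ^ n` by repeated squaring before passing it on. -/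
def powThen (p : ℕ) (k : ModMat → Bool) : ℕ → ModMat → ModMat → ℕ → Bool
  | 0, _, C, _ => k C
  | i + 1, A, C, n =>
    match n with
    | 0 => k C
    | m + 1 => mulThen p A A fun A' =>
      cond (((m + 1) % 2).beq 0) (powThen p k i A' C ((m + 1) / 2))
        (mulThen p C A fun C' => powThen p k i A' C' ((m + 1) / 2))

/-- The identity matrix. -/
def one : ModMat :=
  ⟨⟨1, 0, 0, 0, 0, 0, 0, 0⟩,
    ⟨0, 1, 0, 0, 0, 0, 0, 0⟩,
    ⟨0, 0, 1, 0, 0, 0, 0, 0⟩,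
    ⟨0, 0, 0, 1, 0, 0, 0, 0⟩,
    ⟨0, 0, 0, 0, 1, 0, 0, 0⟩,
    ⟨0, 0, 0, 0, 0, 1, 0, 0⟩,
    ⟨0, 0, 0, 0, 0, 0, 1, 0⟩,
    ⟨0, 0, 0, 0, 0, 0, 0, 1⟩⟩

/-- The matrix of `xEnd a`, where `m` stands for `-1`. -/
def x (m a : ℕ) : ModMat :=
  ⟨⟨0, m, 0, 0, 0, 0, 0, 0⟩,
    ⟨m, 0, 0, 0, 0, 0, 0, 0⟩,
    ⟨1, m, m, m * a, 0, 0, 0, 0⟩,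
    ⟨0, 0, 0, 1, 0, 0, 0, 0⟩,
    ⟨0, 0, 0, 1, 0, m, 1, 0⟩,
    ⟨0, 0, 0, m, m, 0, m, 0⟩,
    ⟨0, 0, 0, m * 2, 0, 0, m, 0⟩,
    ⟨1, m, m * 2, m * (2 * a), 0, 0, m * a, 1⟩⟩

/-- The matrix of `yEnd`. -/
def y : ModMat :=
  ⟨⟨1, 0, 0, 0, 0, 0, 0, 0⟩,
    ⟨0, 0, 0, 0, 0, 0, 0, 1⟩,
    ⟨0, 0, 0, 0, 0, 1, 0, 0⟩,
    ⟨0, 0, 1, 0, 0, 0, 0, 0⟩,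
    ⟨0, 0, 0, 0, 1, 0, 0, 0⟩,
    ⟨0, 0, 0, 1, 0, 0, 0, 0⟩,
    ⟨0, 1, 0, 0, 0, 0, 0, 0⟩,
    ⟨0, 0, 0, 0, 0, 0, 1, 0⟩⟩

/-- The matrix of `siegel e1 (mv 0)`, where `m` stands for `-1`. -/
def root (m : ℕ) : ModMat :=
  ⟨⟨1, 0, 0, m, 0, 1, m, 0⟩,
    ⟨0, 1, 0, 0, m, 0, 0, 0⟩,
    ⟨0, 0, 1, 0, 1, 0, 0, 0⟩,
    ⟨0, 0, 0, 1, 0, 0, 0, 0⟩,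
    ⟨0, 0, 0, 0, 1, 0, 0, 0⟩,
    ⟨0, 0, 0, 0, 0, 1, 0, 0⟩,
    ⟨0, 0, 0, 0, 0, 0, 1, 0⟩,
    ⟨0, 0, 0, 0, 1, 0, 0, 1⟩⟩

/-- One step of a straight line program: store the product of two stored matrices, or a power of a
stored matrix. -/
inductive Step where
  | prod (i j : ℕ)
  | power (i n : ℕ)

/-- Runs a straight line program and compares the last stored matrix with `T`. -/
def run (p : ℕ) (T : ModMat) : List Step → List ModMat → Bool
  | [], l => decide (l.head? = some T)
  | .prod i j :: s, l => mulThen p (l.getD i one) (l.getD j one) fun M => run p T s (M :: l)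
  | .power i n :: s, l => powThen p (fun M => run p T s (M :: l)) 100 (l.getD i one) one n

end ModMat

namespace ModMat

variable (F : Type*) [Field F]

/-- The linear form given by a row. -/
def rowForm (r : ModRow) (z : Fin 8 → F) : F :=
  r.c0 * z 0 + r.c1 * z 1 + r.c2 * z 2 + r.c3 * z 3 + r.c4 * z 4 + r.c5 * z 5 + r.c6 * z 6
    + r.c7 * z 7

/-- The endomorphism given by a matrix with natural number entries. -/
def toEnd (A : ModMat) : Module.End F (Fin 8 → F) where
  toFun z := ![rowForm F A.r0 z, rowForm F A.r1 z, rowForm F A.r2 z, rowForm F A.r3 z,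
    rowForm F A.r4 z, rowForm F A.r5 z, rowForm F A.r6 z, rowForm F A.r7 z]
  map_add' z w := by
    funext i; fin_cases i <;> simp [rowForm] <;> ring
  map_smul' c z := by
    funext i; fin_cases i <;> simp [rowForm] <;> ring

theorem toEnd_apply (A : ModMat) (z : Fin 8 → F) :
    toEnd F A z = ![rowForm F A.r0 z, rowForm F A.r1 z, rowForm F A.r2 z, rowForm F A.r3 z,
      rowForm F A.r4 z, rowForm F A.r5 z, rowForm F A.r6 z, rowForm F A.r7 z] := rfl

theorem rowForm_rowMul (p : ℕ) [CharP F p] (r : ModRow) (B : ModMat) (z : Fin 8 → F) :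
    rowForm F (rowMul p r B) z = rowForm F r (toEnd F B z) := by
  have h (n : ℕ) : ((n % p : ℕ) : F) = n := (CharP.cast_eq_mod F p n).symm
  simp [rowForm, rowMul, h, toEnd_apply]
  ring

theorem toEnd_mul (p : ℕ) [CharP F p] (A B : ModMat) :
    toEnd F (mul p A B) = toEnd F A * toEnd F B := by
  refine LinearMap.ext fun z => ?_
  rw [Module.End.mul_apply, toEnd_apply, toEnd_apply F A]
  simp only [mul, rowForm_rowMul]

theorem toEnd_one : toEnd F one = 1 := by
  refine LinearMap.ext fun z => ?_
  funext i
  fin_cases i <;> simp [toEnd_apply, rowForm, one]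

theorem toEnd_x {m a : ℕ} (hm : (m : F) = -1) : toEnd F (x m a) = xEnd (a : F) := by
  refine LinearMap.ext fun z => ?_
  rw [xEnd_apply]
  funext i
  fin_cases i <;> simp [toEnd_apply, rowForm, x, hm] <;> ring

theorem toEnd_y : toEnd F y = yEnd := by
  refine LinearMap.ext fun z => ?_
  rw [yEnd_apply]
  funext i
  fin_cases i <;> simp [toEnd_apply, rowForm, y]

theorem toEnd_root {m : ℕ} (hm : (m : F) = -1) : toEnd F (root m) = siegel e1 (mv 0) := by
  refine LinearMap.ext fun z => ?_
  rw [siegel_apply]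
  funext i
  simp only [Pi.sub_apply, Pi.add_apply, Pi.smul_apply]
  fin_cases i <;> simp [toEnd_apply, rowForm, root, hm, e1, mv, polarForm, QPlus] <;> ring

variable {F} {H : Submonoid (Module.End F (Fin 8 → F))}

theorem exists_of_powThen (p : ℕ) [CharP F p] {k : ModMat → Bool} (i : ℕ) {A C : ModMat} {n : ℕ}
    (hA : toEnd F A ∈ H) (hC : toEnd F C ∈ H) (h : powThen p k i A C n = true) :
    ∃ M, toEnd F M ∈ H ∧ k M = true := by
  induction i generalizing A C n with
  | zero => exact ⟨C, hC, h⟩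
  | succ i ih =>
    cases n with
    | zero => exact ⟨C, hC, h⟩
    | succ m =>
      have hAA : toEnd F (mul p A A) ∈ H := by rw [toEnd_mul]; exact mul_mem hA hA
      have hCA : toEnd F (mul p C A) ∈ H := by rw [toEnd_mul]; exact mul_mem hC hA
      simp only [powThen, mulThen_eq] at h
      cases hb : ((m + 1) % 2).beq 0 <;> rw [hb] at h
      · exact ih hAA hCA h
      · exact ih hAA hC h

theorem toEnd_mem_of_run (p : ℕ) [CharP F p] {T : ModMat} (s : List Step) {l : List ModMat}
    (hl : ∀ M ∈ l, toEnd F M ∈ H) (h : run p T s l = true) : toEnd F T ∈ H := by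
  have hget {l : List ModMat} (hl : ∀ M ∈ l, toEnd F M ∈ H) (i : ℕ) :
      toEnd F (l.getD i one) ∈ H := by
    by_cases hi : i < l.length
    · rw [List.getD_eq_getElem _ _ hi]
      exact hl _ (List.getElem_mem hi)
    · rw [List.getD_eq_default _ _ (not_lt.mp hi), toEnd_one]
      exact one_mem H
  induction s generalizing l with
  | nil => exact hl _ (List.mem_of_head? (of_decide_eq_true h))
  | cons st s ih =>
    cases st with
    | prod i j =>
      simp only [run, mulThen_eq] at h
      refine ih (List.forall_mem_cons.mpr ⟨?_, hl⟩) h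
      rw [toEnd_mul]
      exact mul_mem (hget hl i) (hget hl j)
    | power i n =>
      obtain ⟨M, hM, hk⟩ := exists_of_powThen p 100 (hget hl i)
        (by rw [toEnd_one]; exact one_mem H) h
      exact ih (List.forall_mem_cons.mpr ⟨hM, hl⟩) hk

/-- A program which computes the root element from `x` and `y` shows that it lies in every monoid
containing them. -/
theorem siegel_e1_mv_mem_of_run (p : ℕ) [CharP F p] {m b : ℕ} {s : List Step}
    (h : run p (root m) s [y, x m b] = true) (hm : (m : F) = -1) {a : F} (hab : a = b)
    (hX : xEnd a ∈ H) (hY : yEnd ∈ H) : siegel e1 (mv 0) ∈ H := by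
  rw [← toEnd_root F hm]
  refine toEnd_mem_of_run p s (fun M hM => ?_) h
  simp only [List.mem_cons, List.not_mem_nil, or_false] at hM
  rcases hM with rfl | rfl
  · rw [toEnd_y]; exact hY
  · rw [toEnd_x F hm, ← hab]; exact hX

end ModMat

namespace ModMat

/-- A program computing the root element for `a = 1` in characteristic `13`. -/
def rootProgram13 : List Step := [
    .prod 0 0, .prod 2 1, .prod 3 1, .prod 1 1, .prod 0 2, .prod 0 2, .prod 0 3, .power 0 14,
    .prod 8 9, .prod 0 1, .prod 0 7, .prod 12 3, .prod 0 13, .power 0 8, .prod 3 0, .power 2 5,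
    .power 5 12, .prod 1 0, .prod 3 7, .prod 0 1, .prod 5 3, .prod 0 3, .prod 14 2, .power 15 12,
    .prod 0 2, .prod 2 0, .prod 25 27, .prod 0 19, .prod 0 26, .power 16 12, .power 1 4,
    .prod 1 0, .power 3 9, .prod 0 20, .prod 2 23, .prod 0 1, .prod 4 19, .prod 0 3, .prod 30 2,
    .prod 15 1, .prod 1 0, .power 30 6, .prod 0 26, .power 32 7, .prod 30 0, .prod 2 16,
    .prod 0 1, .power 18 12, .prod 5 0, .prod 0 4, .prod 42 3, .prod 27 1, .prod 1 0, .prod 26 52,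
    .prod 0 55, .prod 0 47, .prod 54 57, .prod 0 57, .prod 2 0, .prod 50 59, .prod 0 61,
    .prod 0 53, .prod 59 63, .prod 0 62, .prod 2 0, .power 6 2, .prod 7 0, .power 8 11,
    .power 9 12, .prod 1 0, .prod 3 5, .prod 0 1, .power 7 12, .prod 6 0, .prod 0 4, .prod 67 3,
    .prod 52 1, .prod 1 0, .prod 12 19, .prod 10 11, .prod 1 15, .prod 0 1, .prod 3 9, .prod 0 3,
    .prod 58 2, .power 59 12, .prod 0 2, .prod 2 0, .power 80 11, .power 48 2, .prod 1 0,
    .prod 0 38, .power 14 11, .prod 1 0, .power 6 3, .prod 1 0, .power 88 2, .power 56 11,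
    .prod 1 0, .power 46 12, .prod 1 0, .power 23 2, .prod 1 0, .power 15 10, .prod 1 0,
    .prod 106 9, .prod 0 107, .prod 108 2, .prod 0 109, .power 101 3, .power 69 10, .prod 1 0,
    .power 59 5, .prod 1 0, .power 36 3, .prod 1 0, .power 28 2, .prod 1 0, .prod 11 0,
    .prod 0 10]

set_option maxRecDepth 100000 in
theorem run_rootProgram13 :
    run 13 (root 12) rootProgram13 [y, x 12 1] = true := by
  decide +kernel

/-- A program computing the root element for `a = 37` in characteristic `61`. -/
def rootProgram61 : List Step := [
    .prod 0 0, .prod 2 1, .prod 3 1, .prod 1 1, .prod 0 2, .prod 0 3, .prod 0 4, .prod 0 4,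
    .prod 0 6, .prod 0 6, .power 0 372, .prod 12 0, .prod 0 13, .prod 13 14, .prod 0 3,
    .prod 0 12, .prod 15 17, .prod 0 6, .prod 0 16, .power 6 4, .power 4 38, .prod 1 0,
    .power 6 23, .power 10 57, .prod 1 0, .prod 3 6, .prod 0 1, .power 8 60, .prod 6 0, .prod 0 4,
    .prod 19 3, .power 20 60, .prod 0 2, .prod 2 0, .power 21 15, .prod 0 12, .power 23 46,
    .prod 16 0, .prod 2 19, .prod 0 1, .prod 4 12, .prod 0 3, .prod 31 2, .prod 11 1, .prod 1 0,
    .prod 31 45, .prod 0 47, .prod 0 36, .prod 45 49, .prod 0 48, .prod 2 0, .power 38 13,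
    .power 1 22, .prod 1 0, .power 3 39, .power 42 48, .prod 1 0, .prod 3 38, .prod 0 1,
    .prod 5 31, .prod 0 3, .prod 50 2, .prod 30 1, .prod 1 0, .power 51 21, .power 14 30,
    .prod 1 0, .power 16 31, .power 55 40, .prod 1 0, .prod 3 51, .prod 0 1, .prod 5 44,
    .prod 0 3, .prod 63 2, .prod 43 1, .prod 1 0, .prod 13 5, .power 14 60, .prod 0 5, .prod 2 0,
    .power 70 27, .power 48 36, .prod 1 0, .power 39 34, .prod 1 0, .power 22 7, .prod 1 0,
    .power 11 52, .prod 1 0, .power 9 25, .prod 1 0, .power 81 34, .power 59 25, .prod 1 0,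
    .power 50 27, .prod 1 0, .power 33 54, .prod 1 0, .power 22 9, .prod 1 0, .power 20 36,
    .prod 1 0, .prod 104 11, .prod 0 105, .prod 106 2, .prod 0 107, .power 96 44, .power 74 18,
    .prod 1 0, .power 65 17, .prod 1 0, .power 48 34, .prod 1 0, .power 37 26, .prod 1 0,
    .power 35 43, .prod 1 0, .prod 13 0, .prod 0 12]

set_option maxRecDepth 100000 in
theorem run_rootProgram61 :
    run 61 (root 60) rootProgram61 [y, x 60 37] = true := by
  decide +kernel

/-- A program computing the root element for `a = 221` in characteristic `239`. -/
def rootProgram239 : List Step := [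
    .prod 0 0, .prod 2 1, .prod 3 1, .prod 1 1, .prod 0 2, .prod 0 3, .prod 0 3, .prod 0 5,
    .prod 0 5, .prod 0 6, .prod 0 7, .prod 0 9, .prod 0 9, .prod 0 10, .power 0 240, .prod 14 16,
    .prod 0 1, .prod 0 15, .prod 18 19, .prod 0 18, .prod 0 21, .prod 0 6, .prod 20 23,
    .prod 0 22, .prod 2 0, .prod 9 25, .prod 0 27, .prod 0 12, .prod 25 29, .prod 0 29, .prod 2 0,
    .power 13 80, .power 7 188, .prod 1 0, .power 9 51, .power 17 159, .prod 1 0, .prod 3 6,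
    .prod 0 1, .power 8 238, .prod 6 0, .prod 0 4, .prod 27 3, .power 28 238, .prod 0 2,
    .prod 2 0, .power 28 176, .power 22 39, .prod 1 0, .power 24 200, .power 32 63, .prod 1 0,
    .prod 3 21, .prod 0 1, .prod 5 14, .prod 0 3, .prod 41 2, .prod 13 1, .prod 1 0, .prod 60 44,
    .prod 0 61, .prod 42 61, .prod 0 63, .prod 0 48, .prod 35 63, .prod 1 0, .power 5 8,
    .power 1 218, .prod 1 0, .power 3 21, .power 9 231, .prod 1 0, .prod 3 54, .prod 0 1,
    .power 56 238, .prod 6 0, .prod 0 4, .prod 62 3, .prod 34 1, .prod 1 0, .power 19 230,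
    .prod 0 11, .power 21 9, .prod 15 0, .prod 2 66, .prod 0 1, .prod 4 11, .prod 0 3, .prod 73 2,
    .prod 45 1, .prod 1 0, .prod 11 5, .power 12 238, .prod 0 5, .prod 2 0, .power 80 205,
    .power 50 84, .prod 1 0, .power 39 121, .prod 1 0, .power 20 50, .prod 1 0, .power 11 179,
    .prod 1 0, .power 9 107, .prod 1 0, .power 91 34, .power 61 155, .prod 1 0, .power 50 118,
    .prod 1 0, .power 31 189, .prod 1 0, .power 22 60, .prod 1 0, .power 20 132, .prod 1 0,
    .prod 118 11, .prod 0 119, .prod 120 2, .prod 0 121, .power 106 235, .power 76 38, .prod 1 0,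
    .power 65 197, .prod 1 0, .power 46 34, .prod 1 0, .power 37 7, .prod 1 0, .power 35 111,
    .prod 1 0, .prod 13 0, .prod 0 12]

set_option maxRecDepth 100000 in
theorem run_rootProgram239 :
    run 239 (root 238) rootProgram239 [y, x 238 221] = true := by
  decide +kernel

/-- A program computing the root element for `a = 621120` in characteristic `862607`. -/
def rootProgram862607 : List Step := [
    .prod 0 0, .prod 2 1, .prod 3 1, .prod 1 1, .prod 0 2, .prod 0 3, .prod 0 3, .prod 0 5,
    .prod 0 6, .prod 0 6, .prod 0 7, .prod 0 9, .prod 0 10, .prod 0 10, .prod 0 12, .prod 0 12,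
    .prod 0 14, .prod 0 14, .prod 0 15, .prod 0 17, .prod 0 18, .prod 0 19, .prod 0 20,
    .prod 0 20, .prod 0 21, .prod 0 23, .prod 0 23, .prod 0 24, .power 0 372045418224,
    .prod 29 30, .prod 0 1, .prod 0 28, .prod 31 33, .prod 0 4, .prod 0 32, .prod 36 6,
    .prod 0 37, .power 5 582574, .power 3 377594, .prod 1 0, .power 5 485013, .power 9 280033,
    .prod 1 0, .prod 3 6, .prod 0 1, .power 8 862606, .prod 6 0, .prod 0 4, .prod 19 3,
    .power 20 862606, .prod 0 2, .prod 2 0, .power 20 724938, .power 18 124327, .prod 1 0,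
    .power 20 738280, .power 24 137669, .prod 1 0, .prod 3 21, .prod 0 1, .prod 5 14, .prod 0 3,
    .prod 33 2, .prod 13 1, .prod 1 0, .prod 62 66, .prod 0 37, .prod 65 68, .prod 1 0,
    .prod 36 69, .prod 0 71, .prod 0 42, .prod 6 72, .prod 1 0, .power 5 295100, .power 38 650149,
    .prod 1 0, .power 40 212458, .power 9 567507, .prod 1 0, .prod 3 6, .prod 0 1,
    .power 8 862606, .prod 6 0, .prod 0 4, .prod 56 3, .prod 36 1, .prod 1 0, .power 19 262977,
    .power 52 611848, .prod 1 0, .power 54 250759, .power 23 599630, .prod 1 0, .prod 3 20,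
    .prod 0 1, .prod 5 13, .prod 0 3, .prod 69 2, .prod 49 1, .prod 1 0, .power 64 442177,
    .prod 64 0, .power 66 420430, .prod 0 62, .prod 2 70, .prod 0 1, .power 72 862606, .prod 5 0,
    .prod 0 4, .prod 9 3, .power 10 862606, .prod 0 2, .prod 2 0, .power 85 203814,
    .power 63 340387, .prod 1 0, .power 52 370330, .prod 1 0, .power 31 632080, .prod 1 0,
    .power 20 809941, .prod 1 0, .power 9 774410, .prod 1 0, .power 96 658793, .power 74 522220,
    .prod 1 0, .power 63 492277, .prod 1 0, .power 42 230527, .prod 1 0, .power 31 52666,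
    .prod 1 0, .power 20 88197, .prod 1 0, .prod 137 11, .prod 0 138, .prod 139 2, .prod 0 140,
    .power 111 90289, .power 89 626017, .prod 1 0, .power 78 562757, .prod 1 0, .power 57 416392,
    .prod 1 0, .power 46 52123, .prod 1 0, .power 35 377504, .prod 1 0, .prod 13 0, .prod 0 12]

set_option maxRecDepth 100000 in
theorem run_rootProgram862607 :
    run 862607 (root 862606) rootProgram862607 [y, x 862606 621120] = true := by
  decide +kernel

end ModMat

section Exceptional

variable {F : Type*} [Field F] [Finite F] {H : Submonoid (Module.End F (Fin 8 → F))}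

theorem eq_of_cast_eq_zero (F : Type*) [Field F] (p : ℕ) [hp : Fact p.Prime] [CharP F p] {n : ℕ}
    (hn : n.Prime) (h : (n : F) = 0) : p = n :=
  (Nat.prime_dvd_prime_iff_eq hp.out hn).mp ((CharP.cast_eq_zero_iff F p n).mp h)

theorem exists_siegel_e1_of_run (p : ℕ) [Fact p.Prime] [CharP F p] {a : F} {m b : ℕ}
    {s : List ModMat.Step} (h : ModMat.run p (ModMat.root m) s [ModMat.y, ModMat.x m b] = true)
    (hm : m + 1 = p) (hab : a = b) (hX : xEnd a ∈ H) (hY : yEnd ∈ H) :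
    ∃ t : F, t ≠ 0 ∧ siegel e1 (t • mv 0) ∈ H := by
  refine ⟨1, one_ne_zero, ?_⟩
  rw [one_smul]
  refine ModMat.siegel_e1_mv_mem_of_run p h ?_ hab hX hY
  have h0 : ((m + 1 : ℕ) : F) = 0 := by rw [hm]; exact CharP.cast_eq_zero F p
  push_cast at h0
  exact eq_neg_of_add_eq_zero_left h0

theorem exists_siegel_e1_of_sq_add_self (p : ℕ) [Fact p.Prime] [CharP F p] {a : F}
    (h2 : (2 : F) ≠ 0) (h3 : (3 : F) ≠ 0) (ha0 : a ≠ 0) (ha2 : a + 2 ≠ 0) (ha2' : a - 2 ≠ 0)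
    (hη : a ^ 2 + a - 3 = 0) (hX : xEnd a ∈ H) (hY : yEnd ∈ H) :
    ∃ t : F, t ≠ 0 ∧ siegel e1 (t • mv 0) ∈ H := by
  by_cases hg : 81 - 68 * a ^ 2 - 16 * a ^ 3 + 4 * a ^ 4 = 0
  · have h8 : 8 * a + 9 = 0 := mul_left_cancel₀ h3 (by
      linear_combination -hg + (4 * a ^ 2 - 20 * a - 36) * hη)
    have h61 : (61 : F) = 0 := mul_left_cancel₀ h3 (by
      linear_combination (8 * a - 1) * h8 - 64 * hη)
    obtain rfl := eq_of_cast_eq_zero F p (n := 61) (by norm_num) (by exact_mod_cast h61)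
    refine exists_siegel_e1_of_run 61 ModMat.run_rootProgram61 rfl ?_ hX hY
    push_cast
    linear_combination 23 * h8 - (3 * a + 4) * h61
  · have ha1 : a - 1 ≠ 0 := fun h => one_ne_zero (α := F) (by
      linear_combination (a + 2) * h - hη)
    have h5 : a ^ 2 + 5 * a + 5 ≠ 0 := fun h => mul_ne_zero (mul_ne_zero h2 h2) ha2 (by
      linear_combination h - hη)
    have hm : 2 * a ^ 2 - 5 ≠ 0 := fun h => mul_ne_zero h3 h3 (by
      linear_combination -(2 * a + 3) * (h - 2 * hη) - 4 * hη)
    have hβ : 18 - 25 * a - 2 * a ^ 2 + 8 * a ^ 3 ≠ 0 := fun h => by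
      have h' : 3 * a - 4 = 0 := mul_left_cancel₀ h3 (by
        linear_combination h - (8 * a - 10) * hη)
      exact one_ne_zero (α := F) (by linear_combination 9 * hη - (3 * a + 7) * h')
    have hr : a ^ 2 - a - 3 ≠ 0 := fun h => mul_ne_zero h2 ha0 (by linear_combination hη - h)
    obtain ⟨c, hc, h⟩ := exists_siegel_vv_vh_mem p h2 h3 ha0 ha2 ha1 h5 hm hg
      (fun h => absurd h hβ) hX hY
    exact exists_siegel_e1_of_vv h2 ha0 ha2 ha2' ha1 hr hc hX hY h

theorem exists_siegel_e1_of_three_mul_sq (p : ℕ) [Fact p.Prime] [CharP F p] {a : F}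
    (h2 : (2 : F) ≠ 0) (h3 : (3 : F) ≠ 0) (ha0 : a ≠ 0) (ha2 : a + 2 ≠ 0) (ha2' : a - 2 ≠ 0)
    (hδ : 16 - 3 * a ^ 2 = 0) (hX : xEnd a ∈ H) (hY : yEnd ∈ H) :
    ∃ t : F, t ≠ 0 ∧ siegel e1 (t • mv 0) ∈ H := by
  by_cases ha1 : a - 1 = 0
  · have h13 : (13 : F) = 0 := by linear_combination hδ + 3 * (a + 1) * ha1
    obtain rfl := eq_of_cast_eq_zero F p (n := 13) (by norm_num) (by exact_mod_cast h13)
    exact exists_siegel_e1_of_run 13 ModMat.run_rootProgram13 rfl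
      (by push_cast; linear_combination ha1) hX hY
  by_cases h5 : a ^ 2 + 5 * a + 5 = 0
  · have h15 : 15 * a + 31 = 0 := by linear_combination 3 * h5 + hδ
    have h239 : (239 : F) = 0 := mul_left_cancel₀ h3 (by
      linear_combination 225 * hδ + 3 * (15 * a - 31) * h15)
    obtain rfl := eq_of_cast_eq_zero F p (n := 239) (by norm_num) (by exact_mod_cast h239)
    refine exists_siegel_e1_of_run 239 ModMat.run_rootProgram239 rfl ?_ hX hY
    push_cast
    linear_combination 16 * h15 - (a + 3) * h239
  by_cases hg : 81 - 68 * a ^ 2 - 16 * a ^ 3 + 4 * a ^ 4 = 0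
  · have h768 : 768 * a + 1511 = 0 := by
      linear_combination -9 * hg + (140 + 48 * a - 12 * a ^ 2) * hδ
    have h862607 : (862607 : F) = 0 := mul_left_cancel₀ h3 (by
      linear_combination 768 ^ 2 * hδ + 3 * (768 * a - 1511) * h768)
    obtain rfl := eq_of_cast_eq_zero F p (n := 862607) (by norm_num) (by exact_mod_cast h862607)
    refine exists_siegel_e1_of_run 862607 ModMat.run_rootProgram862607 rfl ?_ hX hY
    push_cast
    linear_combination 162862 * h768 - (145 * a + 286) * h862607
  have hr : a ^ 2 - a - 3 ≠ 0 := fun h => by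
    have h7 : 3 * a - 7 = 0 := by linear_combination -3 * h - hδ
    exact one_ne_zero (α := F) (by linear_combination -(3 * a + 7) * h7 - 3 * hδ)
  have hβ : 18 - 25 * a - 2 * a ^ 2 + 8 * a ^ 3 = 0 →
      -18 - 36 * a - 70 * a ^ 2 + 184 * a ^ 3 + 60 * a ^ 4 - 88 * a ^ 5 - 32 * a ^ 6 ≠ 0 :=
    fun h h' => by
      have h53 : 53 * a + 22 = 0 := by linear_combination 3 * h + (8 * a - 2) * hδ
      have hN : (43492 : F) = 0 := by
        linear_combination 2809 * hδ + 3 * (53 * a - 22) * h53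
      have hA : 42060 * a + 95558 = 0 := by
        linear_combination -27 * h' + (288 * a ^ 4 + 792 * a ^ 3 + 996 * a ^ 2 + 2568 * a +
            5942) * hδ
      have hM : (4139254 : F) = 0 := by
        linear_combination 53 * hA - 42060 * h53
      exact h2 (by linear_combination 668208 * hN - 7021 * hM)
  have hc : ∃ c : F, c ≠ 0 ∧ siegel vv (c • vh a) ∈ H := by
    by_cases hm : 2 * a ^ 2 - 5 = 0
    · exact exists_siegel_vv_vh_mem_of_nv p h2 h3 ha1 hg
        (div_ne_zero (mul_ne_zero (mul_ne_zero h2 ha0) ha2) hg) hβ hX hY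
        (siegel_vv_mem_of_degenerate p h2 ha0 ha2 ha1 h5 hm hg hX hY)
    · exact exists_siegel_vv_vh_mem p h2 h3 ha0 ha2 ha1 h5 hm hg hβ hX hY
  obtain ⟨c, hc, h⟩ := hc
  exact exists_siegel_e1_of_vv h2 ha0 ha2 ha2' ha1 hr hc hX hY h

/-- A monoid containing `x` and `y` contains a root element attached to `e1` and `mv 0`. -/
theorem exists_siegel_e1_mem (p : ℕ) [Fact p.Prime] [CharP F p] {a : F}
    (h2 : (2 : F) ≠ 0) (ha0 : a ≠ 0) (ha2 : a + 2 ≠ 0) (ha2' : a - 2 ≠ 0)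
    (hX : xEnd a ∈ H) (hY : yEnd ∈ H) : ∃ t : F, t ≠ 0 ∧ siegel e1 (t • mv 0) ∈ H := by
  have generic (hδ : 16 - 3 * a ^ 2 ≠ 0) (hη : a ^ 2 + a - 3 ≠ 0) :
      ∃ t : F, t ≠ 0 ∧ siegel e1 (t • mv 0) ∈ H := by
    obtain ⟨t, ht, h⟩ := exists_root_mem_of_generic p h2 ha0 ha2 ha2' hδ hη hX hY
    refine ⟨t, ht, ?_⟩
    have hQ : QPlus F (t • mv 0) = 0 := by simp [QPlus_smul]
    rwa [siegel_eq_one_add_wedge _ hQ, wedge_smul_right]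
  by_cases h3 : (3 : F) = 0
  · refine generic (fun h => ?_) (fun h => ?_)
    · exact pow_ne_zero 4 h2 (by linear_combination h + a ^ 2 * h3)
    · exact mul_ne_zero ha0 ha2' (by linear_combination h - (a - 1) * h3)
  by_cases hδ : 16 - 3 * a ^ 2 = 0
  · exact exists_siegel_e1_of_three_mul_sq p h2 h3 ha0 ha2 ha2' hδ hX hY
  by_cases hη : a ^ 2 + a - 3 = 0
  · exact exists_siegel_e1_of_sq_add_self p h2 h3 ha0 ha2 ha2' hη hX hY
  exact generic hδ hη

end Exceptional

/-- For `q = p^f ≥ 5` odd and `a ∈ 𝔽_q*` a generator of `𝔽_q` with `a ≠ ±2`,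
the matrices `x(a)` and `y` have orders 2 and 3 and generate `Ω₈⁺(q)`, the
derived subgroup of the orthogonal group of the plus-type quadratic form `Q⁺`.
In particular `Ω₈⁺(q)` is `(2,3)`-generated for all odd `q ≥ 5`. -/
theorem xPlusOdd_yPlus_generate_omega8plus
    (p f : ℕ) (hp : p.Prime) (hpodd : Odd p) (hf : 1 ≤ f)
    (F : Type*) [Field F] [Fintype F]
    (hcard : Fintype.card F = p ^ f) (hq : 5 ≤ Fintype.card F)
    (a : F) (ha0 : a ≠ 0) (ha2 : a ≠ 2) (ha2' : a ≠ -2)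
    (ha : Subfield.closure {a} = ⊤) :
    ∃ xu yu : GL (Fin 8) F,
      (xu : Matrix (Fin 8) (Fin 8) F) = xPlusOdd F a ∧
      (yu : Matrix (Fin 8) (Fin 8) F) = yPlus F ∧
      orderOf xu = 2 ∧ orderOf yu = 3 ∧
      Subgroup.closure {xu, yu} =
        Subgroup.map (orthogonalGroupOf F (QPlus F)).subtype
          (commutator ↥(orthogonalGroupOf F (QPlus F))) := by
  have : Fact p.Prime := ⟨hp⟩
  have : CharP F p := charP_of_card_eq_prime_pow hcard
  have h2 : (2 : F) ≠ 0 := fun h => by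
    obtain rfl := eq_of_cast_eq_zero F p Nat.prime_two (by exact_mod_cast h)
    exact absurd hpodd (by decide)
  have hm : a - 2 ≠ 0 := sub_ne_zero.mpr ha2
  have hm' : a + 2 ≠ 0 := fun h => ha2' (eq_neg_of_add_eq_zero_left h)
  obtain ⟨xu, hx⟩ := exists_glEnd_eq (isUnit_xEnd a)
  obtain ⟨yu, hy⟩ := exists_glEnd_eq (F := F) isUnit_yEnd
  refine ⟨xu, yu, Matrix.toLin'.injective hx, Matrix.toLin'.injective hy, orderOf_xPlusOdd h2 hx,
    orderOf_yPlus hy, closure_eq_map_commutator h2 hx hy fun H hX hY z hz => ?_⟩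
  obtain ⟨t, ht, h⟩ := exists_siegel_e1_mem p h2 ha0 hm' hm hX hY
  exact HasSiegel.of_e1 hm' hX hY (fun n hn => siegel_e1_mem h2 ha0 hm' ha hX hY ht h hn) hz
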